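/- arXiv:1310.6684 — 9 statements merged into one kernel-verified Lean document; each statement's English description precedes it below -/
import Mathlib

section
/- Let K be a field equipped with a valuation val as below, let n ≥ 2, let m₁,…,mₙ be positive integers, and let d be a positive integer with d ≥ max(m₁,…,mₙ). Let T_d ⊂ ℝ² be the triangle with vertices (0,0), (d,0), (0,d). Let p₁,…,pₙ ∈ (K∖{0})² be points whose valuation vectors val(p₁),…,val(pₙ) lie in ℤ² and are in general position with respect to T_d. If C ∈ K[x,y] is a nonzero polynomial of total degree at most d with μ_{pᵢ}(C) ≥ mᵢ for every i = 1,…,n, then d² ≥ ½·Σᵢ₌₁ⁿ mᵢ². -/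
open MvPolynomial

/-- The lattice width of a subset of `ℝ²` in the direction `u ∈ ℤ²`. -/
noncomputable def latticeWidth (u : ℤ × ℤ) (Δ : Set (ℝ × ℝ)) : ℝ :=
  sSup { w : ℝ | ∃ x ∈ Δ, ∃ y ∈ Δ, w = u.1 * (x.1 - y.1) + u.2 * (x.2 - y.2) }

/-- The minimal lattice width: the infimum over all nonzero directions `u ∈ ℤ²`. -/
noncomputable def minLatticeWidth (Δ : Set (ℝ × ℝ)) : ℝ :=
  sInf { w : ℝ | ∃ u : ℤ × ℤ, u ≠ 0 ∧ w = latticeWidth u Δ }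

/-- A (two-dimensional) convex lattice polygon in `ℝ²`. -/
def IsLatticePolygon (Δ : Set (ℝ × ℝ)) : Prop :=
  (∃ A : Finset (ℤ × ℤ),
    Δ = convexHull ℝ ((fun p : ℤ × ℤ => ((p.1 : ℝ), (p.2 : ℝ))) '' ↑A)) ∧
  (interior Δ).Nonempty

/-- The Newton polygon of a polynomial in two variables. -/
noncomputable def newtonPolygon {K : Type*} [CommRing K] (f : MvPolynomial (Fin 2) K) :
    Set (ℝ × ℝ) :=
  convexHull ℝ ((fun d : Fin 2 →₀ ℕ => ((d 0 : ℝ), (d 1 : ℝ))) '' ↑f.support)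

/-- `μ_p(f) ≥ m` : the point `p` has multiplicity at least `m` on the curve `f = 0`. -/
def multAtLeast {K : Type*} [CommRing K] (p : K × K) (m : ℕ) (f : MvPolynomial (Fin 2) K) :
    Prop :=
  f ∈ (Ideal.span {X 0 - C p.1, X 1 - C p.2} : Ideal (MvPolynomial (Fin 2) K)) ^ m

/-- The set of nonzero differences of lattice points of `Δ`. -/
def dirSet (Δ : Set (ℝ × ℝ)) : Set (ℤ × ℤ) :=
  { u | u ≠ 0 ∧ ∃ a : ℤ × ℤ, ((a.1 : ℝ), (a.2 : ℝ)) ∈ Δ ∧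
        ∃ b : ℤ × ℤ, ((b.1 : ℝ), (b.2 : ℝ)) ∈ Δ ∧ u = a - b }

/-- The tangent cone `TC^Δ(P) ⊂ ℚ²`: union over `u ∈ D(Δ)` of the lines through `P`
with normal direction `u`. -/
def tangentCone (Δ : Set (ℝ × ℝ)) (P : ℤ × ℤ) : Set (ℚ × ℚ) :=
  { q | ∃ u ∈ dirSet Δ, (u.1 : ℚ) * (q.1 - (P.1 : ℚ)) + (u.2 : ℚ) * (q.2 - (P.2 : ℚ)) = 0 }

/-- Points of `ℤ²` in general position with respect to `Δ`: no three of the tangent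
cones have a common point. -/
def InGeneralPosition (Δ : Set (ℝ × ℝ)) {n : ℕ} (P : Fin n → ℤ × ℤ) : Prop :=
  ∀ i j k : Fin n, i ≠ j → i ≠ k → j ≠ k →
    tangentCone Δ (P i) ∩ tangentCone Δ (P j) ∩ tangentCone Δ (P k) = ∅

namespace PlaneCurve

section Multiplicity

variable {K : Type*} [Field K]

/-- The coordinate change moving the point `p` to the origin. -/
noncomputable def shift (p : K × K) : MvPolynomial (Fin 2) K →ₐ[K] MvPolynomial (Fin 2) K :=
  aeval ![X 0 + C p.1, X 1 + C p.2]

lemma shift_neg_comp (p : K × K) : (shift p).comp (shift (-p)) = AlgHom.id K _ := by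
  ext i : 1
  fin_cases i <;> simp [shift]

/-- The coordinate change moving the point `p` to the origin, as an equivalence. -/
noncomputable def shiftEquiv (p : K × K) :
    MvPolynomial (Fin 2) K ≃ₐ[K] MvPolynomial (Fin 2) K :=
  AlgEquiv.ofAlgHom (shift p) (shift (-p)) (shift_neg_comp p)
    (by simpa using shift_neg_comp (-p))

lemma shiftEquiv_apply (p : K × K) (f : MvPolynomial (Fin 2) K) :
    shiftEquiv p f = shift p f := rfl

lemma shift_injective (p : K × K) : Function.Injective (shift p) :=
  (shiftEquiv p).injective

/-- The maximal ideal of the point `p`. -/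
noncomputable def pointIdeal (p : K × K) : Ideal (MvPolynomial (Fin 2) K) :=
  Ideal.span {X 0 - C p.1, X 1 - C p.2}

lemma map_pointIdeal (p : K × K) :
    (pointIdeal p).map (shiftEquiv p) = idealOfVars (Fin 2) K := by
  rw [pointIdeal, Ideal.map_span, idealOfVars]
  congr 1
  ext f
  simp [Set.image_pair, shiftEquiv_apply, shift, Fin.exists_fin_two, eq_comm]

lemma multAtLeast_iff_shift (p : K × K) (m : ℕ) (f : MvPolynomial (Fin 2) K) :
    multAtLeast p m f ↔ shift p f ∈ idealOfVars (Fin 2) K ^ m := by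
  rw [← map_pointIdeal p, ← Ideal.map_pow, ← shiftEquiv_apply]
  change f ∈ pointIdeal p ^ m ↔ _
  constructor
  · exact fun h => Ideal.mem_map_of_mem _ h
  · intro h
    obtain ⟨g, hg, hgf⟩ := (Ideal.mem_map_iff_of_surjective (shiftEquiv p)
      (shiftEquiv p).surjective).1 h
    rwa [← (shiftEquiv p).injective hgf]

lemma multAtLeast_iff_coeff (p : K × K) (m : ℕ) (f : MvPolynomial (Fin 2) K) :
    multAtLeast p m f ↔ ∀ x : Fin 2 →₀ ℕ, x.degree < m → coeff x (shift p f) = 0 := by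
  rw [multAtLeast_iff_shift, mem_pow_idealOfVars_iff']

/-- The multiplicity of the curve `f = 0` at the point `p`. -/
noncomputable def mult (p : K × K) (f : MvPolynomial (Fin 2) K) : ℕ :=
  (MvPowerSeries.order (shift p f : MvPowerSeries (Fin 2) K)).toNat

lemma coe_mult (p : K × K) {f : MvPolynomial (Fin 2) K} (hf : f ≠ 0) :
    (mult p f : ℕ∞) = MvPowerSeries.order (shift p f : MvPowerSeries (Fin 2) K) := by
  apply MvPowerSeries.ne_zero_iff_order_finite.1
  rw [Ne, ← MvPolynomial.coe_zero, MvPolynomial.coe_inj]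
  exact fun h => hf (shift_injective p (by simpa using h))

lemma multAtLeast_iff_le_mult (p : K × K) (m : ℕ) {f : MvPolynomial (Fin 2) K} (hf : f ≠ 0) :
    multAtLeast p m f ↔ m ≤ mult p f := by
  rw [multAtLeast_iff_coeff, ← Nat.cast_le (α := ℕ∞), coe_mult p hf]
  constructor
  · intro h
    exact MvPowerSeries.nat_le_order fun x hx => by simpa using h x hx
  · intro h x hx
    have := MvPowerSeries.coeff_of_lt_order
      (f := (shift p f : MvPowerSeries (Fin 2) K)) (d := x)
      (lt_of_lt_of_le (by exact_mod_cast hx) h)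
    simpa using this

lemma mult_mul (p : K × K) {f g : MvPolynomial (Fin 2) K} (hf : f ≠ 0) (hg : g ≠ 0) :
    mult p (f * g) = mult p f + mult p g := by
  rw [← Nat.cast_inj (R := ℕ∞), Nat.cast_add, coe_mult p hf, coe_mult p hg,
    coe_mult p (mul_ne_zero hf hg), map_mul, MvPolynomial.coe_mul, MvPowerSeries.order_mul]

lemma totalDegree_shift_le (p : K × K) (f : MvPolynomial (Fin 2) K) :
    (shift p f).totalDegree ≤ f.totalDegree := by
  have hX : ∀ i : Fin 2, ((![X 0 + C p.1, X 1 + C p.2] : Fin 2 → MvPolynomial (Fin 2) K)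
      i).totalDegree ≤ 1 := by
    intro i
    fin_cases i
    · exact (totalDegree_add _ _).trans (by simp)
    · exact (totalDegree_add _ _).trans (by simp)
  rw [shift, aeval_def, eval₂_eq]
  refine totalDegree_finsetSum_le fun x hx => ?_
  refine (totalDegree_mul _ _).trans ?_
  rw [algebraMap_eq, totalDegree_C, zero_add]
  refine (totalDegree_finsetProd _ _).trans ?_
  refine le_trans ?_ (le_totalDegree hx)
  rw [Finsupp.sum]
  refine Finset.sum_le_sum fun i _ => (totalDegree_pow _ _).trans ?_
  calc x i * _ ≤ x i * 1 := Nat.mul_le_mul_left _ (hX i)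
    _ = x i := mul_one _

lemma mult_le_totalDegree (p : K × K) {f : MvPolynomial (Fin 2) K} (hf : f ≠ 0) :
    mult p f ≤ f.totalDegree := by
  by_contra! h
  have h1 := (multAtLeast_iff_coeff p _ f).1 ((multAtLeast_iff_le_mult p _ hf).2 le_rfl)
  apply hf
  apply shift_injective p
  rw [map_zero]
  ext x
  rw [coeff_zero]
  rcases lt_or_ge x.degree (mult p f) with hx | hx
  · exact h1 x hx
  · apply coeff_eq_zero_of_totalDegree_lt
    calc _ ≤ f.totalDegree := totalDegree_shift_le p f
      _ < mult p f := h
      _ ≤ x.degree := hx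
      _ = _ := rfl

end Multiplicity

section Bezout

variable {K : Type*} [Field K]

/-- The exponents of total degree less than `k`. -/
noncomputable def lowDeg (k : ℕ) : Finset (Fin 2 →₀ ℕ) :=
  (Finset.range k).biUnion fun j => Finset.univ.finsuppAntidiag j

lemma mem_lowDeg {k : ℕ} {x : Fin 2 →₀ ℕ} : x ∈ lowDeg k ↔ x.degree < k := by
  simp [lowDeg, Finset.mem_finsuppAntidiag, Finsupp.degree_eq_sum]

lemma card_lowDeg (k : ℕ) : (lowDeg k).card * 2 = k * (k + 1) := by
  have h : (lowDeg k).card = ∑ j ∈ Finset.range k, (j + 1) := by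
    rw [lowDeg, Finset.card_biUnion]
    · refine Finset.sum_congr rfl fun j _ => ?_
      rw [← Finset.Nat.card_antidiagonal j]
      refine Finset.card_bij' (fun x _ => (x 0, x 1))
        (fun y _ => Finsupp.single 0 y.1 + Finsupp.single 1 y.2) ?_ ?_ ?_ ?_
      · intro x hx
        simpa [Finset.mem_finsuppAntidiag] using hx
      · intro x hx
        simpa [Finset.mem_finsuppAntidiag] using hx
      · intro x _
        ext i
        fin_cases i <;> simp
      · intro x _
        simp
    · intro i _ j _ hij
      rw [Function.onFun, Finset.disjoint_left]
      intro x hx hx'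
      rw [Finset.mem_finsuppAntidiag] at hx hx'
      exact hij (hx.1.symm.trans hx'.1)
  rw [h]
  clear h
  induction k with
  | zero => simp
  | succ k ih => rw [Finset.sum_range_succ, add_mul, ih]; ring

lemma finrank_restrictTotalDegree (N : ℕ) :
    Module.finrank K (restrictTotalDegree (Fin 2) K N) = (lowDeg (N + 1)).card := by
  have h : {x : Fin 2 →₀ ℕ | (x.sum fun _ e => e) ≤ N} = ↑(lowDeg (N + 1)) := by
    ext x
    rw [Finset.mem_coe, mem_lowDeg, Nat.lt_succ_iff]
    rfl
  rw [restrictTotalDegree, h, Module.finrank_eq_nat_card_basis (basisRestrictSupport K _),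
    Nat.card_coe_set_eq, Set.ncard_coe_finset]

/-- The Taylor coefficients of order less than `k` at `p`. -/
noncomputable def jet (p : K × K) (k : ℕ) : MvPolynomial (Fin 2) K →ₗ[K] (lowDeg k → K) :=
  LinearMap.pi fun x => (lcoeff K (x : Fin 2 →₀ ℕ)).comp (shift p).toLinearMap

lemma jet_eq_zero_iff (p : K × K) (k : ℕ) (f : MvPolynomial (Fin 2) K) :
    jet p k f = 0 ↔ multAtLeast p k f := by
  rw [multAtLeast_iff_coeff, funext_iff]
  simp only [Subtype.forall, mem_lowDeg]
  rfl

lemma jet_surjective (p : K × K) (k : ℕ) : Function.Surjective (jet p k) := by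
  intro t
  obtain ⟨f, hf⟩ := (shiftEquiv p).surjective
    (∑ x : lowDeg k, monomial (x : Fin 2 →₀ ℕ) (t x))
  refine ⟨f, funext fun x => ?_⟩
  change coeff (x : Fin 2 →₀ ℕ) (shiftEquiv p f) = _
  rw [hf, coeff_sum, Finset.sum_eq_single x]
  · simp
  · intro y _ hy
    rw [coeff_monomial, if_neg]
    exact fun h => hy (Subtype.ext h)
  · simp

lemma isCoprime_pointIdeal {p q : K × K} (h : p ≠ q) :
    IsCoprime (pointIdeal p) (pointIdeal q) := by
  rw [Ideal.isCoprime_iff_sup_eq, Ideal.eq_top_iff_one]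
  have h0 : ∀ {a b : K} {x : MvPolynomial (Fin 2) K}, a ≠ b →
      x - C a ∈ pointIdeal p → x - C b ∈ pointIdeal q →
      (1 : MvPolynomial (Fin 2) K) ∈ pointIdeal p ⊔ pointIdeal q := by
    intro a b x hab ha hb
    have h1 := (pointIdeal p ⊔ pointIdeal q).mul_mem_left (C (b - a)⁻¹)
      (sub_mem (Ideal.mem_sup_left ha) (Ideal.mem_sup_right hb))
    have h2 : (C (b - a)⁻¹ * (x - C a - (x - C b)) : MvPolynomial (Fin 2) K) = 1 := by
      rw [show x - C a - (x - C b) = C (b - a) by rw [C_sub]; ring, ← C_mul,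
        inv_mul_cancel₀ (sub_ne_zero.2 hab.symm), C_1]
    rwa [h2] at h1
  by_cases h1 : p.1 = q.1
  · have h2 : p.2 ≠ q.2 := fun h2 => h (Prod.ext h1 h2)
    exact h0 (x := X 1) h2 (Ideal.subset_span (by simp)) (Ideal.subset_span (by simp))
  · exact h0 (x := X 0) h1 (Ideal.subset_span (by simp)) (Ideal.subset_span (by simp))

variable {ι : Type*}

/-- The Taylor coefficients of order less than `k i` at all the points `p i`. -/
noncomputable def jets (p : ι → K × K) (k : ι → ℕ) :
    MvPolynomial (Fin 2) K →ₗ[K] ((i : ι) → lowDeg (k i) → K) :=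
  LinearMap.pi fun i => jet (p i) (k i)

lemma jets_eq_zero_iff (p : ι → K × K) (k : ι → ℕ) (f : MvPolynomial (Fin 2) K) :
    jets p k f = 0 ↔ ∀ i, multAtLeast (p i) (k i) f := by
  rw [funext_iff]
  exact forall_congr' fun i => jet_eq_zero_iff (p i) (k i) f

variable [Fintype ι]

lemma jets_surjective {p : ι → K × K} (hp : Function.Injective p) (k : ι → ℕ) :
    Function.Surjective (jets p k) := by
  intro t
  choose g hg using fun i => jet_surjective (p i) (k i) (t i)
  have hcop : Pairwise (Function.onFun IsCoprime fun i => pointIdeal (p i) ^ k i) :=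
    fun i j hij => (isCoprime_pointIdeal (hp.ne hij)).pow
  obtain ⟨h, hh⟩ := Ideal.pi_mkQ_surjective hcop
    (fun i => Submodule.Quotient.mk (g i))
  refine ⟨h, funext fun i => ?_⟩
  rw [← hg i]
  have h1 : h - g i ∈ pointIdeal (p i) ^ k i := by
    have := congrFun hh i
    exact (Submodule.Quotient.eq _).1 this
  have h2 : jet (p i) (k i) (h - g i) = 0 := (jet_eq_zero_iff _ _ _).2 h1
  rw [map_sub, sub_eq_zero] at h2
  exact h2

lemma finrank_jets (k : ι → ℕ) :
    Module.finrank K ((i : ι) → lowDeg (k i) → K) = ∑ i, (lowDeg (k i)).card := by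
  simp [Module.finrank_pi_fintype]

lemma exists_jets_surjective {p : ι → K × K} (hp : Function.Injective p) (k : ι → ℕ) :
    ∃ N₀, ∀ N ≥ N₀, Function.Surjective ((jets p k).domRestrict (restrictTotalDegree (Fin 2) K N)) := by
  let b := Module.finBasis K ((i : ι) → lowDeg (k i) → K)
  choose g hg using fun j => jets_surjective hp k (b j)
  refine ⟨Finset.univ.sup fun j => (g j).totalDegree, fun N hN => ?_⟩
  rw [← LinearMap.range_eq_top, eq_top_iff, ← b.span_eq, Submodule.span_le]
  rintro _ ⟨j, rfl⟩
  refine ⟨⟨g j, (mem_restrictTotalDegree _ _ _).2 (le_trans ?_ hN)⟩, hg j⟩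
  exact Finset.le_sup (f := fun j => (g j).totalDegree) (Finset.mem_univ j)

lemma finrank_le_of_exact {A W Z Y : Type*} [AddCommGroup A] [Module K A]
    [FiniteDimensional K A] [AddCommGroup W] [Module K W] [FiniteDimensional K W]
    [AddCommGroup Z] [Module K Z] [FiniteDimensional K Z] [AddCommGroup Y] [Module K Y]
    [FiniteDimensional K Y] (Θ : W →ₗ[K] Z) (Φ : W →ₗ[K] Y) (L : A →ₗ[K] W)
    (U : Submodule K Y) (hL : ∀ w, Φ w = 0 → w ∈ LinearMap.range L)
    (hU : ∀ w, Θ w = 0 → Φ w ∈ U) :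
    Module.finrank K W ≤ Module.finrank K Z + Module.finrank K A + Module.finrank K U := by
  let Φ' : LinearMap.ker Θ →ₗ[K] U :=
    (Φ.domRestrict (LinearMap.ker Θ)).codRestrict U fun w => hU w w.2
  have h1 := Θ.finrank_range_add_finrank_ker
  have h2 := Φ'.finrank_range_add_finrank_ker
  have h3 := (LinearMap.range Θ).finrank_le
  have h4 := (LinearMap.range Φ').finrank_le
  have h5 : Module.finrank K (LinearMap.ker Φ') ≤ Module.finrank K A := by
    rw [← Submodule.finrank_map_subtype_eq]
    refine le_trans (Submodule.finrank_mono ?_) L.finrank_range_le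
    rintro _ ⟨w, hw, rfl⟩
    refine hL w ?_
    have := congrArg Subtype.val (LinearMap.mem_ker.1 hw)
    exact this
  omega

/-- Bezout's inequality for plane curves with prescribed multiplicities, one of them irreducible. -/
theorem bezout {p : ι → K × K} (hp : Function.Injective p) {m n : ι → ℕ}
    {f g : MvPolynomial (Fin 2) K} (hf : Irreducible f) (hg : ¬ f ∣ g) {d e : ℕ}
    (hfd : f.totalDegree ≤ d) (hge : g.totalDegree ≤ e)
    (hfd' : d ≤ f.totalDegree)
    (hm : ∀ i, multAtLeast (p i) (m i) f) (hn : ∀ i, multAtLeast (p i) (n i) g) :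
    ∑ i, m i * n i ≤ d * e := by
  obtain ⟨N₀, hN₀⟩ := exists_jets_surjective hp (fun i => m i + n i)
  obtain ⟨M, hM⟩ : ∃ M, N₀ ≤ M + d + e := ⟨N₀, by omega⟩
  have hg0 : g ≠ 0 := by rintro rfl; exact hg (dvd_zero _)
  let V := restrictTotalDegree (Fin 2) K
  let mulV : ∀ (a b : ℕ) (h : MvPolynomial (Fin 2) K), h.totalDegree ≤ b → (V a →ₗ[K] V (a + b)) :=
    fun a b h hh => ((LinearMap.mulRight K h).domRestrict (V a)).codRestrict (V (a + b))
      fun c => (mem_restrictTotalDegree _ _ _).2 <| (totalDegree_mul _ _).trans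
        (add_le_add ((mem_restrictTotalDegree _ _ _).1 c.2) hh)
  have hV : ∀ {a b : ℕ}, a = b → V a ≤ V b := fun h => h ▸ le_rfl
  let L : V M →ₗ[K] V (M + e) × V (M + d) :=
    (mulV M e g hge).prod (-(mulV M d f hfd))
  let Φ : V (M + e) × V (M + d) →ₗ[K] V (M + d + e) :=
    ((Submodule.inclusion (hV (by omega))).comp (mulV (M + e) d f hfd)).coprod (mulV (M + d) e g hge)
  let Θ : V (M + e) × V (M + d) →ₗ[K]
      ((i : ι) → lowDeg (n i) → K) × ((i : ι) → lowDeg (m i) → K) :=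
    ((jets p n).domRestrict (V (M + e))).prodMap ((jets p m).domRestrict (V (M + d)))
  let J := (jets p fun i => m i + n i).domRestrict (V (M + d + e))
  have key := finrank_le_of_exact Θ Φ L (LinearMap.ker J) ?_ ?_
  · have h1 := J.finrank_range_add_finrank_ker
    rw [LinearMap.range_eq_top.2 (hN₀ _ hM), finrank_top, finrank_jets] at h1
    rw [Module.finrank_prod, Module.finrank_prod, finrank_jets, finrank_jets] at key
    simp only [V, finrank_restrictTotalDegree] at key h1
    have c1 := card_lowDeg (M + e + 1)
    have c2 := card_lowDeg (M + d + 1)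
    have c3 := card_lowDeg (M + d + e + 1)
    have c4 := card_lowDeg (M + 1)
    have c5 : ∑ i, (lowDeg (m i + n i)).card
        = ∑ i, (lowDeg (m i)).card + ∑ i, (lowDeg (n i)).card + ∑ i, m i * n i := by
      rw [← Finset.sum_add_distrib, ← Finset.sum_add_distrib]
      refine Finset.sum_congr rfl fun i _ => ?_
      have e1 := card_lowDeg (m i)
      have e2 := card_lowDeg (n i)
      have e3 := card_lowDeg (m i + n i)
      nlinarith
    nlinarith
  · rintro ⟨⟨a, ha⟩, ⟨b, hb⟩⟩ hw
    have hw' : a * f + b * g = 0 := congrArg Subtype.val hw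
    have hdvd : f ∣ b := by
      have : f ∣ b * g := (dvd_add_right (dvd_mul_left f a)).1 (hw' ▸ dvd_zero f)
      exact (hf.prime.dvd_or_dvd this).resolve_right hg
    obtain ⟨c, rfl⟩ := hdvd
    have hac : a = -(c * g) := by
      have : f * (a + c * g) = 0 := by rw [← hw']; ring
      rcases mul_eq_zero.1 this with h | h
      · exact absurd h hf.ne_zero
      · exact eq_neg_of_add_eq_zero_left h
    have hc : c ∈ V M := by
      rw [mem_restrictTotalDegree]
      by_cases hc0 : c = 0
      · simp [hc0]
      · have h1 := (mem_restrictTotalDegree _ _ _).1 hb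
        rw [totalDegree_mul_of_isDomain hf.ne_zero hc0] at h1
        omega
    refine ⟨-⟨c, hc⟩, ?_⟩
    refine Prod.ext (Subtype.ext ?_) (Subtype.ext ?_)
    · change -c * g = a
      rw [hac]; ring
    · change -(-c * f) = f * c
      ring
  · rintro ⟨⟨a, ha⟩, ⟨b, hb⟩⟩ hw
    have h1 : jets p n a = 0 := congrArg Prod.fst hw
    have h2 : jets p m b = 0 := congrArg Prod.snd hw
    rw [jets_eq_zero_iff] at h1 h2
    change jets p (fun i => m i + n i) (a * f + b * g) = 0
    rw [jets_eq_zero_iff]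
    intro i
    have h3 : ∀ {x y : MvPolynomial (Fin 2) K}, multAtLeast (p i) (n i) x →
        multAtLeast (p i) (m i) y → multAtLeast (p i) (m i + n i) (x * y) := by
      intro x y hx hy
      rw [multAtLeast, pow_add, mul_comm x y]
      exact Ideal.mul_mem_mul hy hx
    refine Ideal.add_mem _ (h3 (h1 i) (hm i)) ?_
    rw [mul_comm]
    exact h3 (hn i) (h2 i)

lemma exists_multAtLeast (p : ι → K × K) (n : ι → ℕ) {d : ℕ} (hd : 1 ≤ d)
    (hn : ∑ i, n i * (n i + 1) < d * (d + 1)) :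
    ∃ g : MvPolynomial (Fin 2) K, g ≠ 0 ∧ g.totalDegree ≤ d - 1 ∧
      ∀ i, multAtLeast (p i) (n i) g := by
  let J := (jets p n).domRestrict (restrictTotalDegree (Fin 2) K (d - 1))
  have h : LinearMap.ker J ≠ ⊥ := by
    apply LinearMap.ker_ne_bot_of_finrank_lt
    rw [finrank_jets, finrank_restrictTotalDegree, Nat.sub_add_cancel hd]
    have h1 := card_lowDeg d
    simp only [← card_lowDeg, ← Finset.sum_mul] at hn
    omega
  obtain ⟨⟨g, hg⟩, hgJ, hg0⟩ := (Submodule.ne_bot_iff _).1 h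
  refine ⟨g, fun h => hg0 (Subtype.ext h), (mem_restrictTotalDegree _ _ _).1 hg, ?_⟩
  exact (jets_eq_zero_iff p n g).1 hgJ

lemma sum_mul_le_of_irreducible {p : ι → K × K} (hp : Function.Injective p)
    {f : MvPolynomial (Fin 2) K} (hf : Irreducible f) (n : ι → ℕ) {d : ℕ} (hd : 1 ≤ d)
    (hfd : f.totalDegree = d) (hn : ∑ i, n i * (n i + 1) < d * (d + 1)) :
    ∑ i, mult (p i) f * n i ≤ d * (d - 1) := by
  obtain ⟨g, hg0, hgd, hgn⟩ := exists_multAtLeast p n hd hn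
  refine bezout hp hf ?_ hfd.le hgd hfd.ge
    (fun i => (multAtLeast_iff_le_mult (p i) _ hf.ne_zero).2 le_rfl) hgn
  rintro ⟨c, rfl⟩
  rw [totalDegree_mul_of_isDomain hf.ne_zero (right_ne_zero_of_mul hg0)] at hgd
  omega

end Bezout

section Numeric

variable {ι : Type*} [Fintype ι] {m : ι → ℕ} {d : ℕ}

lemma sum_mul_pred_le (hd : 1 ≤ d) (hm : ∀ i, m i ≤ d)
    (hB : ∀ n : ι → ℕ, ∑ i, n i * (n i + 1) < d * (d + 1) → ∑ i, m i * n i ≤ d * (d - 1)) :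
    ∑ i, m i * (m i - 1) ≤ d * (d - 1) := by
  classical
  have hcost : ∀ i, (m i - 1) * (m i - 1 + 1) = m i * (m i - 1) := by
    intro i
    rcases Nat.eq_zero_or_pos (m i) with h | h
    · simp [h]
    · rw [Nat.sub_add_cancel h, mul_comm]
  by_cases hA : ∑ i, m i * (m i - 1) < d * (d + 1)
  · exact hB (fun i => m i - 1) (by simpa only [hcost] using hA)
  exfalso
  let T : Finset (ι → ℕ) := (Fintype.piFinset fun i => Finset.range (m i - 1 + 1)).filter
    fun n => ∑ i, n i * (n i + 1) < d * (d + 1)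
  have hT : T.Nonempty := ⟨fun _ => 0, by simp [T]; omega⟩
  obtain ⟨n, hnT, hmax⟩ := T.exists_max_image (fun n => ∑ i, n i) hT
  simp only [T, Finset.mem_filter, Fintype.mem_piFinset, Finset.mem_range, Nat.lt_succ_iff]
    at hnT hmax
  obtain ⟨i, hi⟩ : ∃ i, n i < m i - 1 := by
    by_contra! h
    have : n = fun i => m i - 1 := funext fun i => le_antisymm (hnT.1 i) (h i)
    apply hA
    rw [this] at hnT
    simpa only [hcost] using hnT.2
  have h1 : d * (d + 1) ≤ ∑ j, n j * (n j + 1) + 2 * (n i + 1) := by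
    by_contra! h
    have h2 : ∀ g : ℕ → ℕ, ∑ j, g (Function.update n i (n i + 1) j)
        = g (n i + 1) + ∑ j ∈ Finset.univ.erase i, g (n j) := by
      intro g
      rw [← Finset.add_sum_erase _ _ (Finset.mem_univ i), Function.update_self]
      congr 1
      exact Finset.sum_congr rfl fun j hj => by
        rw [Function.update_of_ne (Finset.ne_of_mem_erase hj)]
    have h3 : ∀ g : ℕ → ℕ, ∑ j, g (n j) = g (n i) + ∑ j ∈ Finset.univ.erase i, g (n j) :=
      fun g => (Finset.add_sum_erase _ _ (Finset.mem_univ i)).symm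
    have h4 := hmax (Function.update n i (n i + 1)) ⟨fun j => ?_, ?_⟩
    · have e1 := h2 id
      have e2 := h3 id
      simp only [id] at e1 e2
      omega
    · rcases eq_or_ne j i with rfl | hj
      · rw [Function.update_self]; omega
      · rw [Function.update_of_ne hj]; exact hnT.1 j
    · rw [h2 fun a => a * (a + 1)]
      rw [h3 fun a => a * (a + 1)] at h
      nlinarith
  have h5 := hB n hnT.2
  have h6 : ∑ j, n j * (n j + 1) ≤ ∑ j, m j * n j := by
    refine Finset.sum_le_sum fun j _ => ?_
    rw [mul_comm (m j)]
    rcases Nat.eq_zero_or_pos (n j) with h | h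
    · simp [h]
    · exact Nat.mul_le_mul_left _ (by have := hnT.1 j; omega)
  have h7 := hm i
  obtain ⟨e, rfl⟩ : ∃ e, d = e + 1 := ⟨d - 1, by omega⟩
  simp only [Nat.add_sub_cancel] at h5
  have h8 : n i + 1 ≤ e := by omega
  nlinarith

lemma sum_sq_eq : ∑ i, m i ^ 2 = ∑ i, m i * (m i - 1) + ∑ i, m i := by
  rw [← Finset.sum_add_distrib]
  refine Finset.sum_congr rfl fun i _ => ?_
  rcases Nat.eq_zero_or_pos (m i) with h | h
  · simp [h]
  · obtain ⟨e, he⟩ : ∃ e, m i = e + 1 := ⟨m i - 1, by omega⟩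
    rw [he, Nat.add_sub_cancel]; ring

lemma sum_sq_le_or_sum_mul_pred_le (hd : 1 ≤ d) (hm : ∀ i, m i ≤ d)
    (hB : ∀ n : ι → ℕ, ∑ i, n i * (n i + 1) < d * (d + 1) → ∑ i, m i * n i ≤ d * (d - 1))
    (hk : d ≤ (Finset.univ.filter fun i => m i = 1).card) :
    ∑ i, m i ^ 2 ≤ d * (d - 1) ∨ ∑ i, m i * (m i - 1) + 3 * d ≤ d ^ 2 + 2 := by
  classical
  have hA := sum_mul_pred_le hd hm hB
  set A := ∑ i, m i * (m i - 1) with hAdef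
  have hdd : d * (d - 1) < d * (d + 1) := by
    apply Nat.mul_lt_mul_of_pos_left <;> omega
  let T : Finset (Finset ι) := Finset.univ.filter fun S => A + 2 * ∑ i ∈ S, m i < d * (d + 1)
  have hT : T.Nonempty := ⟨∅, by simp [T]; omega⟩
  obtain ⟨S, hST, hmax⟩ := T.exists_max_image (fun S => ∑ i ∈ S, m i) hT
  simp only [T, Finset.mem_filter, Finset.mem_univ, true_and] at hST hmax
  have hsplit : ∀ a : ι → ℕ, ∑ i, (if i ∈ S then a i else 0) = ∑ i ∈ S, a i := by
    intro a; simp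
  have hgain : A + ∑ i ∈ S, m i ≤ d * (d - 1) := by
    have h1 := hB (fun i => if i ∈ S then m i else m i - 1) ?_
    · refine le_trans (le_of_eq ?_) h1
      rw [← hsplit, hAdef, ← Finset.sum_add_distrib]
      refine Finset.sum_congr rfl fun i _ => ?_
      split_ifs
      · rcases Nat.eq_zero_or_pos (m i) with h | h
        · simp [h]
        · obtain ⟨e, he⟩ : ∃ e, m i = e + 1 := ⟨m i - 1, by omega⟩
          rw [he, Nat.add_sub_cancel]; ring
      · rfl
    · refine lt_of_le_of_lt (le_of_eq ?_) hST
      rw [← hsplit, hAdef, Finset.mul_sum, ← Finset.sum_add_distrib]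
      refine Finset.sum_congr rfl fun i _ => ?_
      rcases Nat.eq_zero_or_pos (m i) with h | h
      · simp [h]
      · obtain ⟨e, he⟩ : ∃ e, m i = e + 1 := ⟨m i - 1, by omega⟩
        split_ifs
        · rw [he, Nat.add_sub_cancel]; ring
        · rw [he, Nat.add_sub_cancel]; ring
  by_cases hall : ∀ i, i ∉ S → m i = 0
  · left
    rw [sum_sq_eq]
    refine le_trans (le_of_eq ?_) hgain
    rw [← hAdef]
    congr 1
    exact (Finset.sum_subset (Finset.subset_univ S) fun i _ hi => hall i hi).symm
  right
  push Not at hall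
  obtain ⟨j, hjS, hj0⟩ := hall
  have hfull : d * (d + 1) ≤ A + 2 * ∑ i ∈ S, m i + 2 := by
    by_contra! h
    have hsimple : ∀ i, m i = 1 → i ∈ S := by
      intro i hi
      by_contra hiS
      have := hmax (insert i S) (by rw [Finset.sum_insert hiS]; omega)
      rw [Finset.sum_insert hiS] at this
      omega
    obtain ⟨U, hU, hUcard⟩ := Finset.exists_subset_card_eq
      (s := Finset.univ.filter fun i => m i = 1) (n := m j - 1) (by have := hm j; omega)
    have hUS : U ⊆ S := fun i hi => hsimple i (Finset.mem_filter.1 (hU hi)).2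
    have hUsum : ∑ i ∈ U, m i = m j - 1 := by
      rw [← hUcard, Finset.card_eq_sum_ones]
      exact Finset.sum_congr rfl fun i hi => (Finset.mem_filter.1 (hU hi)).2
    have h1 := Finset.sum_sdiff (f := m) hUS
    have hj' : j ∉ S \ U := fun h => hjS (Finset.mem_sdiff.1 h).1
    have h2 : ∑ i ∈ insert j (S \ U), m i = ∑ i ∈ S, m i + 1 := by
      rw [Finset.sum_insert hj']; omega
    have := hmax (insert j (S \ U)) (by rw [h2]; omega)
    omega
  obtain ⟨e, rfl⟩ : ∃ e, d = e + 1 := ⟨d - 1, by omega⟩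
  simp only [Nat.add_sub_cancel] at hgain
  nlinarith

lemma sum_sq_le (hd : 2 ≤ d) (hm : ∀ i, m i ≤ d)
    (hB : ∀ n : ι → ℕ, ∑ i, n i * (n i + 1) < d * (d + 1) → ∑ i, m i * n i ≤ d * (d - 1))
    (hT : ∑ i, m i ≤ d ^ 2 + 2 * d) : ∑ i, m i ^ 2 ≤ 2 * d ^ 2 := by
  have hd1 : 1 ≤ d := by omega
  have hA := sum_mul_pred_le hd1 hm hB
  obtain ⟨e, rfl⟩ : ∃ e, d = e + 1 := ⟨d - 1, by omega⟩
  by_cases hk : e + 1 ≤ (Finset.univ.filter fun i => m i = 1).card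
  · rcases sum_sq_le_or_sum_mul_pred_le hd1 hm hB hk with h | h
    · simp only [Nat.add_sub_cancel] at h
      nlinarith
    · rw [sum_sq_eq]
      nlinarith
  · have h1 : ∑ i, m i ^ 2 ≤ 2 * ∑ i, m i * (m i - 1)
        + (Finset.univ.filter fun i => m i = 1).card := by
      rw [Finset.card_filter, Finset.mul_sum, ← Finset.sum_add_distrib]
      refine Finset.sum_le_sum fun i _ => ?_
      rcases Nat.lt_or_ge (m i) 2 with h | h
      · interval_cases m i <;> simp
      · obtain ⟨e, he⟩ : ∃ e, m i = e + 2 := ⟨m i - 2, by omega⟩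
        rw [he, show e + 2 - 1 = e + 1 by omega, if_neg (by omega)]
        nlinarith
    simp only [Nat.add_sub_cancel] at hA
    nlinarith

end Numeric

section Reduction

variable {K : Type*} [Field K] {ι : Type*} [Fintype ι]

lemma sum_add_sq_le {a b : ι → ℕ} {x y : ℕ} (ha : ∑ i, a i ^ 2 ≤ 2 * x ^ 2)
    (hb : ∑ i, b i ^ 2 ≤ 2 * y ^ 2) : ∑ i, (a i + b i) ^ 2 ≤ 2 * (x + y) ^ 2 := by
  have h1 : (∑ i, a i * b i) ^ 2 ≤ (2 * x * y) ^ 2 := by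
    refine (Finset.sum_mul_sq_le_sq_mul_sq _ _ _).trans ?_
    calc _ ≤ (2 * x ^ 2) * (2 * y ^ 2) := Nat.mul_le_mul ha hb
      _ = _ := by ring
  have h2 : ∑ i, a i * b i ≤ 2 * x * y := (Nat.pow_le_pow_iff_left two_ne_zero).1 h1
  have h3 : ∑ i, (a i + b i) ^ 2 = ∑ i, a i ^ 2 + 2 * ∑ i, a i * b i + ∑ i, b i ^ 2 := by
    rw [Finset.mul_sum, ← Finset.sum_add_distrib, ← Finset.sum_add_distrib]
    exact Finset.sum_congr rfl fun i _ => by ring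
  rw [h3]
  nlinarith

theorem sum_mult_sq_le {p : ι → K × K} (hp : Function.Injective p) {D : ℕ}
    (hlin : ∀ f : MvPolynomial (Fin 2) K, f.totalDegree = 1 → f.totalDegree ≤ D →
      ∑ i, mult (p i) f ≤ 2)
    (hsum : ∀ f : MvPolynomial (Fin 2) K, f ≠ 0 → f.totalDegree ≤ D →
      ∑ i, mult (p i) f ≤ f.totalDegree ^ 2 + 2 * f.totalDegree)
    (f : MvPolynomial (Fin 2) K) (hf : f ≠ 0) (hfD : f.totalDegree ≤ D) :
    ∑ i, mult (p i) f ^ 2 ≤ 2 * f.totalDegree ^ 2 := by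
  have hzero : ∀ f : MvPolynomial (Fin 2) K, f ≠ 0 → f.totalDegree = 0 →
      ∑ i, mult (p i) f ^ 2 ≤ 2 * f.totalDegree ^ 2 := by
    intro f hf h0
    refine le_of_eq_of_le (Finset.sum_eq_zero fun i _ => ?_) (Nat.zero_le _)
    have := mult_le_totalDegree (p i) hf
    rw [h0, Nat.le_zero] at this
    simp [this]
  revert hf hfD
  induction f using WfDvdMonoid.induction_on_irreducible with
  | zero => exact fun h => absurd rfl h
  | unit u hu =>
    intro hu0 _
    exact hzero u hu0 (isUnit_iff_totalDegree_of_isReduced.1 hu).2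
  | mul g f hg0 hf ih =>
    intro _ hD
    have hdeg := totalDegree_mul_of_isDomain hf.ne_zero hg0
    rw [hdeg] at hD ⊢
    simp only [mult_mul _ hf.ne_zero hg0]
    have hfD : f.totalDegree ≤ D := by omega
    refine sum_add_sq_le ?_ (ih hg0 (by omega))
    have hle := fun i => mult_le_totalDegree (p i) hf.ne_zero
    rcases Nat.lt_trichotomy f.totalDegree 1 with h | h | h
    · exact hzero f hf.ne_zero (by omega)
    · have h1 : ∑ i, mult (p i) f ^ 2 = ∑ i, mult (p i) f := by
        refine Finset.sum_congr rfl fun i _ => ?_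
        have := hle i
        rw [h] at this
        interval_cases mult (p i) f <;> rfl
      rw [h1, h]
      exact hlin f h hfD
    · exact sum_sq_le h hle
        (fun n hn => sum_mul_le_of_irreducible hp hf n (by omega) rfl hn)
        (hsum f hf.ne_zero hfD)

end Reduction

section FiniteDifferences

/-- All iterated differences of order `m` of the function `D` vanish. -/
def DiffZero : ℕ → (ℤ × ℤ → ℤ) → Prop
  | 0, D => ∀ v, D v = 0
  | m + 1, D => DiffZero m (fun v => D (v + (1, 0)) - D v) ∧
      DiffZero m (fun v => D (v + (0, 1)) - D v)

lemma DiffZero.zero (m : ℕ) : DiffZero m fun _ => 0 := by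
  induction m with
  | zero => exact fun _ => rfl
  | succ m ih => exact ⟨by simpa using ih, by simpa using ih⟩

lemma DiffZero.add {m : ℕ} {D E : ℤ × ℤ → ℤ} (hD : DiffZero m D) (hE : DiffZero m E) :
    DiffZero m fun v => D v + E v := by
  induction m generalizing D E with
  | zero => intro v; simp only [hD v, hE v, add_zero]
  | succ m ih =>
    refine ⟨?_, ?_⟩
    · convert ih hD.1 hE.1 using 2; ring
    · convert ih hD.2 hE.2 using 2; ring

lemma DiffZero.mul {a b c : ℕ} {D E : ℤ × ℤ → ℤ} (hD : DiffZero a D) (hE : DiffZero b E)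
    (h : a + b ≤ c + 1) : DiffZero c fun v => D v * E v := by
  induction c generalizing a b D E with
  | zero =>
    intro v
    rcases Nat.eq_zero_or_pos a with rfl | ha
    · simp only [hD v, zero_mul]
    · obtain rfl : b = 0 := by omega
      simp only [hE v, mul_zero]
  | succ c ih =>
    rcases a with _ | a
    · simpa only [funext hD, zero_mul] using DiffZero.zero (c + 1)
    rcases b with _ | b
    · simpa only [funext hE, mul_zero] using DiffZero.zero (c + 1)
    refine ⟨?_, ?_⟩
    · convert ((ih hD.1 hE (by omega)).add (ih hD.1 hE.1 (by omega))).add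
        (ih hD hE.1 (by omega)) using 2
      ring
    · convert ((ih hD.2 hE (by omega)).add (ih hD.2 hE.2 (by omega))).add
        (ih hD hE.2 (by omega)) using 2
      ring

lemma DiffZero.const (c : ℤ) : DiffZero 1 fun _ => c :=
  ⟨fun _ => sub_self c, fun _ => sub_self c⟩

lemma DiffZero.mono {a c : ℕ} {D : ℤ × ℤ → ℤ} (hD : DiffZero a D) (h : a ≤ c) :
    DiffZero c D := by
  simpa using hD.mul (DiffZero.const 1) (Nat.succ_le_succ h)

lemma DiffZero.affine (z : ℤ × ℤ) (c : ℤ) :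
    DiffZero 2 fun v => z.1 * v.1 + z.2 * v.2 + c := by
  refine ⟨?_, ?_⟩
  · convert DiffZero.const z.1 using 2
    simp; ring
  · convert DiffZero.const z.2 using 2
    simp; ring

lemma DiffZero.of_smul {m : ℕ} {c : ℤ} (hc : c ≠ 0) {D : ℤ × ℤ → ℤ}
    (h : DiffZero m fun v => c * D v) : DiffZero m D := by
  induction m generalizing D with
  | zero => exact fun v => (mul_eq_zero.1 (h v)).resolve_left hc
  | succ m ih =>
    refine ⟨ih ?_, ih ?_⟩
    · simpa only [mul_sub] using h.1
    · simpa only [mul_sub] using h.2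

lemma DiffZero.choose (z : ℤ × ℤ) (c : ℤ) (r : ℕ) :
    DiffZero (r + 1) fun v => Ring.choose (z.1 * v.1 + z.2 * v.2 + c) r := by
  refine DiffZero.of_smul (c := (r.factorial : ℤ)) (by exact_mod_cast r.factorial_ne_zero) ?_
  have h : ∀ r : ℕ, DiffZero (r + 1) fun v : ℤ × ℤ =>
      (descPochhammer ℤ r).eval (z.1 * v.1 + z.2 * v.2 + c) := by
    intro r
    induction r with
    | zero => simpa using DiffZero.const 1
    | succ r ih =>
      simp only [descPochhammer_succ_eval]
      refine ih.mul (b := 2) ?_ (by omega)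
      convert DiffZero.affine z (c - r) using 2
      ring
  convert h r using 2
  rw [Polynomial.eval_eq_smeval, Ring.descPochhammer_eq_factorial_smul_choose, nsmul_eq_mul]

/-- No function with vanishing `m`-th differences is equal to `1` at one point of `S` and to `0` at
the others. -/
def Thick (S : Finset (ℤ × ℤ)) (m : ℕ) : Prop :=
  ∀ D, DiffZero m D → ∀ v ∈ S, (∀ w ∈ S, w ≠ v → D w = 0) → D v ≠ 1

end FiniteDifferences

section Valuation

variable {K : Type*} [Field K]

/-- The exponent of a monomial as a lattice point. -/
def latticePt (x : Fin 2 →₀ ℕ) : ℤ × ℤ := (x 0, x 1)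

lemma latticePt_injective : Function.Injective latticePt := by
  intro x y h
  ext i
  have h0 : (x 0 : ℤ) = y 0 := congrArg Prod.fst h
  have h1 : (x 1 : ℤ) = y 1 := congrArg Prod.snd h
  fin_cases i
  · exact_mod_cast h0
  · exact_mod_cast h1

/-- The linear functional sending the monomial with exponent `x` to `D x * p ^ x`. -/
noncomputable def weightedEval (D : ℤ × ℤ → ℤ) (p : K × K) : MvPolynomial (Fin 2) K →ₗ[K] K :=
  (basisMonomials (Fin 2) K).constr K fun x => (D (latticePt x) : K) * (p.1 ^ x 0 * p.2 ^ x 1)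

lemma weightedEval_monomial (D : ℤ × ℤ → ℤ) (p : K × K) (x : Fin 2 →₀ ℕ) (c : K) :
    weightedEval D p (monomial x c) = c * ((D (latticePt x) : K) * (p.1 ^ x 0 * p.2 ^ x 1)) := by
  have h : monomial x c = c • basisMonomials (Fin 2) K x := by
    simp [smul_monomial]
  rw [h, map_smul, weightedEval, Module.Basis.constr_basis, smul_eq_mul]

lemma weightedEval_apply (D : ℤ × ℤ → ℤ) (p : K × K) (f : MvPolynomial (Fin 2) K) :
    weightedEval D p f = ∑ x ∈ f.support,
      coeff x f * ((D (latticePt x) : K) * (p.1 ^ x 0 * p.2 ^ x 1)) := by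
  conv_lhs => rw [f.as_sum, map_sum]
  exact Finset.sum_congr rfl fun x _ => weightedEval_monomial D p x _

lemma weightedEval_sub_mul_zero (D : ℤ × ℤ → ℤ) (p : K × K) (h : MvPolynomial (Fin 2) K) :
    weightedEval D p ((X 0 - C p.1) * h)
      = p.1 * weightedEval (fun v => D (v + (1, 0)) - D v) p h := by
  induction h using MvPolynomial.induction_on' with
  | monomial x c =>
    rw [sub_mul, map_sub, X, C_mul_monomial, monomial_mul, weightedEval_monomial,
      weightedEval_monomial, weightedEval_monomial]
    have h1 : latticePt (Finsupp.single 0 1 + x) = latticePt x + (1, 0) := by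
      simp [latticePt, add_comm]
    rw [h1]
    simp
    ring
  | add f g hf hg => rw [mul_add, map_add, hf, hg, map_add, mul_add]

lemma weightedEval_sub_mul_one (D : ℤ × ℤ → ℤ) (p : K × K) (h : MvPolynomial (Fin 2) K) :
    weightedEval D p ((X 1 - C p.2) * h)
      = p.2 * weightedEval (fun v => D (v + (0, 1)) - D v) p h := by
  induction h using MvPolynomial.induction_on' with
  | monomial x c =>
    rw [sub_mul, map_sub, X, C_mul_monomial, monomial_mul, weightedEval_monomial,
      weightedEval_monomial, weightedEval_monomial]
    have h1 : latticePt (Finsupp.single 1 1 + x) = latticePt x + (0, 1) := by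
      simp [latticePt, add_comm]
    rw [h1]
    simp
    ring
  | add f g hf hg => rw [mul_add, map_add, hf, hg, map_add, mul_add]

lemma weightedEval_eq_zero {m : ℕ} {D : ℤ × ℤ → ℤ} (hD : DiffZero m D) {p : K × K}
    {f : MvPolynomial (Fin 2) K} (hf : multAtLeast p m f) : weightedEval D p f = 0 := by
  induction m generalizing D f with
  | zero =>
    rw [weightedEval_apply]
    exact Finset.sum_eq_zero fun x _ => by rw [hD]; simp
  | succ m ih =>
    rw [multAtLeast, pow_succ'] at hf
    refine Submodule.mul_induction_on hf ?_ fun x y hx hy => by rw [map_add, hx, hy, add_zero]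
    intro r hr s hs
    obtain ⟨a, b, rfl⟩ := Ideal.mem_span_pair.1 hr
    have h1 : (a * (X 0 - C p.1) + b * (X 1 - C p.2)) * s
        = (X 0 - C p.1) * (a * s) + (X 1 - C p.2) * (b * s) := by ring
    rw [h1, map_add, weightedEval_sub_mul_zero, weightedEval_sub_mul_one,
      ih hD.1 (Ideal.mul_mem_left _ a hs), ih hD.2 (Ideal.mul_mem_left _ b hs)]
    simp

section

variable {val : K → WithBot ℚ} (hval_mul : ∀ a b : K, val (a * b) = val a + val b)
  (hval_add : ∀ a b : K, val (a + b) ≤ max (val a) (val b))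
  (hval_zero : ∀ x : K, val x = ⊥ ↔ x = 0)

include hval_mul hval_zero in
lemma val_one : val 1 = 0 := by
  have h := hval_mul 1 1
  rw [mul_one] at h
  have h0 : val 1 ≠ ⊥ := fun h => one_ne_zero ((hval_zero 1).1 h)
  obtain ⟨a, ha⟩ := WithBot.ne_bot_iff_exists.1 h0
  rw [← ha] at h ⊢
  have h' : a = a + a := by exact_mod_cast h
  have : a = 0 := by linarith
  rw [this]; rfl

include hval_mul hval_zero in
lemma val_neg (x : K) : val (-x) = val x := by
  have h1 : val (-1) = 0 := by
    have h := hval_mul (-1) (-1)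
    rw [neg_mul_neg, mul_one, val_one hval_mul hval_zero] at h
    have h0 : val (-1) ≠ ⊥ := fun h => (neg_ne_zero.2 one_ne_zero) ((hval_zero (-1)).1 h)
    obtain ⟨a, ha⟩ := WithBot.ne_bot_iff_exists.1 h0
    rw [← ha] at h ⊢
    have h' : (0 : ℚ) = a + a := by exact_mod_cast h
    have : a = 0 := by linarith
    rw [this]; rfl
  rw [← neg_one_mul, hval_mul, h1, zero_add]

include hval_mul hval_add hval_zero in
lemma val_intCast_le (z : ℤ) : val (z : K) ≤ 0 := by
  have hn : ∀ n : ℕ, val (n : K) ≤ 0 := by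
    intro n
    induction n with
    | zero => rw [Nat.cast_zero, (hval_zero 0).2 rfl]; exact bot_le
    | succ n ih =>
      rw [Nat.cast_succ]
      exact (hval_add _ _).trans (max_le ih (val_one hval_mul hval_zero).le)
  rcases Int.eq_nat_or_neg z with ⟨n, rfl | rfl⟩
  · exact_mod_cast hn n
  · rw [Int.cast_neg, val_neg hval_mul hval_zero]
    exact_mod_cast hn n

include hval_add hval_zero in
lemma val_sum_lt {α : Type*} (s : Finset α) (t : α → K) (M : ℚ)
    (h : ∀ x ∈ s, val (t x) < M) : val (∑ x ∈ s, t x) < M := by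
  classical
  induction s using Finset.induction_on with
  | empty => rw [Finset.sum_empty, (hval_zero 0).2 rfl]; exact WithBot.bot_lt_coe M
  | insert a s ha ih =>
    rw [Finset.sum_insert ha]
    exact lt_of_le_of_lt (hval_add _ _) (max_lt (h a (Finset.mem_insert_self a s))
      (ih fun x hx => h x (Finset.mem_insert_of_mem hx)))

include hval_mul hval_zero in
lemma val_pow {x : K} {a : ℤ} (hx : val x = ((a : ℚ) : WithBot ℚ)) (k : ℕ) :
    val (x ^ k) = (((a : ℚ) * k : ℚ) : WithBot ℚ) := by
  induction k with
  | zero => rw [pow_zero, val_one hval_mul hval_zero]; simp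
  | succ k ih =>
    rw [pow_succ, hval_mul, ih, hx, ← WithBot.coe_add]
    congr 1
    push_cast
    ring

end

end Valuation

section Faces

/-- The value at `v` of the tropical term with coefficient function `b` at the point `Q`. -/
def height (b : ℤ × ℤ → ℚ) (Q : ℚ × ℚ) (v : ℤ × ℤ) : ℚ := b v + (Q.1 * v.1 + Q.2 * v.2)

/-- The exponents in `A` of the dominant terms at `Q`. -/
def face (A : Finset (ℤ × ℤ)) (b : ℤ × ℤ → ℚ) (Q : ℚ × ℚ) : Finset (ℤ × ℤ) :=
  A.filter fun v => ∀ w ∈ A, height b Q w ≤ height b Q v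

/-- A lattice point as a rational point. -/
def ratPt (P : ℤ × ℤ) : ℚ × ℚ := (P.1, P.2)

/-- The exponents of a polynomial as lattice points. -/
noncomputable def latticeSupport {K : Type*} [Field K] (f : MvPolynomial (Fin 2) K) :
    Finset (ℤ × ℤ) := f.support.image latticePt

/-- The valuations of the coefficients of `f`. -/
noncomputable def coeffVal {K : Type*} [Field K] (val : K → WithBot ℚ)
    (f : MvPolynomial (Fin 2) K) (v : ℤ × ℤ) : ℚ :=
  (val (coeff (Finsupp.single 0 v.1.toNat + Finsupp.single 1 v.2.toNat) f)).unbotD 0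

lemma coeffVal_latticePt {K : Type*} [Field K] {val : K → WithBot ℚ}
    (hval_zero : ∀ x : K, val x = ⊥ ↔ x = 0) {f : MvPolynomial (Fin 2) K} {x : Fin 2 →₀ ℕ}
    (hx : x ∈ f.support) : val (coeff x f) = (coeffVal val f (latticePt x) : WithBot ℚ) := by
  have h1 : Finsupp.single 0 (latticePt x).1.toNat + Finsupp.single 1 (latticePt x).2.toNat
      = x := by
    ext i
    fin_cases i <;> simp [latticePt]
  rw [coeffVal, h1]
  have h0 : val (coeff x f) ≠ ⊥ := fun h => (mem_support_iff.1 hx) ((hval_zero _).1 h)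
  obtain ⟨a, ha⟩ := WithBot.ne_bot_iff_exists.1 h0
  rw [← ha, WithBot.unbotD_coe]

theorem thick_face {K : Type*} [Field K] {val : K → WithBot ℚ}
    (hval_mul : ∀ a b : K, val (a * b) = val a + val b)
    (hval_add : ∀ a b : K, val (a + b) ≤ max (val a) (val b))
    (hval_zero : ∀ x : K, val x = ⊥ ↔ x = 0) {f : MvPolynomial (Fin 2) K} {p : K × K}
    {P : ℤ × ℤ} (hP : val p.1 = ((P.1 : ℚ) : WithBot ℚ) ∧ val p.2 = ((P.2 : ℚ) : WithBot ℚ))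
    {m : ℕ} (hf : multAtLeast p m f) :
    Thick (face (latticeSupport f) (coeffVal val f) (ratPt P)) m := by
  intro D hD v hv hvD hDv
  have hsum := weightedEval_eq_zero hD hf
  rw [weightedEval_apply] at hsum
  obtain ⟨hvA, hvmax⟩ := Finset.mem_filter.1 hv
  obtain ⟨x, hx, rfl⟩ := Finset.mem_image.1 hvA
  have hterm : ∀ y ∈ f.support, val (coeff y f * (p.1 ^ y 0 * p.2 ^ y 1))
      = (height (coeffVal val f) (ratPt P) (latticePt y) : WithBot ℚ) := by
    intro y hy
    rw [hval_mul, hval_mul, val_pow hval_mul hval_zero hP.1, val_pow hval_mul hval_zero hP.2,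
      coeffVal_latticePt hval_zero hy, ← WithBot.coe_add, ← WithBot.coe_add]
    rfl
  rw [← Finset.add_sum_erase _ _ hx, hDv] at hsum
  have h1 := eq_neg_of_add_eq_zero_left hsum
  have h2 := congrArg val h1
  rw [val_neg hval_mul hval_zero, Int.cast_one, one_mul, hterm x hx] at h2
  refine absurd h2 (ne_of_gt (val_sum_lt hval_add hval_zero _ _ _ ?_))
  intro y hy
  obtain ⟨hyx, hy⟩ := Finset.mem_erase.1 hy
  by_cases hyS : latticePt y ∈ face (latticeSupport f) (coeffVal val f) (ratPt P)
  · rw [hvD _ hyS (latticePt_injective.ne hyx)]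
    simp only [Int.cast_zero, zero_mul, mul_zero]
    rw [(hval_zero 0).2 rfl]
    exact WithBot.bot_lt_coe _
  · have h3 : coeff y f * ((D (latticePt y) : K) * (p.1 ^ y 0 * p.2 ^ y 1))
        = (D (latticePt y) : K) * (coeff y f * (p.1 ^ y 0 * p.2 ^ y 1)) := by ring
    rw [h3, hval_mul, hterm y hy]
    refine lt_of_le_of_lt (add_le_add_left (val_intCast_le hval_mul hval_add hval_zero _) _) ?_
    rw [zero_add, WithBot.coe_lt_coe]
    by_contra! h4
    refine hyS (Finset.mem_filter.2 ⟨Finset.mem_image_of_mem _ hy, fun w hw => ?_⟩)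
    exact (hvmax w hw).trans h4

end Faces

section LocalStructure

/-- The dot product on `ℤ²`. -/
def dot (u v : ℤ × ℤ) : ℤ := u.1 * v.1 + u.2 * v.2

lemma Thick.exists_ne {S : Finset (ℤ × ℤ)} {m : ℕ} (hS : Thick S m) (hm : 1 ≤ m)
    (hne : S.Nonempty) : ∃ v ∈ S, ∃ w ∈ S, v ≠ w := by
  obtain ⟨v, hv⟩ := hne
  by_contra! h
  exact hS (fun _ => 1) ((DiffZero.const 1).mono hm) v hv
    (fun w hw hwv => absurd (h v hv w hw).symm hwv) rfl

lemma eq_add_mul_of_dot_eq {w z n a b : ℤ × ℤ} (hz : dot z w = 1)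
    (hn : n = (-w.2, w.1) ∨ n = (w.2, -w.1)) (h : dot n a = dot n b) :
    b.1 = a.1 + (dot z b - dot z a) * w.1 ∧ b.2 = a.2 + (dot z b - dot z a) * w.2 := by
  have h' : w.1 * (b.2 - a.2) = w.2 * (b.1 - a.1) := by
    rcases hn with rfl | rfl <;> simp only [dot] at h <;> linarith
  simp only [dot] at hz ⊢
  constructor
  · linear_combination (-(b.1 - a.1)) * hz - z.2 * h'
  · linear_combination (-(b.2 - a.2)) * hz + z.1 * h'

lemma choose_eq_zero {k : ℤ} {r : ℕ} (h0 : 0 ≤ k) (h : k < r) : Ring.choose k r = 0 := by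
  obtain ⟨j, rfl⟩ := Int.eq_ofNat_of_zero_le h0
  have : j < r := by exact_mod_cast h
  rw [Ring.choose_natCast, Nat.choose_eq_zero_of_lt this, Nat.cast_zero]

lemma choose_self (r : ℕ) : Ring.choose (r : ℤ) r = 1 := by
  rw [Ring.choose_natCast, Nat.choose_self, Nat.cast_one]

lemma Thick.exists_side {S : Finset (ℤ × ℤ)} {m : ℕ} (hS : Thick S m) {w z n : ℤ × ℤ}
    (hz : dot z w = 1) (hn : n = (-w.2, w.1) ∨ n = (w.2, -w.1)) {α : ℤ} {r : ℕ}
    (hlo : ∀ v ∈ S, α ≤ dot n v) (hhi : ∀ v ∈ S, dot n v ≤ α + r)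
    (hatt : ∃ v ∈ S, dot n v = α + r) :
    ∃ a ∈ S, ∃ b ∈ S, dot n a = α + r ∧ dot n b = α + r ∧ ∃ L : ℤ, (m : ℤ) - r ≤ L ∧
      b.1 = a.1 + L * w.1 ∧ b.2 = a.2 + L * w.2 := by
  let T := S.filter fun v => dot n v = α + r
  have hT : T.Nonempty := by
    obtain ⟨v, hv, h⟩ := hatt
    exact ⟨v, Finset.mem_filter.2 ⟨hv, h⟩⟩
  obtain ⟨a, ha, hamin⟩ := T.exists_min_image (dot z) hT
  obtain ⟨b, hb, hbmax⟩ := T.exists_max_image (dot z) hT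
  have ha' := Finset.mem_filter.1 ha
  have hb' := Finset.mem_filter.1 hb
  obtain ⟨e1, e2⟩ := eq_add_mul_of_dot_eq hz hn (ha'.2.trans hb'.2.symm)
  refine ⟨a, ha'.1, b, hb'.1, ha'.2, hb'.2, dot z b - dot z a, ?_, e1, e2⟩
  by_contra! hlt
  obtain ⟨L, hL⟩ := Int.eq_ofNat_of_zero_le (sub_nonneg.2 (hamin b hb))
  have hD := (DiffZero.choose n (-α) r).mul (DiffZero.choose z (-dot z a) L) (c := m) (by omega)
  refine hS _ hD b hb'.1 ?_ ?_
  · intro v hv hvb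
    by_cases hvT : dot n v = α + r
    · have hvT' : v ∈ T := Finset.mem_filter.2 ⟨hv, hvT⟩
      have h1 : dot z v < dot z b := by
        refine lt_of_le_of_ne (hbmax v hvT') fun h => hvb ?_
        obtain ⟨e1, e2⟩ := eq_add_mul_of_dot_eq hz hn (hvT.trans hb'.2.symm)
        rw [h, sub_self, zero_mul, add_zero] at e1 e2
        exact (Prod.ext e1 e2).symm
      have h2 := hamin v hvT'
      refine mul_eq_zero_of_right _ (choose_eq_zero ?_ ?_)
      · change 0 ≤ dot z v + -dot z a
        linarith
      · change dot z v + -dot z a < L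
        linarith
    · have h1 := hhi v hv
      have h2 := hlo v hv
      refine mul_eq_zero_of_left (choose_eq_zero ?_ ?_) _
      · change 0 ≤ dot n v + -α
        linarith
      · change dot n v + -α < r
        have := lt_of_le_of_ne h1 hvT
        linarith
  · have h1 : n.1 * b.1 + n.2 * b.2 + -α = r := by
      change dot n b + -α = r
      linarith [hb'.2]
    have h2 : z.1 * b.1 + z.2 * b.2 + -dot z a = L := by
      change dot z b + -dot z a = L
      linarith
    rw [h1, h2, choose_self, choose_self, one_mul]

lemma exists_primitive {δ : ℤ × ℤ} (hδ : δ ≠ 0) : ∃ w z : ℤ × ℤ, ∃ g : ℤ, 1 ≤ g ∧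
    dot z w = 1 ∧ δ.1 = g * w.1 ∧ δ.2 = g * w.2 := by
  have hg : 0 < Int.gcd δ.1 δ.2 := by
    rw [Nat.pos_iff_ne_zero, Ne, Int.gcd_eq_zero_iff]
    exact fun h => hδ (Prod.ext h.1 h.2)
  obtain ⟨x, y, hcop, hx, hy⟩ := Int.exists_gcd_one hg
  refine ⟨(x, y), (Int.gcdA x y, Int.gcdB x y), Int.gcd δ.1 δ.2, by exact_mod_cast hg, ?_,
    by rw [mul_comm]; exact hx, by rw [mul_comm]; exact hy⟩
  have := Int.gcd_eq_gcd_ab x y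
  rw [hcop] at this
  simp only [dot]
  rw [Nat.cast_one] at this
  linarith

end LocalStructure

section Area

open MeasureTheory

/-- The cross product on the plane. -/
def cross (u v : ℝ × ℝ) : ℝ := u.1 * v.2 - u.2 * v.1

/-- The triangle with vertices `(0, 0)`, `(t, 0)`, `(0, t)`. -/
def stdTriangle (t : ℝ) : Set (ℝ × ℝ) := {x | 0 ≤ x.1 ∧ 0 ≤ x.2 ∧ x.1 + x.2 ≤ t}

lemma volume_line_eq_zero {u : ℝ × ℝ} (hu : u ≠ 0) (c : ℝ) :
    volume {x : ℝ × ℝ | u.1 * x.1 + u.2 * x.2 = c} = 0 := by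
  let s : AffineSubspace ℝ (ℝ × ℝ) :=
    { carrier := {x | u.1 * x.1 + u.2 * x.2 = c}
      smul_vsub_vadd_mem' := by
        intro r x y z hx hy hz
        simp only [Set.mem_ofPred_eq, vsub_eq_sub, vadd_eq_add, Prod.fst_add, Prod.snd_add,
          Prod.smul_fst, Prod.smul_snd, Prod.fst_sub, Prod.snd_sub, smul_eq_mul] at *
        linear_combination r * hx - r * hy + hz }
  refine Measure.addHaar_affineSubspace volume s fun h => hu ?_
  have h' : ∀ x : ℝ × ℝ, u.1 * x.1 + u.2 * x.2 = c := by
    intro x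
    have : x ∈ s := h ▸ AffineSubspace.mem_top ℝ _ x
    exact this
  have h0 := h' (0, 0)
  have h1 := h' (1, 0)
  have h2 := h' (0, 1)
  simp only [mul_zero, mul_one, add_zero, zero_add] at h0 h1 h2
  exact Prod.ext (h1.trans h0.symm) (h2.trans h0.symm)

lemma volume_reflect (c : ℝ × ℝ) (s : Set (ℝ × ℝ)) :
    volume ((fun x => c - x) ⁻¹' s) = volume s :=
  (Measure.measurePreserving_sub_left volume c).measure_preimage_equiv (f := MeasurableEquiv.subLeft c) s

lemma volume_square (t : ℝ) :
    volume (Set.Icc (0 : ℝ) t ×ˢ Set.Icc (0 : ℝ) t) = ENNReal.ofReal t * ENNReal.ofReal t := by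
  rw [Measure.volume_eq_prod, Measure.prod_prod, Real.volume_Icc, sub_zero]

lemma le_volume_stdTriangle : ENNReal.ofReal (1 / 2) ≤ volume (stdTriangle 1) := by
  have h1 : Set.Icc (0 : ℝ) 1 ×ˢ Set.Icc (0 : ℝ) 1
      ⊆ stdTriangle 1 ∪ (fun x => (1, 1) - x) ⁻¹' stdTriangle 1 := by
    rintro ⟨x, y⟩ ⟨⟨h1, h2⟩, h3, h4⟩
    simp only [stdTriangle, Set.mem_union, Set.mem_ofPred_eq, Set.mem_preimage, Prod.fst_sub,
      Prod.snd_sub] at *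
    rcases le_total (x + y) 1 with h | h
    · exact Or.inl ⟨h1, h3, h⟩
    · exact Or.inr ⟨by linarith, by linarith, by linarith⟩
  have h2 := (measure_mono h1).trans (measure_union_le (μ := volume) _ _)
  rw [volume_square, volume_reflect, ENNReal.ofReal_one, one_mul, ← two_mul] at h2
  rw [ENNReal.ofReal_div_of_pos two_pos, ENNReal.ofReal_one, ENNReal.ofReal_ofNat]
  exact ENNReal.div_le_of_le_mul' h2

lemma measurableSet_stdTriangle (t : ℝ) : MeasurableSet (stdTriangle t) := by
  unfold stdTriangle
  measurability

lemma volume_stdTriangle_le {t : ℝ} (ht : 0 ≤ t) :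
    volume (stdTriangle t) ≤ ENNReal.ofReal (t ^ 2 / 2) := by
  let T' := (fun x => ((t, t) : ℝ × ℝ) - x) ⁻¹' stdTriangle t
  have h1 : stdTriangle t ∪ T' ⊆ Set.Icc (0 : ℝ) t ×ˢ Set.Icc (0 : ℝ) t := by
    rintro ⟨x, y⟩ (⟨h1, h2, h3⟩ | ⟨h1, h2, h3⟩) <;>
      simp only [Prod.fst_sub, Prod.snd_sub] at h1 h2 h3 <;>
      exact ⟨⟨by linarith, by linarith⟩, by linarith, by linarith⟩
  have h2 : AEDisjoint volume (stdTriangle t) T' := by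
    refine measure_mono_null ?_ (volume_line_eq_zero (u := (1, 1)) (by simp) t)
    rintro ⟨x, y⟩ ⟨⟨h1, h2, h3⟩, h4, h5, h6⟩
    simp only [Prod.fst_sub, Prod.snd_sub, Set.mem_ofPred_eq] at *
    linarith
  have h3 := measure_mono (μ := volume) h1
  rw [measure_union₀' (measurableSet_stdTriangle t).nullMeasurableSet h2, volume_square,
    volume_reflect, ← two_mul, ← ENNReal.ofReal_mul ht, ← sq] at h3
  rw [ENNReal.ofReal_div_of_pos two_pos, ENNReal.ofReal_ofNat]
  rw [ENNReal.le_div_iff_mul_le (by simp) (by simp), mul_comm]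
  exact h3

lemma le_volume_of_triangle {X : Set (ℝ × ℝ)} (hX : Convex ℝ X) {p q r : ℝ × ℝ} (hp : p ∈ X)
    (hq : q ∈ X) (hr : r ∈ X) :
    ENNReal.ofReal (|cross (q - p) (r - p)| / 2) ≤ volume X := by
  let M : Matrix (Fin 2) (Fin 2) ℝ := !![(q - p).1, (r - p).1; (q - p).2, (r - p).2]
  let f := Matrix.toLin (Module.Basis.finTwoProd ℝ) (Module.Basis.finTwoProd ℝ) M
  have hdet : LinearMap.det f = cross (q - p) (r - p) := by
    rw [LinearMap.det_toLin, Matrix.det_fin_two_of, cross]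
    ring
  have hsub : (fun x => p + x) '' (f '' stdTriangle 1) ⊆ X := by
    rintro _ ⟨_, ⟨⟨s, t⟩, ⟨hs, ht, hst⟩, rfl⟩, rfl⟩
    have h := hX.sum_mem (t := Finset.univ) (w := ![1 - s - t, s, t]) (z := ![p, q, r])
      (by intro i _; fin_cases i <;> simp at * <;> linarith)
      (by simp [Fin.sum_univ_three]; ring)
      (by intro i _; fin_cases i <;> simp [hp, hq, hr])
    convert h using 1
    simp only [f, M, Matrix.toLin_finTwoProd_apply, Fin.sum_univ_three]
    ext <;> simp <;> ring
  refine le_trans ?_ (measure_mono hsub)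
  rw [Set.image_add_left, measure_preimage_add, Measure.addHaar_image_linearMap, hdet, div_eq_mul_one_div,
    ENNReal.ofReal_mul (abs_nonneg _)]
  gcongr
  exact le_volume_stdTriangle

lemma volume_halves_le (X : Set (ℝ × ℝ)) {u : ℝ × ℝ} (hu : u ≠ 0) (c : ℝ) :
    volume (X ∩ {x | u.1 * x.1 + u.2 * x.2 ≤ c}) + volume (X ∩ {x | c ≤ u.1 * x.1 + u.2 * x.2})
      ≤ volume X := by
  have hmeas : MeasurableSet {x : ℝ × ℝ | u.1 * x.1 + u.2 * x.2 ≤ c} := by measurability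
  rw [← measure_inter_add_sdiff X hmeas]
  refine add_le_add le_rfl ?_
  refine (measure_mono (t := (X \ {x | u.1 * x.1 + u.2 * x.2 ≤ c})
    ∪ {x : ℝ × ℝ | u.1 * x.1 + u.2 * x.2 = c}) ?_).trans ((measure_union_le (μ := volume) _ _).trans ?_)
  · rintro x ⟨hx, hxc⟩
    rcases eq_or_lt_of_le (show c ≤ u.1 * x.1 + u.2 * x.2 from hxc) with h | h
    · exact Or.inr h.symm
    · exact Or.inl ⟨hx, not_le.2 h⟩
  · rw [volume_line_eq_zero hu, add_zero]

lemma convex_halfPlane_le (u : ℝ × ℝ) (c : ℝ) :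
    Convex ℝ {x : ℝ × ℝ | u.1 * x.1 + u.2 * x.2 ≤ c} := by
  intro x hx y hy a b ha hb hab
  simp only [Set.mem_ofPred_eq, Prod.fst_add, Prod.snd_add, Prod.smul_fst, Prod.smul_snd,
    smul_eq_mul] at *
  have : u.1 * (a * x.1 + b * y.1) + u.2 * (a * x.2 + b * y.2)
      = a * (u.1 * x.1 + u.2 * x.2) + b * (u.1 * y.1 + u.2 * y.2) := by ring
  rw [this]
  calc _ ≤ a * c + b * c := by gcongr
    _ = c := by rw [← add_mul, hab, one_mul]

lemma convex_halfPlane_ge (u : ℝ × ℝ) (c : ℝ) :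
    Convex ℝ {x : ℝ × ℝ | c ≤ u.1 * x.1 + u.2 * x.2} := by
  convert convex_halfPlane_le (-u) (-c) using 1
  ext x
  simp only [Set.mem_ofPred_eq, Prod.fst_neg, Prod.snd_neg]
  constructor <;> intro h <;> linarith

lemma le_volume_of_opposite {X : Set (ℝ × ℝ)} (hX : Convex ℝ X) {p q p' q' : ℝ × ℝ} (hp : p ∈ X)
    (hq : q ∈ X) (hp' : p' ∈ X) (hq' : q' ∈ X) (hs : cross (q - p) (p' - p) ≤ 0)
    (hs' : 0 ≤ cross (q - p) (q' - p)) :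
    ENNReal.ofReal (|cross (q - p) (q' - p')| / 2) ≤ volume X := by
  by_cases hpq : q - p = 0
  · simp [hpq, cross]
  let u : ℝ × ℝ := (-(q - p).2, (q - p).1)
  have hu : u ≠ 0 := by
    intro h
    rw [Prod.ext_iff] at h
    exact hpq (Prod.ext h.2 (neg_eq_zero.1 h.1))
  let c := u.1 * p.1 + u.2 * p.2
  have h1 := le_volume_of_triangle (hX.inter (convex_halfPlane_le u c)) (p := p) (q := q) (r := p')
    ⟨hp, le_refl c⟩ ⟨hq, by simp [u, c]; linarith⟩
    ⟨hp', by simp only [cross, Prod.fst_sub, Prod.snd_sub] at hs; simp [u, c]; linarith⟩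
  have h2 := le_volume_of_triangle (hX.inter (convex_halfPlane_ge u c)) (p := p) (q := q) (r := q')
    ⟨hp, le_refl c⟩ ⟨hq, by simp [u, c]; linarith⟩
    ⟨hq', by simp only [cross, Prod.fst_sub, Prod.snd_sub] at hs'; simp [u, c]; linarith⟩
  refine le_trans ?_ ((add_le_add h1 h2).trans (volume_halves_le X hu c))
  rw [← ENNReal.ofReal_add (by positivity) (by positivity)]
  refine ENNReal.ofReal_le_ofReal ?_
  have h3 : cross (q - p) (q' - p') = cross (q - p) (q' - p) - cross (q - p) (p' - p) := by
    simp only [cross, Prod.fst_sub, Prod.snd_sub]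
    ring
  rw [h3, abs_of_nonpos hs, abs_of_nonneg hs', abs_of_nonneg (by linarith)]
  linarith

lemma le_volume_of_quadrilateral {X : Set (ℝ × ℝ)} (hX : Convex ℝ X) {p q p' q' : ℝ × ℝ}
    (hp : p ∈ X) (hq : q ∈ X) (hp' : p' ∈ X) (hq' : q' ∈ X) :
    ENNReal.ofReal (|cross (q - p) (q' - p')| / 2) ≤ volume X := by
  have h3 : cross (q - p) (q' - p') = cross (q - p) (q' - p) - cross (q - p) (p' - p) := by
    simp only [cross, Prod.fst_sub, Prod.snd_sub]
    ring
  have h4 : cross (q - p) (p' - q') = -cross (q - p) (q' - p') := by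
    simp only [cross, Prod.fst_sub, Prod.snd_sub]
    ring
  rcases le_total (cross (q - p) (p' - p)) 0 with hs | hs <;>
    rcases le_total (cross (q - p) (q' - p)) 0 with hs' | hs'
  · rcases le_total (cross (q - p) (p' - p)) (cross (q - p) (q' - p)) with h | h
    · refine le_trans (ENNReal.ofReal_le_ofReal ?_) (le_volume_of_triangle hX hp hq hp')
      rw [h3, abs_of_nonneg (by linarith), abs_of_nonpos hs]
      linarith
    · refine le_trans (ENNReal.ofReal_le_ofReal ?_) (le_volume_of_triangle hX hp hq hq')
      rw [h3, abs_of_nonpos (by linarith), abs_of_nonpos hs']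
      linarith
  · exact le_volume_of_opposite hX hp hq hp' hq' hs hs'
  · have := le_volume_of_opposite hX hp hq hq' hp' hs' hs
    rwa [h4, abs_neg] at this
  · rcases le_total (cross (q - p) (p' - p)) (cross (q - p) (q' - p)) with h | h
    · refine le_trans (ENNReal.ofReal_le_ofReal ?_) (le_volume_of_triangle hX hp hq hq')
      rw [h3, abs_of_nonneg (by linarith), abs_of_nonneg hs']
      linarith
    · refine le_trans (ENNReal.ofReal_le_ofReal ?_) (le_volume_of_triangle hX hp hq hp')
      rw [h3, abs_of_nonpos (by linarith), abs_of_nonneg hs]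
      linarith

/-- A lattice point as a real point. -/
def realPt (v : ℤ × ℤ) : ℝ × ℝ := (v.1, v.2)

/-- The convex hull of a finite set of lattice points. -/
def hull (S : Finset (ℤ × ℤ)) : Set (ℝ × ℝ) := convexHull ℝ (realPt '' S)

lemma realPt_mem_hull {S : Finset (ℤ × ℤ)} {v : ℤ × ℤ} (hv : v ∈ S) : realPt v ∈ hull S :=
  subset_convexHull ℝ _ (Set.mem_image_of_mem _ hv)

lemma measurableSet_hull (S : Finset (ℤ × ℤ)) : MeasurableSet (hull S) :=
  ((S.finite_toSet.image realPt).isCompact_convexHull (𝕜 := ℝ)).measurableSet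

/-- The cross product on `ℤ²`. -/
def intCross (u v : ℤ × ℤ) : ℤ := u.1 * v.2 - u.2 * v.1

lemma le_volume_hull {S : Finset (ℤ × ℤ)} {m : ℕ} {p q p' q' : ℤ × ℤ} (hp : p ∈ S) (hq : q ∈ S)
    (hp' : p' ∈ S) (hq' : q' ∈ S) (h : (m : ℤ) ≤ |intCross (q - p) (q' - p')|) :
    ENNReal.ofReal (m / 2) ≤ volume (hull S) := by
  refine le_trans (ENNReal.ofReal_le_ofReal ?_) (le_volume_of_quadrilateral (convex_convexHull ℝ _)
    (realPt_mem_hull hp) (realPt_mem_hull hq) (realPt_mem_hull hp') (realPt_mem_hull hq'))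
  have h1 : cross (realPt q - realPt p) (realPt q' - realPt p')
      = (intCross (q - p) (q' - p') : ℤ) := by
    simp [cross, intCross, realPt]
  rw [h1]
  have h2 : (m : ℝ) ≤ |((intCross (q - p) (q' - p') : ℤ) : ℝ)| := by exact_mod_cast h
  linarith

lemma aedisjoint_hull_face (A : Finset (ℤ × ℤ)) (b : ℤ × ℤ → ℚ) {Q Q' : ℚ × ℚ} (hQ : Q ≠ Q') :
    AEDisjoint volume (hull (face A b Q)) (hull (face A b Q')) := by
  rcases (face A b Q').eq_empty_or_nonempty with hem | hne
  · rw [AEDisjoint, hem]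
    simp [hull]
  let u : ℝ × ℝ := ((Q.1 - Q'.1 : ℚ), (Q.2 - Q'.2 : ℚ))
  have hu : u ≠ 0 := by
    intro h
    rw [Prod.ext_iff] at h
    refine hQ (Prod.ext (sub_eq_zero.1 ?_) (sub_eq_zero.1 ?_))
    · exact Rat.cast_eq_zero.1 h.1
    · exact Rat.cast_eq_zero.1 h.2
  obtain ⟨w, hw, hwmax⟩ := (face A b Q').exists_max_image
    (fun v => (Q.1 - Q'.1) * v.1 + (Q.2 - Q'.2) * v.2) hne
  let c : ℝ := u.1 * (realPt w).1 + u.2 * (realPt w).2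
  have h1 : hull (face A b Q) ⊆ {x | c ≤ u.1 * x.1 + u.2 * x.2} := by
    refine convexHull_min ?_ (convex_halfPlane_ge u c)
    rintro _ ⟨v, hv, rfl⟩
    have hv := Finset.mem_filter.1 hv
    have hw := Finset.mem_filter.1 hw
    have h2 := hv.2 w hw.1
    have h3 := hw.2 v hv.1
    have h4 : (Q.1 - Q'.1) * w.1 + (Q.2 - Q'.2) * w.2
        ≤ (Q.1 - Q'.1) * v.1 + (Q.2 - Q'.2) * v.2 := by
      simp only [height] at h2 h3
      linarith
    simp only [Set.mem_ofPred_eq, c, u, realPt]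
    exact_mod_cast h4
  have h2 : hull (face A b Q') ⊆ {x | u.1 * x.1 + u.2 * x.2 ≤ c} := by
    refine convexHull_min ?_ (convex_halfPlane_le u c)
    rintro _ ⟨v, hv, rfl⟩
    have h4 := hwmax v hv
    simp only [Set.mem_ofPred_eq, c, u, realPt]
    exact_mod_cast h4
  refine measure_mono_null (fun x hx => ?_) (volume_line_eq_zero hu c)
  exact le_antisymm (h2 hx.2) (h1 hx.1)

lemma convex_stdTriangle (t : ℝ) : Convex ℝ (stdTriangle t) := by
  have h : stdTriangle t = {x | 0 ≤ ((1, 0) : ℝ × ℝ).1 * x.1 + ((1, 0) : ℝ × ℝ).2 * x.2} ∩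
      ({x | 0 ≤ ((0, 1) : ℝ × ℝ).1 * x.1 + ((0, 1) : ℝ × ℝ).2 * x.2} ∩
      {x | ((1, 1) : ℝ × ℝ).1 * x.1 + ((1, 1) : ℝ × ℝ).2 * x.2 ≤ t}) := by
    ext x
    simp [stdTriangle]
  rw [h]
  exact (convex_halfPlane_ge _ _).inter ((convex_halfPlane_ge _ _).inter (convex_halfPlane_le _ _))

theorem sum_volume_hull_face_le {A : Finset (ℤ × ℤ)} (b : ℤ × ℤ → ℚ) {d : ℕ}
    (hA : ∀ v ∈ A, realPt v ∈ stdTriangle d) (s : Finset (ℚ × ℚ)) :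
    ∑ Q ∈ s, volume (hull (face A b Q)) ≤ ENNReal.ofReal ((d : ℝ) ^ 2 / 2) := by
  rw [← measure_biUnion_finset₀ (fun Q _ Q' _ h => aedisjoint_hull_face A b h)
    fun Q _ => (measurableSet_hull _).nullMeasurableSet]
  refine (measure_mono ?_).trans (volume_stdTriangle_le (Nat.cast_nonneg d))
  refine Set.iUnion₂_subset fun Q _ => convexHull_min ?_ (convex_stdTriangle _)
  rintro _ ⟨v, hv, rfl⟩
  exact hA v (Finset.mem_filter.1 hv).1

end Area

section LocalAlternative

open MeasureTheory

lemma dot_sub (n v w : ℤ × ℤ) : dot n (v - w) = dot n v - dot n w := by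
  simp only [dot, Prod.fst_sub, Prod.snd_sub]
  ring

/-- The point of the ray from `P` in direction `n` with parameter `s`. -/
def rayPt (P n : ℤ × ℤ) (s : ℚ) : ℚ × ℚ := (P.1 + s * n.1, P.2 + s * n.2)

lemma rayPt_zero (P n : ℤ × ℤ) : rayPt P n 0 = ratPt P := by
  simp [rayPt, ratPt]

lemma height_rayPt (b : ℤ × ℤ → ℚ) (P n v : ℤ × ℤ) (s : ℚ) :
    height b (rayPt P n s) v = height b (ratPt P) v + s * dot n v := by
  simp only [height, rayPt, ratPt, dot]
  push_cast
  ring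

lemma exists_rayPt {A : Finset (ℤ × ℤ)} {b : ℤ × ℤ → ℚ} {P n a c w : ℤ × ℤ} {m : ℕ} {L : ℤ}
    (hn : n = (-w.2, w.1) ∨ n = (w.2, -w.1)) (ha : a ∈ face A b (ratPt P))
    (hc : c ∈ face A b (ratPt P)) (hL : m ≤ L) (h1 : c.1 = a.1 + L * w.1)
    (h2 : c.2 = a.2 + L * w.2) :
    (∃ s : ℚ, 0 ≤ s ∧ a ∈ face A b (rayPt P n s) ∧ c ∈ face A b (rayPt P n s) ∧
      ENNReal.ofReal (m / 2) ≤ volume (hull (face A b (rayPt P n s)))) ∨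
    ∀ v ∈ A, dot n v ≤ dot n a := by
  obtain ⟨haA, hamax⟩ := Finset.mem_filter.1 ha
  obtain ⟨hcA, hcmax⟩ := Finset.mem_filter.1 hc
  let T := A.filter fun v => dot n a < dot n v
  rcases T.eq_empty_or_nonempty with hT | hT
  · refine Or.inr fun v hv => not_lt.1 fun h => ?_
    have : v ∈ T := Finset.mem_filter.2 ⟨hv, h⟩
    simp [hT] at this
  left
  let slope : ℤ × ℤ → ℚ := fun v =>
    (height b (ratPt P) a - height b (ratPt P) v) / (dot n v - dot n a)
  obtain ⟨v, hv, hvmin⟩ := T.exists_min_image slope hT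
  obtain ⟨hvA, hva⟩ := Finset.mem_filter.1 hv
  have hs : 0 ≤ slope v := by
    refine div_nonneg (sub_nonneg.2 (hamax v hvA)) (sub_nonneg.2 ?_)
    exact_mod_cast hva.le
  have hca : dot n c = dot n a := by
    rcases hn with rfl | rfl <;> simp only [dot] <;> rw [h1, h2] <;> ring
  have hcaP : height b (ratPt P) c = height b (ratPt P) a :=
    le_antisymm (hamax c hcA) (hcmax a haA)
  have hva' : (0 : ℚ) < dot n v - dot n a := by
    rw [sub_pos]
    exact_mod_cast hva
  have hvQ : height b (rayPt P n (slope v)) v = height b (rayPt P n (slope v)) a := by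
    rw [height_rayPt, height_rayPt]
    have : slope v * (dot n v - dot n a) = height b (ratPt P) a - height b (ratPt P) v :=
      div_mul_cancel₀ _ hva'.ne'
    linarith
  have hcQ : height b (rayPt P n (slope v)) c = height b (rayPt P n (slope v)) a := by
    rw [height_rayPt, height_rayPt, hcaP, hca]
  have hmax : ∀ w ∈ A, height b (rayPt P n (slope v)) w ≤ height b (rayPt P n (slope v)) a := by
    intro w hw
    rw [height_rayPt, height_rayPt]
    rcases le_or_gt (dot n w) (dot n a) with h | h
    · have h' : (dot n w : ℚ) ≤ dot n a := by exact_mod_cast h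
      have := mul_le_mul_of_nonneg_left h' hs
      linarith [hamax w hw]
    · have h' : (0 : ℚ) < dot n w - dot n a := by
        rw [sub_pos]
        exact_mod_cast h
      have := (le_div_iff₀ h').1 (hvmin w (Finset.mem_filter.2 ⟨hw, h⟩))
      linarith
  have haF : a ∈ face A b (rayPt P n (slope v)) := Finset.mem_filter.2 ⟨haA, hmax⟩
  have hcF : c ∈ face A b (rayPt P n (slope v)) :=
    Finset.mem_filter.2 ⟨hcA, fun w hw => (hmax w hw).trans hcQ.ge⟩
  have hvF : v ∈ face A b (rayPt P n (slope v)) :=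
    Finset.mem_filter.2 ⟨hvA, fun w hw => (hmax w hw).trans hvQ.ge⟩
  refine ⟨slope v, hs, haF, hcF, le_volume_hull haF hcF haF hvF ?_⟩
  have h3 : |intCross (c - a) (v - a)| = |L * (dot n v - dot n a)| := by
    rw [← dot_sub]
    rcases hn with rfl | rfl
    · congr 1
      simp only [intCross, dot, Prod.fst_sub, Prod.snd_sub]
      rw [h1, h2]
      ring
    · rw [← abs_neg]
      congr 1
      simp only [intCross, dot, Prod.fst_sub, Prod.snd_sub]
      rw [h1, h2]
      ring
  rw [h3]
  refine le_trans ?_ (le_abs_self _)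
  have : 1 ≤ dot n v - dot n a := by linarith
  nlinarith [Int.natCast_nonneg m]

theorem local_alternative {A : Finset (ℤ × ℤ)} {b : ℤ × ℤ → ℚ} {P : ℤ × ℤ} {m : ℕ}
    (hS : Thick (face A b (ratPt P)) m) (hm : 1 ≤ m) (hA : (face A b (ratPt P)).Nonempty) :
    ∃ a ∈ face A b (ratPt P), ∃ c ∈ face A b (ratPt P), a ≠ c ∧ ∃ w : ℤ × ℤ, w ≠ 0 ∧
      ∀ n : ℤ × ℤ, (n = (-w.2, w.1) ∨ n = (w.2, -w.1)) →
      (∃ s : ℚ, 0 ≤ s ∧ a ∈ face A b (rayPt P n s) ∧ c ∈ face A b (rayPt P n s) ∧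
        ENNReal.ofReal (m / 2) ≤ volume (hull (face A b (rayPt P n s)))) ∨
      (∃ L : ℤ, (m : ℤ) ≤ L ∧ c.1 = a.1 + L * w.1 ∧ c.2 = a.2 + L * w.2 ∧
        ∀ v ∈ A, dot n v ≤ dot n a) := by
  obtain ⟨v₀, hv₀, v₁, hv₁, hne⟩ := hS.exists_ne hm hA
  obtain ⟨w, z, g, hg, hz, hg1, hg2⟩ := exists_primitive (sub_ne_zero.2 hne.symm)
  have hw : w ≠ 0 := by
    rintro rfl
    simp [dot] at hz
  let n : ℤ × ℤ := (-w.2, w.1)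
  have hcross : ∀ x y : ℤ × ℤ, intCross (v₁ - v₀) (x - y) = g * (dot n x - dot n y) := by
    intro x y
    rw [intCross, hg1, hg2, ← dot_sub]
    simp only [dot, n, Prod.fst_sub, Prod.snd_sub]
    ring
  have hinner : ENNReal.ofReal (m / 2) ≤ volume (hull (face A b (ratPt P))) →
      ∃ a ∈ face A b (ratPt P), ∃ c ∈ face A b (ratPt P), a ≠ c ∧ ∃ w : ℤ × ℤ, w ≠ 0 ∧
      ∀ n : ℤ × ℤ, (n = (-w.2, w.1) ∨ n = (w.2, -w.1)) →
      (∃ s : ℚ, 0 ≤ s ∧ a ∈ face A b (rayPt P n s) ∧ c ∈ face A b (rayPt P n s) ∧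
        ENNReal.ofReal (m / 2) ≤ volume (hull (face A b (rayPt P n s)))) ∨
      (∃ L : ℤ, (m : ℤ) ≤ L ∧ c.1 = a.1 + L * w.1 ∧ c.2 = a.2 + L * w.2 ∧
        ∀ v ∈ A, dot n v ≤ dot n a) := by
    refine fun h => ⟨v₀, hv₀, v₁, hv₁, hne, w, hw, fun n _ => Or.inl ⟨0, le_rfl, ?_⟩⟩
    rw [rayPt_zero]
    exact ⟨hv₀, hv₁, h⟩
  obtain ⟨vmin, hvmin, hmin⟩ := (face A b (ratPt P)).exists_min_image (dot n) hA
  obtain ⟨vmax, hvmax, hmax⟩ := (face A b (ratPt P)).exists_max_image (dot n) hA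
  obtain ⟨r, hr⟩ := Int.eq_ofNat_of_zero_le (sub_nonneg.2 (hmin vmax hvmax))
  have hmax' : ∀ v ∈ face A b (ratPt P), dot n v ≤ dot n vmin + r := by
    intro v hv
    linarith [hmax v hv]
  rcases le_or_gt m r with hrm | hrm
  · refine hinner (le_volume_hull hv₀ hv₁ hvmin hvmax ?_)
    rw [hcross]
    refine le_trans ?_ (le_abs_self _)
    have : (m : ℤ) ≤ r := by exact_mod_cast hrm
    nlinarith
  obtain ⟨a, ha, c, hc, hda, hdc, L, hL, e1, e2⟩ := hS.exists_side hz (Or.inl rfl) hmin hmax'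
    ⟨vmax, hvmax, by linarith⟩
  rcases Nat.eq_zero_or_pos r with rfl | hr0
  · rw [Nat.cast_zero, sub_zero] at hL
    refine ⟨a, ha, c, hc, ?_, w, hw, fun n' hn' => ?_⟩
    · rintro rfl
      have hL0 : L ≠ 0 := by
        have : (1 : ℤ) ≤ m := by exact_mod_cast hm
        linarith
      refine hw (Prod.ext ?_ ?_)
      · simpa [hL0] using e1
      · simpa [hL0] using e2
    · rcases exists_rayPt hn' ha hc hL e1 e2 with h | h
      · exact Or.inl h
      · exact Or.inr ⟨L, hL, e1, e2, h⟩
  · obtain ⟨a', ha', c', hc', hda', hdc', L', hL', e1', e2'⟩ :=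
      hS.exists_side (n := (w.2, -w.1)) (α := -dot n vmax) (r := r) hz (Or.inr rfl)
      (fun v hv => by
        have := hmax v hv
        simp only [dot, n] at this ⊢
        linarith)
      (fun v hv => by
        have := hmin v hv
        simp only [dot, n] at this hr ⊢
        linarith)
      ⟨vmin, hvmin, by
        simp only [dot, n] at hr ⊢
        linarith⟩
    refine hinner (le_volume_hull ha hc' hc ha' ?_)
    have hd : dot n a - dot n a' = r := by
      simp only [dot, n] at hda hda' hr ⊢
      linarith
    have h1 : intCross (c' - a) (a' - c) = -((L + L') * (dot n a - dot n a')) := by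
      simp only [intCross, dot, n, Prod.fst_sub, Prod.snd_sub]
      rw [e1, e2, e1', e2']
      ring
    rw [h1, abs_neg, hd]
    refine le_trans ?_ (le_abs_self _)
    have h2 : (r : ℤ) + 1 ≤ m := by exact_mod_cast hrm
    have h3 : (1 : ℤ) ≤ r := by exact_mod_cast hr0
    have h4 : 2 * ((m : ℤ) - r) * r ≤ (L + L') * r := by
      refine mul_le_mul_of_nonneg_right ?_ (by linarith)
      linarith
    nlinarith [mul_nonneg (sub_nonneg.2 h3) (sub_nonneg.2 h2)]

end LocalAlternative

section Boundary

lemma eq_zero_of_overlap {R : Type*} [CommRing R] [LinearOrder R] [IsStrictOrderedRing R]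
    {α β s t s' t' : R} (h1 : s < t') (h2 : s' < t) (hs : 0 ≤ α * s + β) (ht : 0 ≤ α * t + β)
    (hs' : α * s' + β ≤ 0) (ht' : α * t' + β ≤ 0) : α = 0 ∧ β = 0 := by
  have hα : α = 0 := by
    rcases lt_trichotomy α 0 with h | h | h
    · nlinarith [mul_pos_of_neg_of_neg h (sub_neg.2 h2)]
    · exact h
    · nlinarith [mul_pos h (sub_pos.2 h1)]
  subst hα
  rw [zero_mul, zero_add] at hs hs'
  exact ⟨rfl, le_antisymm hs' hs⟩

lemma height_eq_of_mem_face {A : Finset (ℤ × ℤ)} {b : ℤ × ℤ → ℚ} {Q : ℚ × ℚ} {v w : ℤ × ℤ}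
    (hv : v ∈ face A b Q) (hw : w ∈ face A b Q) : height b Q v = height b Q w :=
  le_antisymm ((Finset.mem_filter.1 hw).2 v (Finset.mem_filter.1 hv).1)
    ((Finset.mem_filter.1 hv).2 w (Finset.mem_filter.1 hw).1)

/-- Dominant edges lying on the same side of the hull of `A` do not overlap. -/
lemma not_overlap {A : Finset (ℤ × ℤ)} {b : ℤ × ℤ → ℚ} {X Y : ℤ × ℤ → ℤ}
    (hXY : ∀ u v, dot u v = X u * X v + Y u * Y v)
    {a c n P a' c' n' P' : ℤ × ℤ}
    (ha : a ∈ face A b (ratPt P)) (hc : c ∈ face A b (ratPt P))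
    (ha' : a' ∈ face A b (ratPt P')) (hc' : c' ∈ face A b (ratPt P'))
    (hn : ∀ v ∈ A, dot n v ≤ dot n a) (hnc : dot n c = dot n a)
    (hn' : ∀ v ∈ A, dot n' v ≤ dot n' a') (hnc' : dot n' c' = dot n' a')
    (hY : 0 < Y n) (hY' : 0 < Y n') (hne : dot (P - P') (c - a) ≠ 0)
    (h1 : X a' < X c) (h2 : X a < X c') : False := by
  have memA : ∀ {v Q}, v ∈ face A b Q → v ∈ A := fun h => (Finset.mem_filter.1 h).1
  have hup : ∀ v ∈ A, dot n v = dot n a → Y n * (dot n' v - dot n' a')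
      = (X n' * Y n - X n * Y n') * X v + (Y n' * dot n a - Y n * dot n' a') := by
    intro v _ hv
    rw [← hv, hXY n' v, hXY n v]
    ring
  have hdown : ∀ v ∈ A, dot n' v = dot n' a' → Y n' * (dot n a - dot n v)
      = (X n' * Y n - X n * Y n') * X v + (Y n' * dot n a - Y n * dot n' a') := by
    intro v _ hv
    rw [← hv, hXY n' v, hXY n v]
    ring
  have hle : ∀ v ∈ A, Y n * (dot n' v - dot n' a') ≤ 0 := fun v hv =>
    mul_nonpos_of_nonneg_of_nonpos hY.le (sub_nonpos.2 (hn' v hv))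
  have hge : ∀ v ∈ A, 0 ≤ Y n' * (dot n a - dot n v) := fun v hv =>
    mul_nonneg hY'.le (sub_nonneg.2 (hn v hv))
  obtain ⟨hα, hβ⟩ := eq_zero_of_overlap h1 h2
    (by rw [← hdown a' (memA ha') rfl]; exact hge a' (memA ha'))
    (by rw [← hdown c' (memA hc') hnc']; exact hge c' (memA hc'))
    (by rw [← hup a (memA ha) rfl]; exact hle a (memA ha))
    (by rw [← hup c (memA hc) hnc]; exact hle c (memA hc))
  have hline : ∀ v ∈ A, dot n' v = dot n' a' → dot n v = dot n a := by
    intro v hv h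
    have := hdown v hv h
    rw [hα, hβ, zero_mul, add_zero] at this
    have := (mul_eq_zero.1 this).resolve_left hY'.ne'
    linarith
  let g : ℤ × ℤ → ℚ := fun v => (height b (ratPt P) v - height b (ratPt P) a)
    - (height b (ratPt P') v - height b (ratPt P') a')
  have hg : ∀ v w, g v - g w = dot (P - P') (v - w) := by
    intro v w
    simp only [g, height, ratPt, dot, Prod.fst_sub, Prod.snd_sub]
    push_cast
    ring
  have hg1 : ∀ v ∈ face A b (ratPt P), 0 ≤ g v := by
    intro v hv
    have h3 := height_eq_of_mem_face hv ha
    have h4 := (Finset.mem_filter.1 ha').2 v (memA hv)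
    simp only [g]
    linarith
  have hg2 : ∀ v ∈ face A b (ratPt P'), g v ≤ 0 := by
    intro v hv
    have h3 := height_eq_of_mem_face hv ha'
    have h4 := (Finset.mem_filter.1 ha).2 v (memA hv)
    simp only [g]
    linarith
  have hgl : ∀ v, dot n v = dot n a → Y n * g v
      = ((X (P - P') * Y n - Y (P - P') * X n : ℤ) : ℚ) * X v
        + (Y n * g a - ((X (P - P') * Y n - Y (P - P') * X n : ℤ) : ℚ) * X a) := by
    intro v hv
    have h3 := hg v a
    rw [dot_sub, hXY, hXY] at h3
    rw [hXY n v, hXY n a] at hv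
    have h4 : (X n : ℚ) * X v + Y n * Y v = X n * X a + Y n * Y a := by exact_mod_cast hv
    push_cast at h3 ⊢
    linear_combination Y n * h3 + Y (P - P') * h4
  have hYq : (0 : ℚ) < Y n := by exact_mod_cast hY
  obtain ⟨hα', hβ'⟩ := eq_zero_of_overlap (s := (X a : ℚ)) (t := X c) (s' := X a') (t' := X c')
    (by exact_mod_cast h2) (by exact_mod_cast h1)
    (by rw [← hgl a rfl]; exact mul_nonneg hYq.le (hg1 a ha))
    (by rw [← hgl c hnc]; exact mul_nonneg hYq.le (hg1 c hc))
    (by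
      rw [← hgl a' (hline a' (memA ha') rfl)]
      exact mul_nonpos_of_nonneg_of_nonpos hYq.le (hg2 a' ha'))
    (by
      rw [← hgl c' (hline c' (memA hc') hnc')]
      exact mul_nonpos_of_nonneg_of_nonpos hYq.le (hg2 c' hc'))
  have hzero : ∀ v, dot n v = dot n a → g v = 0 := by
    intro v hv
    have := hgl v hv
    rw [hβ', hα', zero_mul, add_zero] at this
    exact (mul_eq_zero.1 this).resolve_left hYq.ne'
  have h5 := hg c a
  rw [hzero c hnc, hzero a rfl, sub_zero] at h5
  exact hne (by exact_mod_cast h5.symm)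

lemma sum_boundary_le_of_lt {ι : Type*} (s : Finset ι) {A : Finset (ℤ × ℤ)} {b : ℤ × ℤ → ℚ}
    {X Y : ℤ × ℤ → ℤ} (hXY : ∀ u v, dot u v = X u * X v + Y u * Y v) {d : ℕ}
    (hX : ∀ v ∈ A, 0 ≤ X v ∧ X v ≤ d) {a c n P : ι → ℤ × ℤ} {m : ι → ℕ}
    (ha : ∀ i ∈ s, a i ∈ face A b (ratPt (P i))) (hc : ∀ i ∈ s, c i ∈ face A b (ratPt (P i)))
    (hn : ∀ i ∈ s, ∀ v ∈ A, dot (n i) v ≤ dot (n i) (a i))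
    (hnc : ∀ i ∈ s, dot (n i) (c i) = dot (n i) (a i)) (hY : ∀ i ∈ s, 0 < Y (n i))
    (hm : ∀ i ∈ s, X (a i) + m i ≤ X (c i))
    (hne : ∀ i ∈ s, ∀ j ∈ s, i ≠ j → dot (P i - P j) (c i - a i) ≠ 0) :
    ∑ i ∈ s, m i ≤ d := by
  have hdisj : ∀ i ∈ s, ∀ j ∈ s, i ≠ j →
      Disjoint (Finset.Ico (X (a i)) (X (c i))) (Finset.Ico (X (a j)) (X (c j))) := by
    intro i hi j hj hij
    rw [Finset.disjoint_left]
    intro x hxi hxj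
    rw [Finset.mem_Ico] at hxi hxj
    exact not_overlap hXY (ha i hi) (hc i hi) (ha j hj) (hc j hj) (hn i hi) (hnc i hi) (hn j hj)
      (hnc j hj) (hY i hi) (hY j hj) (hne i hi j hj hij) (hxj.1.trans_lt hxi.2)
      (hxi.1.trans_lt hxj.2)
  calc ∑ i ∈ s, m i ≤ ∑ i ∈ s, (Finset.Ico (X (a i)) (X (c i))).card := by
        refine Finset.sum_le_sum fun i hi => ?_
        rw [Int.card_Ico]
        have := hm i hi
        omega
    _ = (s.biUnion fun i => Finset.Ico (X (a i)) (X (c i))).card :=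
        (Finset.card_biUnion hdisj).symm
    _ ≤ (Finset.Ico (0 : ℤ) d).card := by
        refine Finset.card_le_card (Finset.biUnion_subset.2 fun i hi => ?_)
        exact Finset.Ico_subset_Ico (hX _ (Finset.mem_filter.1 (ha i hi)).1).1
          (hX _ (Finset.mem_filter.1 (hc i hi)).1).2
    _ = d := by simp

lemma sum_boundary_le {ι : Type*} (s : Finset ι) {A : Finset (ℤ × ℤ)} {b : ℤ × ℤ → ℚ}
    {X Y : ℤ × ℤ → ℤ} (hXY : ∀ u v, dot u v = X u * X v + Y u * Y v) {d : ℕ}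
    (hX : ∀ v ∈ A, 0 ≤ X v ∧ X v ≤ d) {a c n P : ι → ℤ × ℤ} {m : ι → ℕ}
    (ha : ∀ i ∈ s, a i ∈ face A b (ratPt (P i))) (hc : ∀ i ∈ s, c i ∈ face A b (ratPt (P i)))
    (hn : ∀ i ∈ s, ∀ v ∈ A, dot (n i) v ≤ dot (n i) (a i))
    (hnc : ∀ i ∈ s, dot (n i) (c i) = dot (n i) (a i)) (hY : ∀ i ∈ s, 0 < Y (n i))
    (hm : ∀ i ∈ s, (m i : ℤ) ≤ |X (c i) - X (a i)|)
    (hne : ∀ i ∈ s, ∀ j ∈ s, i ≠ j → dot (P i - P j) (c i - a i) ≠ 0) :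
    ∑ i ∈ s, m i ≤ d := by
  refine sum_boundary_le_of_lt s hXY hX (b := b) (n := n) (P := P)
    (a := fun i => if X (a i) ≤ X (c i) then a i else c i)
    (c := fun i => if X (a i) ≤ X (c i) then c i else a i) ?_ ?_ ?_ ?_ hY ?_ ?_
  · intro i hi
    split_ifs
    exacts [ha i hi, hc i hi]
  · intro i hi
    split_ifs
    exacts [hc i hi, ha i hi]
  · intro i hi v hv
    split_ifs
    exacts [hn i hi v hv, (hnc i hi).symm ▸ hn i hi v hv]
  · intro i hi
    split_ifs
    exacts [hnc i hi, (hnc i hi).symm]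
  · intro i hi
    have := hm i hi
    split_ifs with h
    · rw [abs_of_nonneg (sub_nonneg.2 h)] at this
      linarith
    · rw [abs_of_neg (sub_neg.2 (not_le.1 h))] at this
      linarith
  · intro i hi j hj hij
    have := hne i hi j hj hij
    split_ifs
    · exact this
    · rw [dot_sub] at this ⊢
      intro h
      exact this (by linarith)

end Boundary

section Counting

open MeasureTheory

lemma mem_tangentCone_of_mem_face {Δ : Set (ℝ × ℝ)} {A : Finset (ℤ × ℤ)} {b : ℤ × ℤ → ℚ}
    (hΔ : ∀ v ∈ A, realPt v ∈ Δ) {P : ℤ × ℤ} {Q : ℚ × ℚ} {a c : ℤ × ℤ} (hac : a ≠ c)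
    (ha : a ∈ face A b (ratPt P)) (hc : c ∈ face A b (ratPt P)) (ha' : a ∈ face A b Q)
    (hc' : c ∈ face A b Q) : Q ∈ tangentCone Δ P := by
  refine ⟨a - c, ⟨sub_ne_zero.2 hac, a, hΔ a (Finset.mem_filter.1 ha).1, c,
    hΔ c (Finset.mem_filter.1 hc).1, rfl⟩, ?_⟩
  have h1 := height_eq_of_mem_face ha hc
  have h2 := height_eq_of_mem_face ha' hc'
  simp only [height, ratPt, Prod.fst_sub, Prod.snd_sub] at h1 h2 ⊢
  push_cast
  linear_combination h2 - h1

lemma ratPt_mem_tangentCone {Δ : Set (ℝ × ℝ)} {A : Finset (ℤ × ℤ)}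
    (hΔ : ∀ v ∈ A, realPt v ∈ Δ) {P P' a c : ℤ × ℤ} (hac : a ≠ c) (ha : a ∈ A) (hc : c ∈ A)
    (h : dot (P - P') (c - a) = 0) : ratPt P ∈ tangentCone Δ P' := by
  refine ⟨c - a, ⟨sub_ne_zero.2 hac.symm, c, hΔ c hc, a, hΔ a ha, rfl⟩, ?_⟩
  have h' : ((P - P').1 * (c - a).1 + (P - P').2 * (c - a).2 : ℚ) = 0 := by exact_mod_cast h
  simp only [ratPt, Prod.fst_sub, Prod.snd_sub] at h' ⊢
  push_cast at h' ⊢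
  linear_combination h'

lemma sum_le_of_fiber_card_le {κ α : Type*} [DecidableEq α] (s : Finset κ) (Q : κ → α)
    (V : α → ENNReal) {k : ℕ} (h : ∀ q, (s.filter fun x => Q x = q).card ≤ k) :
    ∑ x ∈ s, V (Q x) ≤ k * ∑ q ∈ s.image Q, V q := by
  rw [Finset.sum_comp V Q, Finset.mul_sum]
  refine Finset.sum_le_sum fun q _ => ?_
  rw [nsmul_eq_mul]
  gcongr
  exact h q

variable {ι : Type*} {Δ : Set (ℝ × ℝ)} {A : Finset (ℤ × ℤ)} {b : ℤ × ℤ → ℚ}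
  {P : ι → ℤ × ℤ} {m : ι → ℕ} {d : ℕ}

lemma sum_inner_le (hA : ∀ v ∈ A, realPt v ∈ stdTriangle d)
    (h3 : ∀ Q i j k, i ≠ j → i ≠ k → j ≠ k → Q ∈ tangentCone Δ (P i) → Q ∈ tangentCone Δ (P j) →
      Q ∉ tangentCone Δ (P k))
    (h2 : ∀ i j, i ≠ j → ratPt (P i) ∉ tangentCone Δ (P j)) (s : Finset (ι × Bool))
    (Q : ι × Bool → ℚ × ℚ) (hQ : ∀ x ∈ s, Q x ∈ tangentCone Δ (P x.1))
    (hQ' : ∀ i, (i, true) ∈ s → (i, false) ∈ s → Q (i, true) = Q (i, false) →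
      Q (i, true) = ratPt (P i))
    (hV : ∀ x ∈ s, ENNReal.ofReal (m x.1 / 2) ≤ volume (hull (face A b (Q x)))) :
    ∑ x ∈ s, m x.1 ≤ 2 * d ^ 2 := by
  classical
  have hpair : ∀ x ∈ s, ∀ y ∈ s, x ≠ y → x.1 = y.1 → Q x = Q y → Q x = ratPt (P x.1) := by
    rintro ⟨i, ε⟩ hx ⟨j, ε'⟩ hy hxy (rfl : i = j) hq
    cases ε <;> cases ε'
    · exact absurd rfl hxy
    · rw [hq]; exact hQ' i hy hx hq.symm
    · exact hQ' i hx hy hq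
    · exact absurd rfl hxy
  have htriple : ∀ x ∈ s, ∀ y ∈ s, ∀ z ∈ s, x ≠ y → x ≠ z → y ≠ z → x.1 = y.1 → Q x = Q y →
      Q x = Q z → False := by
    intro x hx y hy z hz hxy hxz hyz h hq hq'
    have h1 := hpair x hx y hy hxy h hq
    refine h2 x.1 z.1 (fun h' => ?_) (h1 ▸ hq' ▸ hQ z hz)
    have e1 : x.2 ≠ y.2 := fun e => hxy (Prod.ext h e)
    have e2 : x.2 ≠ z.2 := fun e => hxz (Prod.ext h' e)
    have e3 : y.2 ≠ z.2 := fun e => hyz (Prod.ext (h.symm.trans h') e)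
    revert e1 e2 e3
    cases x.2 <;> cases y.2 <;> cases z.2 <;> simp
  have hfib : ∀ q, (s.filter fun x => Q x = q).card ≤ 2 := by
    intro q
    by_contra! hlt
    obtain ⟨x, hx, y, hy, z, hz, hxy, hxz, hyz⟩ := Finset.two_lt_card.1 hlt
    obtain ⟨hxs, rfl⟩ := Finset.mem_filter.1 hx
    obtain ⟨hy, hyx⟩ := Finset.mem_filter.1 hy
    obtain ⟨hz, hzx⟩ := Finset.mem_filter.1 hz
    by_cases e1 : x.1 = y.1
    · exact htriple x hxs y hy z hz hxy hxz hyz e1 hyx.symm hzx.symm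
    by_cases e2 : x.1 = z.1
    · exact htriple x hxs z hz y hy hxz hxy hyz.symm e2 hzx.symm hyx.symm
    by_cases e3 : y.1 = z.1
    · exact htriple y hy z hz x hxs hyz hxy.symm hxz.symm e3 (hyx.trans hzx.symm) hyx
    exact h3 (Q x) x.1 y.1 z.1 e1 e2 e3 (hQ x hxs) (hyx ▸ hQ y hy) (hzx ▸ hQ z hz)
  have h := (Finset.sum_le_sum hV).trans (sum_le_of_fiber_card_le s Q
    (fun q => volume (hull (face A b q))) hfib)
  have h' := h.trans (mul_le_mul_right (sum_volume_hull_face_le b hA (s.image Q)) _)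
  rw [← ENNReal.ofReal_sum_of_nonneg (fun x _ => by positivity), ← ENNReal.ofReal_natCast,
    ← ENNReal.ofReal_mul (by positivity), ENNReal.ofReal_le_ofReal_iff (by positivity),
    ← Finset.sum_div] at h'
  have h'' : (∑ x ∈ s, (m x.1 : ℝ)) ≤ 2 * d ^ 2 := by
    push_cast at h'
    linarith
  exact_mod_cast h''

end Counting

section GlobalBound

variable {ι : Type*} [Fintype ι] {Δ : Set (ℝ × ℝ)} {A : Finset (ℤ × ℤ)} {b : ℤ × ℤ → ℚ}
  {P : ι → ℤ × ℤ} {m : ι → ℕ} {d : ℕ}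

lemma face_nonempty (hA : A.Nonempty) (b : ℤ × ℤ → ℚ) (Q : ℚ × ℚ) : (face A b Q).Nonempty := by
  obtain ⟨v, hv, hmax⟩ := A.exists_max_image (height b Q) hA
  exact ⟨v, Finset.mem_filter.2 ⟨hv, hmax⟩⟩

lemma sum_le_of_thick (hne : A.Nonempty) (hA : ∀ v ∈ A, realPt v ∈ stdTriangle d)
    (hΔ : ∀ v ∈ A, realPt v ∈ Δ) (hm : ∀ i, 1 ≤ m i)
    (hS : ∀ i, Thick (face A b (ratPt (P i))) (m i))
    (h3 : ∀ Q i j k, i ≠ j → i ≠ k → j ≠ k → Q ∈ tangentCone Δ (P i) → Q ∈ tangentCone Δ (P j) →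
      Q ∉ tangentCone Δ (P k))
    (h2 : ∀ i j, i ≠ j → ratPt (P i) ∉ tangentCone Δ (P j)) :
    ∑ i, m i ≤ d ^ 2 + 2 * d := by
  classical
  choose a ha c hc hac w hw halt using
    fun i => local_alternative (hS i) (hm i) (face_nonempty hne _ _)
  let nrm : ι × Bool → ℤ × ℤ := fun x =>
    cond x.2 (-(w x.1).2, (w x.1).1) ((w x.1).2, -(w x.1).1)
  have hnrm : ∀ x, nrm x = (-(w x.1).2, (w x.1).1) ∨ nrm x = ((w x.1).2, -(w x.1).1) := by
    rintro ⟨i, _ | _⟩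
    exacts [Or.inr rfl, Or.inl rfl]
  let inner : ι × Bool → ℚ → Prop := fun x s => 0 ≤ s ∧
    a x.1 ∈ face A b (rayPt (P x.1) (nrm x) s) ∧ c x.1 ∈ face A b (rayPt (P x.1) (nrm x) s) ∧
    ENNReal.ofReal (m x.1 / 2) ≤ MeasureTheory.volume (hull (face A b (rayPt (P x.1) (nrm x) s)))
  let N : Finset (ι × Bool) := Finset.univ.filter fun x => ∃ s, inner x s
  let B : Finset (ι × Bool) := Finset.univ.filter fun x => ¬∃ s, inner x s
  have hchoice : ∀ x, ∃ s, x ∈ N → inner x s := by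
    intro x
    by_cases hx : x ∈ N
    · exact (Finset.mem_filter.1 hx).2.imp fun s hs _ => hs
    · exact ⟨0, fun h => absurd h hx⟩
  choose s hs using hchoice
  have hN : ∑ x ∈ N, m x.1 ≤ 2 * d ^ 2 := by
    refine sum_inner_le (b := b) hA h3 h2 N (fun x => rayPt (P x.1) (nrm x) (s x)) ?_ ?_ ?_
    · intro x hx
      obtain ⟨-, h1, h2, -⟩ := hs x hx
      exact mem_tangentCone_of_mem_face hΔ (hac x.1) (ha x.1) (hc x.1) h1 h2
    · intro i hi hi' h
      have h1 := (hs _ hi).1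
      have h1' := (hs _ hi').1
      rw [Prod.ext_iff] at h
      simp only [rayPt, nrm, cond_true, cond_false, Int.cast_neg] at h
      suffices hs0 : s (i, true) = 0 by
        change rayPt (P i) (nrm (i, true)) (s (i, true)) = ratPt (P i)
        rw [hs0, rayPt_zero]
      have e1 : (s (i, true) + s (i, false)) * (w i).2 = 0 := by linarith [h.1]
      have e2 : (s (i, true) + s (i, false)) * (w i).1 = 0 := by linarith [h.2]
      have e3 : s (i, true) + s (i, false) = 0 := by
        by_contra hne
        refine hw i (Prod.ext ?_ ?_)
        · exact_mod_cast (mul_eq_zero.1 e2).resolve_left hne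
        · exact_mod_cast (mul_eq_zero.1 e1).resolve_left hne
      linarith
    · exact fun x hx => (hs x hx).2.2.2
  have hB : ∀ x ∈ B, ∃ L : ℤ, (m x.1 : ℤ) ≤ L ∧ (c x.1).1 = (a x.1).1 + L * (w x.1).1 ∧
      (c x.1).2 = (a x.1).2 + L * (w x.1).2 ∧ ∀ v ∈ A, dot (nrm x) v ≤ dot (nrm x) (a x.1) :=
    fun x hx => (halt x.1 (nrm x) (hnrm x)).resolve_left (Finset.mem_filter.1 hx).2
  have hclass : ∀ X Y : ℤ × ℤ → ℤ, (∀ u v, dot u v = X u * X v + Y u * Y v) →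
      (∀ v ∈ A, 0 ≤ X v ∧ X v ≤ d) → (∀ v, Y (-v) = -Y v) →
      (∀ x L, (c x.1).1 = (a x.1).1 + L * (w x.1).1 → (c x.1).2 = (a x.1).2 + L * (w x.1).2 →
        |X (c x.1) - X (a x.1)| = |L * Y (nrm x)|) →
      ∑ x ∈ B.filter (fun x => 0 < Y (nrm x)), m x.1 ≤ d := by
    intro X Y hXY hX hYneg hXw
    refine sum_boundary_le _ hXY hX (A := A) (b := b) (a := fun x => a x.1) (c := fun x => c x.1)
      (n := nrm) (P := fun x => P x.1) (fun x _ => ha x.1) (fun x _ => hc x.1) ?_ ?_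
      (fun x hx => (Finset.mem_filter.1 hx).2) ?_ ?_
    · intro x hx
      obtain ⟨L, -, -, -, h⟩ := hB x (Finset.mem_filter.1 hx).1
      exact h
    · intro x hx
      obtain ⟨L, -, e1, e2, -⟩ := hB x (Finset.mem_filter.1 hx).1
      rcases hnrm x with h | h <;> rw [h] <;> simp only [dot] <;> rw [e1, e2] <;> ring
    · intro x hx
      obtain ⟨hxB, hY⟩ := Finset.mem_filter.1 hx
      obtain ⟨L, hL, e1, e2, -⟩ := hB x hxB
      rw [hXw x L e1 e2]
      refine le_trans ?_ (le_abs_self _)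
      nlinarith [Int.natCast_nonneg (m x.1)]
    · intro x hx y hy hxy h
      by_cases e : x.1 = y.1
      · have h1 := (Finset.mem_filter.1 hx).2
        have h2 := (Finset.mem_filter.1 hy).2
        have h3 : nrm y = -nrm x := by
          obtain ⟨i, ε⟩ := x
          obtain ⟨j, ε'⟩ := y
          obtain rfl : i = j := e
          cases ε <;> cases ε' <;> first | exact absurd rfl hxy | simp [nrm]
        rw [h3, hYneg] at h2
        linarith
      · exact h2 x.1 y.1 e (ratPt_mem_tangentCone hΔ (hac x.1) (Finset.mem_filter.1 (ha x.1)).1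
          (Finset.mem_filter.1 (hc x.1)).1 h)
  have hA' : ∀ v ∈ A, 0 ≤ v.1 ∧ 0 ≤ v.2 ∧ v.1 + v.2 ≤ d := by
    intro v hv
    obtain ⟨h1, h2, h3⟩ := hA v hv
    simp only [realPt] at h1 h2 h3
    exact ⟨by exact_mod_cast h1, by exact_mod_cast h2, by exact_mod_cast h3⟩
  have habs : ∀ x L, (c x.1).1 = (a x.1).1 + L * (w x.1).1 →
      (c x.1).2 = (a x.1).2 + L * (w x.1).2 →
      |(c x.1).1 - (a x.1).1| = |L * (nrm x).2| ∧ |(c x.1).2 - (a x.1).2| = |L * (nrm x).1| := by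
    intro x L e1 e2
    rw [e1, e2, add_sub_cancel_left, add_sub_cancel_left]
    rcases hnrm x with h | h <;> rw [h] <;> simp
  have hB1 := hclass (fun v => v.1) (fun v => v.2) (fun u v => rfl)
    (fun v hv => by have := hA' v hv; constructor <;> linarith) (fun v => rfl)
    (fun x L e1 e2 => (habs x L e1 e2).1)
  have hB2 := hclass (fun v => v.1) (fun v => -v.2) (fun u v => by simp only [dot]; ring)
    (fun v hv => by have := hA' v hv; constructor <;> linarith) (fun v => rfl)
    (fun x L e1 e2 => by rw [mul_neg, abs_neg]; exact (habs x L e1 e2).1)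
  have hB3 := hclass (fun v => v.2) (fun v => v.1) (fun u v => by simp only [dot]; ring)
    (fun v hv => by have := hA' v hv; constructor <;> linarith) (fun v => rfl)
    (fun x L e1 e2 => (habs x L e1 e2).2)
  have hB4 := hclass (fun v => v.2) (fun v => -v.1) (fun u v => by simp only [dot]; ring)
    (fun v hv => by have := hA' v hv; constructor <;> linarith) (fun v => rfl)
    (fun x L e1 e2 => by rw [mul_neg, abs_neg]; exact (habs x L e1 e2).2)
  have hBsum : ∑ x ∈ B, m x.1 ≤ 4 * d := by
    have h : ∑ x ∈ B, m x.1 ≤ ∑ x ∈ B.filter (fun x => 0 < (nrm x).2), m x.1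
        + ∑ x ∈ B.filter (fun x => 0 < -(nrm x).2), m x.1
        + ∑ x ∈ B.filter (fun x => 0 < (nrm x).1), m x.1
        + ∑ x ∈ B.filter (fun x => 0 < -(nrm x).1), m x.1 := by
      simp only [Finset.sum_filter]
      rw [← Finset.sum_add_distrib, ← Finset.sum_add_distrib, ← Finset.sum_add_distrib]
      refine Finset.sum_le_sum fun x _ => ?_
      have hn0 : (nrm x).1 ≠ 0 ∨ (nrm x).2 ≠ 0 := by
        by_contra! h0
        rcases hnrm x with h | h <;>
          simp only [h, neg_eq_zero] at h0 <;> exact hw x.1 (Prod.ext h0.2 h0.1)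
      split_ifs <;> omega
    linarith
  have htotal : ∑ x : ι × Bool, m x.1 = 2 * ∑ i, m i := by
    rw [Fintype.sum_prod_type, Finset.mul_sum]
    simp
  have hsplit := Finset.sum_filter_add_sum_filter_not Finset.univ (fun x => ∃ s, inner x s)
    fun x => m x.1
  rw [htotal] at hsplit
  have hsplit' : ∑ x ∈ N, m x.1 + ∑ x ∈ B, m x.1 = 2 * ∑ i, m i := hsplit
  linarith

end GlobalBound

section GeneralPosition

lemma not_mem_tangentCone_of_third {Δ : Set (ℝ × ℝ)} (h10 : ((1 : ℤ), (0 : ℤ)) ∈ dirSet Δ)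
    (h01 : ((0 : ℤ), (1 : ℤ)) ∈ dirSet Δ) {P P' R : ℤ × ℤ}
    (h : tangentCone Δ P ∩ tangentCone Δ P' ∩ tangentCone Δ R = ∅) :
    ratPt P ∉ tangentCone Δ P' := by
  rintro ⟨u, hu, hPu⟩
  have hline : ∀ q : ℚ × ℚ, (u.1 : ℚ) * (q.1 - P'.1) + u.2 * (q.2 - P'.2) = 0 →
      q ∈ tangentCone Δ R → False := by
    intro q hq hR
    have hqP : q ∈ tangentCone Δ P := by
      refine ⟨u, hu, ?_⟩
      simp only [ratPt] at hPu
      linear_combination hq - hPu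
    have : q ∈ tangentCone Δ P ∩ tangentCone Δ P' ∩ tangentCone Δ R := ⟨⟨hqP, u, hu, hq⟩, hR⟩
    rw [h] at this
    exact this
  by_cases hu2 : u.2 = 0
  · have hu1 : (u.1 : ℚ) ≠ 0 := fun h => hu.1 (Prod.ext (by exact_mod_cast h) hu2)
    exact hline (P'.1, R.2) (by rw [hu2]; simp) ⟨_, h01, by simp⟩
  · have hu2' : (u.2 : ℚ) ≠ 0 := by exact_mod_cast hu2
    refine hline (R.1, P'.2 - u.1 * (R.1 - P'.1) / u.2) ?_ ⟨_, h10, by simp⟩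
    field_simp
    ring

lemma stdTriangle_subset_convexHull {t : ℝ} (ht : 0 < t) :
    stdTriangle t ⊆ convexHull ℝ ({((0 : ℝ), (0 : ℝ)), (t, (0 : ℝ)), ((0 : ℝ), t)} :
      Set (ℝ × ℝ)) := by
  rintro ⟨x, y⟩ ⟨hx, hy, hxy⟩
  simp only at hx hy hxy
  have h := (convex_convexHull ℝ ({((0 : ℝ), (0 : ℝ)), (t, (0 : ℝ)), ((0 : ℝ), t)} :
    Set (ℝ × ℝ))).sum_mem (t := Finset.univ) (w := ![1 - (x + y) / t, x / t, y / t])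
    (z := ![(0, 0), (t, 0), (0, t)])
    (by
      have : (x + y) / t ≤ 1 := (div_le_one ht).2 hxy
      intro i _
      fin_cases i
      · simpa using this
      · exact div_nonneg hx ht.le
      · exact div_nonneg hy ht.le)
    (by
      simp [Fin.sum_univ_three]
      field_simp
      ring)
    (by intro i _; fin_cases i <;> exact subset_convexHull ℝ _ (by simp))
  convert h using 1
  simp only [Fin.sum_univ_three]
  ext <;> simp [ht.ne']

lemma realPt_mem_stdTriangle {K : Type*} [Field K] {f : MvPolynomial (Fin 2) K} {v : ℤ × ℤ}
    (hv : v ∈ latticeSupport f) : realPt v ∈ stdTriangle f.totalDegree := by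
  obtain ⟨x, hx, rfl⟩ := Finset.mem_image.1 hv
  have h := le_totalDegree hx
  rw [Finsupp.sum_fintype _ _ fun _ => rfl, Fin.sum_univ_two] at h
  simp only [stdTriangle, realPt, latticePt, Set.mem_ofPred_eq, Int.cast_natCast]
  exact ⟨Nat.cast_nonneg _, Nat.cast_nonneg _, by exact_mod_cast h⟩

lemma stdTriangle_mono {s t : ℝ} (h : s ≤ t) : stdTriangle s ⊆ stdTriangle t :=
  fun _ hx => ⟨hx.1, hx.2.1, hx.2.2.trans h⟩

lemma latticeSupport_nonempty {K : Type*} [Field K] {f : MvPolynomial (Fin 2) K} (hf : f ≠ 0) :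
    (latticeSupport f).Nonempty :=
  (support_nonempty.2 hf).image _

section

variable {K : Type*} [Field K] {val : K → WithBot ℚ}
  (hval_mul : ∀ a b : K, val (a * b) = val a + val b)
  (hval_add : ∀ a b : K, val (a + b) ≤ max (val a) (val b))
  (hval_zero : ∀ x : K, val x = ⊥ ↔ x = 0) {ι : Type*} {p : ι → K × K}
  {P : ι → ℤ × ℤ}
  (hP : ∀ i, val (p i).1 = (((P i).1 : ℚ) : WithBot ℚ) ∧
    val (p i).2 = (((P i).2 : ℚ) : WithBot ℚ))
  {Δ : Set (ℝ × ℝ)}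
  (h3 : ∀ Q i j k, i ≠ j → i ≠ k → j ≠ k → Q ∈ tangentCone Δ (P i) → Q ∈ tangentCone Δ (P j) →
    Q ∉ tangentCone Δ (P k))
  {f : MvPolynomial (Fin 2) K} (hf : f ≠ 0) (hΔ : stdTriangle f.totalDegree ⊆ Δ)

include hval_mul hval_add hval_zero hP hf in
lemma thick_face_mult (i : ι) :
    Thick (face (latticeSupport f) (coeffVal val f) (ratPt (P i))) (mult (p i) f) :=
  thick_face hval_mul hval_add hval_zero (hP i) ((multAtLeast_iff_le_mult _ _ hf).2 le_rfl)

variable [Fintype ι]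

include hval_mul hval_add hval_zero hP h3 hf hΔ in
theorem sum_mult_le (h2 : ∀ i j, i ≠ j → ratPt (P i) ∉ tangentCone Δ (P j)) :
    ∑ i, mult (p i) f ≤ f.totalDegree ^ 2 + 2 * f.totalDegree := by
  classical
  have h := sum_le_of_thick (ι := {i // 1 ≤ mult (p i) f}) (P := fun i => P i)
    (m := fun i => mult (p i) f) (b := coeffVal val f) (latticeSupport_nonempty hf)
    (fun v hv => realPt_mem_stdTriangle hv) (fun v hv => hΔ (realPt_mem_stdTriangle hv))
    (fun i => i.2) (fun i => thick_face_mult hval_mul hval_add hval_zero hP hf i)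
    (fun Q i j k hij hik hjk => h3 Q i j k (Subtype.coe_ne_coe.2 hij) (Subtype.coe_ne_coe.2 hik)
      (Subtype.coe_ne_coe.2 hjk))
    (fun i j hij => h2 i j (Subtype.coe_ne_coe.2 hij))
  rw [← Finset.sum_subtype (Finset.univ.filter fun i => 1 ≤ mult (p i) f) (by simp)
    fun i => mult (p i) f, Finset.sum_filter] at h
  refine (Finset.sum_le_sum fun i _ => ?_).trans h
  split_ifs <;> omega

include hval_mul hval_add hval_zero hP h3 hf hΔ in
theorem sum_mult_le_two (hdeg : f.totalDegree = 1) : ∑ i, mult (p i) f ≤ 2 := by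
  classical
  have h1 : ∑ i, mult (p i) f ≤ (Finset.univ.filter fun i => 1 ≤ mult (p i) f).card := by
    rw [Finset.card_filter]
    refine Finset.sum_le_sum fun i _ => ?_
    have := mult_le_totalDegree (p i) hf
    split_ifs <;> omega
  refine h1.trans (not_lt.1 fun hlt => ?_)
  obtain ⟨i, hi, j, hj, k, hk, hij, hik, hjk⟩ := Finset.two_lt_card.1 hlt
  let b := coeffVal val f
  let Q : ℚ × ℚ := (b (0, 0) - b (1, 0), b (0, 0) - b (0, 1))
  have hconst : ∀ v ∈ latticeSupport f, height b Q v = b (0, 0) := by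
    intro v hv
    obtain ⟨h1, h2, h3⟩ := realPt_mem_stdTriangle hv
    rw [hdeg] at h3
    simp only [realPt] at h1 h2 h3
    have h1' : 0 ≤ v.1 := by exact_mod_cast h1
    have h2' : 0 ≤ v.2 := by exact_mod_cast h2
    have h3' : v.1 + v.2 ≤ 1 := by exact_mod_cast h3
    obtain h | h | h : v = (0, 0) ∨ v = (1, 0) ∨ v = (0, 1) := by
      simp only [Prod.ext_iff]
      omega
    all_goals
      rw [h]
      simp [height, Q]
  have hmem : ∀ v ∈ latticeSupport f, v ∈ face (latticeSupport f) b Q := fun v hv =>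
    Finset.mem_filter.2 ⟨hv, fun w hw => by rw [hconst v hv, hconst w hw]⟩
  have hcone : ∀ i, 1 ≤ mult (p i) f → Q ∈ tangentCone Δ (P i) := by
    intro i hi
    obtain ⟨v, hv, w, hw, hvw⟩ := (thick_face_mult hval_mul hval_add hval_zero hP hf i).exists_ne hi
      (face_nonempty (latticeSupport_nonempty hf) _ _)
    exact mem_tangentCone_of_mem_face (fun v hv => hΔ (realPt_mem_stdTriangle hv)) hvw hv hw
      (hmem v (Finset.mem_filter.1 hv).1) (hmem w (Finset.mem_filter.1 hw).1)
  exact h3 Q i j k hij hik hjk (hcone i (Finset.mem_filter.1 hi).2)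
    (hcone j (Finset.mem_filter.1 hj).2) (hcone k (Finset.mem_filter.1 hk).2)

end

end GeneralPosition

end PlaneCurve

/-- Degree version of Statement 3: for a curve of degree at most `d`
(`d ≥ max mᵢ`) through points whose valuation vectors are integral and in general position
with respect to the triangle `T_d`, one gets `d² ≥ ½·Σ mᵢ²`. -/
theorem statement4 (K : Type*) [Field K]
    (val : K → WithBot ℚ)
    (hval_mul : ∀ a b : K, val (a * b) = val a + val b)
    (hval_add : ∀ a b : K, val (a + b) ≤ max (val a) (val b))
    (hval_zero : ∀ x : K, val x = ⊥ ↔ x = 0)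
    (n : ℕ) (hn : 2 ≤ n) (m : Fin n → ℕ) (hm : ∀ i, 1 ≤ m i)
    (d : ℕ) (hd : 1 ≤ d) (hdm : ∀ i, m i ≤ d)
    (p : Fin n → K × K) (hp : ∀ i, (p i).1 ≠ 0 ∧ (p i).2 ≠ 0)
    (P : Fin n → ℤ × ℤ)
    (hvalP : ∀ i, val (p i).1 = (((P i).1 : ℚ) : WithBot ℚ) ∧
                  val (p i).2 = (((P i).2 : ℚ) : WithBot ℚ))
    (hgen : InGeneralPosition
      (convexHull ℝ ({((0 : ℝ), (0 : ℝ)), ((d : ℝ), (0 : ℝ)), ((0 : ℝ), (d : ℝ))} :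
        Set (ℝ × ℝ))) P)
    (Cf : MvPolynomial (Fin 2) K) (hC0 : Cf ≠ 0) (hdeg : Cf.totalDegree ≤ d)
    (hmult : ∀ i, multAtLeast (p i) (m i) Cf) :
    ((d : ℝ)) ^ 2 ≥ (1 / 2) * ∑ i, (m i : ℝ) ^ 2 := by
  have key : ∑ i, m i ^ 2 ≤ 2 * d ^ 2 := by
    rcases hn.eq_or_lt with rfl | hn3
    · rw [Fin.sum_univ_two, two_mul]
      exact add_le_add (Nat.pow_le_pow_left (hdm 0) 2) (Nat.pow_le_pow_left (hdm 1) 2)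
    let Δ : Set (ℝ × ℝ) :=
      convexHull ℝ {((0 : ℝ), (0 : ℝ)), ((d : ℝ), (0 : ℝ)), ((0 : ℝ), (d : ℝ))}
    have hΔ : PlaneCurve.stdTriangle d ⊆ Δ :=
      PlaneCurve.stdTriangle_subset_convexHull (by exact_mod_cast hd)
    have hd1 : (1 : ℝ) ≤ d := by exact_mod_cast hd
    have h00 : (((0 : ℤ) : ℝ), ((0 : ℤ) : ℝ)) ∈ Δ := hΔ (by simp [PlaneCurve.stdTriangle])
    have h10 : ((1 : ℤ), (0 : ℤ)) ∈ dirSet Δ :=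
      ⟨by simp, (1, 0), hΔ (by simp [PlaneCurve.stdTriangle, hd1]), (0, 0), h00, by simp⟩
    have h01 : ((0 : ℤ), (1 : ℤ)) ∈ dirSet Δ :=
      ⟨by simp, (0, 1), hΔ (by simp [PlaneCurve.stdTriangle, hd1]), (0, 0), h00, by simp⟩
    have h3 : ∀ Q i j k, i ≠ j → i ≠ k → j ≠ k → Q ∈ tangentCone Δ (P i) →
        Q ∈ tangentCone Δ (P j) → Q ∉ tangentCone Δ (P k) := by
      intro Q i j k hij hik hjk hi hj hk
      have h : Q ∈ tangentCone Δ (P i) ∩ tangentCone Δ (P j) ∩ tangentCone Δ (P k) :=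
        ⟨⟨hi, hj⟩, hk⟩
      rw [hgen i j k hij hik hjk] at h
      exact h
    have h2 : ∀ i j, i ≠ j → PlaneCurve.ratPt (P i) ∉ tangentCone Δ (P j) := by
      intro i j hij
      obtain ⟨k, hk⟩ : ∃ k, k ∉ ({i, j} : Finset (Fin n)) := by
        by_contra! h
        have h' := Finset.card_le_card (fun x _ => h x : Finset.univ ⊆ ({i, j} : Finset (Fin n)))
        rw [Finset.card_univ, Fintype.card_fin] at h'
        exact absurd (h'.trans Finset.card_le_two) (not_le.2 hn3)
      rw [Finset.mem_insert, Finset.mem_singleton, not_or] at hk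
      exact PlaneCurve.not_mem_tangentCone_of_third h10 h01
        (hgen i j k hij (Ne.symm hk.1) (Ne.symm hk.2))
    have hpinj : Function.Injective p := by
      intro i j hij
      by_contra hne
      refine h2 i j hne ⟨_, h10, ?_⟩
      have h := (hvalP i).1
      rw [hij, (hvalP j).1, WithBot.coe_inj] at h
      simp [PlaneCurve.ratPt, h]
    have hsub : ∀ f : MvPolynomial (Fin 2) K, f.totalDegree ≤ d →
        PlaneCurve.stdTriangle f.totalDegree ⊆ Δ := fun f hf =>
      (PlaneCurve.stdTriangle_mono (by exact_mod_cast hf)).trans hΔ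
    have h := PlaneCurve.sum_mult_sq_le hpinj (D := d)
      (fun f hf1 hfd => PlaneCurve.sum_mult_le_two hval_mul hval_add hval_zero hvalP h3
        (by rintro rfl; simp at hf1) (hsub f hfd) hf1)
      (fun f hf hfd => PlaneCurve.sum_mult_le hval_mul hval_add hval_zero hvalP h3 hf
        (hsub f hfd) h2) Cf hC0 hdeg
    refine (Finset.sum_le_sum fun i _ => Nat.pow_le_pow_left
      ((PlaneCurve.multAtLeast_iff_le_mult (p i) (m i) hC0).1 (hmult i)) 2).trans (h.trans ?_)
    exact Nat.mul_le_mul_left 2 (Nat.pow_le_pow_left hdeg 2)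
  have key' : ∑ i, (m i : ℝ) ^ 2 ≤ 2 * d ^ 2 := by exact_mod_cast key
  linarith
end

section
/- (Detropicalization lemma.) Let F be an infinite field and let K = F(t) be the field of rational functions over F (Mathlib's RatFunc F), with t ∈ K the image of the polynomial variable. Let n ≥ 1, let m₁,…,mₙ be positive integers, let x₁,…,xₙ, y₁,…,yₙ ∈ ℤ, and let Δ ⊂ ℝ² be a convex lattice polygon. Suppose there is no nonzero polynomial C ∈ K[x,y] whose Newton polygon equals Δ and such that μ_{(t^{−xᵢ}, t^{−yᵢ})}(C) ≥ mᵢ for every i = 1,…,n (here t^{−x} denotes the integer power in the field K). Then the set of elements a ∈ F∖{0} for which there exists a nonzero polynomial C' ∈ F[x,y] with Newton polygon equal to Δ and μ_{(a^{−xᵢ}, a^{−yᵢ})}(C') ≥ mᵢ for every i is finite; in particular, there exists a ∈ F∖{0} such that no such polynomial C' over F exists. -/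
open MvPolynomial

open scoped LaurentPolynomial

namespace LaurentPolynomial

variable {F : Type*} [Field F]

/-- Evaluation of a Laurent polynomial at a unit of an algebra. -/
noncomputable def evalUnit {A : Type*} [CommRing A] [Algebra F A] (a : Aˣ) : F[T;T⁻¹] →+* A :=
  eval₂ (algebraMap F A) a

lemma finite_setOf_evalUnit_eq_zero {f : F[T;T⁻¹]} (hf : f ≠ 0) :
    {a : Fˣ | evalUnit a f = 0}.Finite := by
  obtain ⟨n, g, hg⟩ := f.exists_T_pow
  have hg0 : g ≠ 0 := by
    rintro rfl
    rw [map_zero, eq_comm, (isUnit_T (R := F) n).mul_left_eq_zero] at hg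
    exact hf hg
  refine ((Polynomial.finite_setOfPred_isRoot hg0).preimage Units.val_injective.injOn).subset ?_
  intro a ha
  have h := congrArg (evalUnit a) hg
  rw [map_mul, show evalUnit a f = 0 from ha, zero_mul, evalUnit, eval₂_toLaurent] at h
  exact h

lemma evalUnit_toLaurent_eq_algebraMap {a : (RatFunc F)ˣ} (ha : (a : RatFunc F) = RatFunc.X)
    (g : Polynomial F) : evalUnit a (Polynomial.toLaurent g) = algebraMap _ (RatFunc F) g := by
  rw [evalUnit, eval₂_toLaurent, ha, ← Polynomial.aeval_def, RatFunc.aeval_X_left_eq_algebraMap]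

lemma evalUnit_injective {a : (RatFunc F)ˣ} (ha : (a : RatFunc F) = RatFunc.X) :
    Function.Injective (evalUnit (F := F) a) := by
  rw [injective_iff_map_eq_zero]
  intro f hf
  obtain ⟨n, g, hg⟩ := f.exists_T_pow
  have h := congrArg (evalUnit a) hg
  rw [map_mul, hf, zero_mul, evalUnit_toLaurent_eq_algebraMap ha,
    FaithfulSMul.algebraMap_eq_zero_iff] at h
  rw [h, map_zero, eq_comm, (isUnit_T (R := F) n).mul_left_eq_zero] at hg
  exact hg

/-- A linear system with Laurent polynomial entries that is insoluble over `F(t)` becomes soluble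
for only finitely many specializations of `t`. -/
lemma finite_setOf_evalUnit_mem_span {ι J : Type*} [Finite J] {t : (RatFunc F)ˣ}
    (ht : (t : RatFunc F) = RatFunc.X) (s : Set ι) (w : ι → J → F[T;T⁻¹]) (b : J → F[T;T⁻¹])
    (h : evalUnit t ∘ b ∉ Submodule.span (RatFunc F) ((fun d ↦ evalUnit t ∘ w d) '' s)) :
    {a : Fˣ | evalUnit a ∘ b ∈ Submodule.span F ((fun d ↦ evalUnit a ∘ w d) '' s)}.Finite := by
  classical
  cases nonempty_fintype J
  obtain ⟨l, hlb, hlw⟩ := Submodule.exists_dual_map_eq_bot_of_notMem h inferInstance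
  obtain ⟨q, hq⟩ := IsLocalization.exist_integer_multiples_of_finite
    (nonZeroDivisors (Polynomial F)) (fun j ↦ l (Pi.single j 1))
  choose c hc using hq
  let r : (J → F[T;T⁻¹]) → F[T;T⁻¹] := fun u ↦ ∑ j, Polynomial.toLaurent (c j) * u j
  have hr (u) : evalUnit t (r u) = algebraMap _ (RatFunc F) (q : Polynomial F) *
      l (evalUnit t ∘ u) := by
    rw [LinearMap.pi_apply_eq_sum_univ l (evalUnit t ∘ u), Finset.mul_sum, map_sum]
    refine Finset.sum_congr rfl fun j _ ↦ ?_
    have hs : (Pi.single j 1 : J → RatFunc F) = fun i ↦ if j = i then 1 else 0 := by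
      ext i; simp [Pi.single_apply, eq_comm]
    rw [map_mul, evalUnit_toLaurent_eq_algebraMap ht, hc, Algebra.smul_def, hs, smul_eq_mul,
      Function.comp_apply]
    ring
  have hb : r b ≠ 0 := by
    intro h0
    have hrb := hr b
    rw [h0, map_zero, eq_comm, mul_eq_zero, FaithfulSMul.algebraMap_eq_zero_iff] at hrb
    exact hrb.elim (nonZeroDivisors.ne_zero q.2) hlb
  have hw : ∀ d ∈ s, r (w d) = 0 := by
    intro d hd
    apply evalUnit_injective ht
    have : l (evalUnit t ∘ w d) = 0 := by
      rw [← Submodule.mem_bot (RatFunc F), ← hlw]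
      exact Submodule.mem_map_of_mem (Submodule.subset_span ⟨d, hd, rfl⟩)
    rw [hr, this, mul_zero, map_zero]
  refine (finite_setOf_evalUnit_eq_zero hb).subset fun a ha ↦ ?_
  let la : (J → F) →ₗ[F] F := ∑ j, evalUnit a (Polynomial.toLaurent (c j)) • LinearMap.proj j
  have hla (u) : la (evalUnit a ∘ u) = evalUnit a (r u) := by
    simp [la, r, LinearMap.sum_apply, map_sum]
  have hle : Submodule.span F ((fun d ↦ evalUnit a ∘ w d) '' s) ≤ LinearMap.ker la := by
    rw [Submodule.span_le]
    rintro _ ⟨d, hd, rfl⟩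
    simp [hla, hw d hd]
  have := hle ha
  rwa [LinearMap.mem_ker, hla] at this

end LaurentPolynomial

namespace MvPolynomial

variable {R S : Type*} [CommRing R] [CommRing S]

/-- The substitution `f ↦ f(x + p₁, y + p₂)`. -/
noncomputable def translate (p : R × R) : MvPolynomial (Fin 2) R →ₐ[R] MvPolynomial (Fin 2) R :=
  aeval ![X 0 + C p.1, X 1 + C p.2]

lemma translate_neg_translate (p : R × R) (f : MvPolynomial (Fin 2) R) :
    translate (-p) (translate p f) = f := by
  have : (translate (-p)).comp (translate p) = AlgHom.id R _ := by
    ext i : 1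
    fin_cases i <;> simp [translate, algHom_C]
  exact DFunLike.congr_fun this f

lemma map_translate (φ : R →+* S) (p : R × R) (f : MvPolynomial (Fin 2) R) :
    map φ (translate p f) = translate (φ p.1, φ p.2) (map φ f) := by
  induction f using MvPolynomial.induction_on with
  | C a => simp [algHom_C]
  | add f g hf hg => simp [hf, hg]
  | mul_X f i hf =>
    rw [map_mul, map_mul, hf, map_mul, map_mul]
    congr 1
    fin_cases i <;> simp [translate]

lemma multAtLeast_iff_coeff_translate (p : R × R) (m : ℕ) (f : MvPolynomial (Fin 2) R) :
    multAtLeast p m f ↔ ∀ α : Fin 2 →₀ ℕ, α.degree < m → coeff α (translate p f) = 0 := by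
  rw [← mem_pow_idealOfVars_iff', multAtLeast]
  have hvars : idealOfVars (Fin 2) R = Ideal.span {X 0, X 1} := by
    rw [idealOfVars, ← Matrix.range_cons_cons_empty (X 0) (X 1) ![]]
    congr 2
    ext i : 1
    fin_cases i <;> rfl
  constructor
  · intro h
    have := Ideal.mem_map_of_mem (translate p) h
    rw [Ideal.map_pow, Ideal.map_span] at this
    simpa [Set.image_pair, translate, algHom_C, ← hvars] using this
  · intro h
    have := Ideal.mem_map_of_mem (translate (-p)) h
    rw [Ideal.map_pow, hvars, Ideal.map_span, translate_neg_translate] at this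
    simpa [Set.image_pair, translate, sub_eq_add_neg] using this

/-- Taylor coefficients of `f` of degree less than `m i` at the points `p i`. -/
noncomputable def jets {n : Type*} (m : n → ℕ) (p : n → R × R) :
    MvPolynomial (Fin 2) R →ₗ[R] ((i : n) × {α : Fin 2 →₀ ℕ // α.degree < m i}) → R :=
  LinearMap.pi fun j ↦ lcoeff R j.2.1 ∘ₗ (translate (p j.1)).toLinearMap

lemma jets_eq_zero_iff {n : Type*} {m : n → ℕ} {p : n → R × R} {f : MvPolynomial (Fin 2) R} :
    jets m p f = 0 ↔ ∀ i, multAtLeast (p i) (m i) f := by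
  simp_rw [multAtLeast_iff_coeff_translate]
  refine ⟨fun h i α hα ↦ congrFun h ⟨i, α, hα⟩, fun h ↦ ?_⟩
  ext j
  exact h j.1 j.2.1 j.2.2

lemma jets_monomial_map {n : Type*} (m : n → ℕ) (p : n → R × R) (φ : R →+* S) (d : Fin 2 →₀ ℕ) :
    jets m (fun i ↦ (φ (p i).1, φ (p i).2)) (monomial d 1) = φ ∘ jets m p (monomial d 1) := by
  ext j
  simp [jets, ← coeff_map, map_translate]

lemma mem_span_image_monomial_iff {K M : Type*} [Field K] [AddCommGroup M] [Module K M]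
    {σ : Type*} (L : MvPolynomial σ K →ₗ[K] M) {s : Set (σ →₀ ℕ)} {v : σ →₀ ℕ} (hv : v ∈ s) :
    L (monomial v 1) ∈ Submodule.span K ((fun d ↦ L (monomial d 1)) '' (s \ {v})) ↔
      ∃ f ∈ restrictSupport K s ⊓ LinearMap.ker L, coeff v f ≠ 0 := by
  classical
  rw [← Set.image_image L (fun d ↦ monomial d (1 : K)), ← Submodule.map_span,
    ← restrictSupport_eq_span]
  constructor
  · rintro ⟨g, hg, hgv⟩
    refine ⟨monomial v 1 - g, ⟨sub_mem ?_ (restrictSupport_mono K Set.sdiff_subset hg), ?_⟩, ?_⟩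
    · simp [hv]
    · simp [hgv]
    · have : coeff v g = 0 := by
        by_contra h0
        exact (hg (mem_support_iff.2 h0)).2 rfl
      simp [this]
  · rintro ⟨f, ⟨hfs, hfL⟩, hfv⟩
    refine ⟨monomial v 1 - (coeff v f)⁻¹ • f, fun d hd ↦ ?_, ?_⟩
    · have hd' : coeff d (monomial v 1 - (coeff v f)⁻¹ • f) ≠ 0 := mem_support_iff.1 hd
      have hdv : d ≠ v := by
        rintro rfl
        simp [hfv] at hd'
      have hdf : coeff d f ≠ 0 := fun h0 ↦ hd' (by simp [h0, coeff_monomial, hdv.symm])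
      exact ⟨hfs (mem_support_iff.2 hdf), hdv⟩
    · rw [map_sub, map_smul, LinearMap.mem_ker.1 hfL, smul_zero, sub_zero]

/-- The embedding of exponents into the plane. -/
def exponentPoint (d : Fin 2 →₀ ℕ) : ℝ × ℝ := (d 0, d 1)

lemma exponentPoint_injective : Function.Injective exponentPoint := by
  intro d e h
  simp only [exponentPoint, Prod.mk.injEq, Nat.cast_inj] at h
  ext i
  fin_cases i
  exacts [h.1, h.2]

lemma support_subset_of_newtonPolygon_eq {Δ : Set (ℝ × ℝ)} {f : MvPolynomial (Fin 2) R}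
    (h : newtonPolygon f = Δ) : (f.support : Set (Fin 2 →₀ ℕ)) ⊆ exponentPoint ⁻¹' Δ :=
  fun _ hd ↦ h ▸ subset_convexHull ℝ _ (Set.mem_image_of_mem exponentPoint hd)

lemma extremePoints_subset_of_newtonPolygon_eq {Δ : Set (ℝ × ℝ)} {f : MvPolynomial (Fin 2) R}
    (h : newtonPolygon f = Δ) : Δ.extremePoints ℝ ⊆ exponentPoint '' f.support :=
  h ▸ extremePoints_convexHull_subset

end MvPolynomial

lemma IsLatticePolygon.exists_finite {Δ : Set (ℝ × ℝ)} (h : IsLatticePolygon Δ) :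
    ∃ s : Set (ℝ × ℝ), s.Finite ∧ Δ = convexHull ℝ s := by
  obtain ⟨⟨A, rfl⟩, -⟩ := h
  exact ⟨_, A.finite_toSet.image _, rfl⟩

lemma IsLatticePolygon.finite_extremePoints {Δ : Set (ℝ × ℝ)} (h : IsLatticePolygon Δ) :
    (Δ.extremePoints ℝ).Finite := by
  obtain ⟨s, hs, rfl⟩ := h.exists_finite
  exact hs.subset extremePoints_convexHull_subset

lemma IsLatticePolygon.convexHull_extremePoints {Δ : Set (ℝ × ℝ)} (h : IsLatticePolygon Δ) :
    convexHull ℝ (Δ.extremePoints ℝ) = Δ := by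
  rw [← h.finite_extremePoints.isClosed_convexHull ℝ |>.closure_eq]
  obtain ⟨s, hs, rfl⟩ := h.exists_finite
  exact closure_convexHull_extremePoints (hs.isCompact_convexHull ℝ) (convex_convexHull ℝ s)

lemma IsLatticePolygon.newtonPolygon_eq_iff {R : Type*} [CommRing R] {Δ : Set (ℝ × ℝ)}
    (h : IsLatticePolygon Δ) {f : MvPolynomial (Fin 2) R} :
    newtonPolygon f = Δ ↔ (f.support : Set (Fin 2 →₀ ℕ)) ⊆ exponentPoint ⁻¹' Δ ∧
      Δ.extremePoints ℝ ⊆ exponentPoint '' f.support := by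
  refine ⟨fun hf ↦ ⟨support_subset_of_newtonPolygon_eq hf,
    extremePoints_subset_of_newtonPolygon_eq hf⟩, fun ⟨hs, hv⟩ ↦ Set.Subset.antisymm ?_ ?_⟩
  · refine convexHull_min (Set.image_subset_iff.2 hs) ?_
    rw [← h.convexHull_extremePoints]
    exact convex_convexHull ℝ _
  · conv_lhs => rw [← h.convexHull_extremePoints]
    exact convexHull_mono hv

lemma IsLatticePolygon.ne_zero_of_newtonPolygon_eq {R : Type*} [CommRing R] {Δ : Set (ℝ × ℝ)}
    (h : IsLatticePolygon Δ) {f : MvPolynomial (Fin 2) R} (hf : newtonPolygon f = Δ) : f ≠ 0 := by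
  rintro rfl
  obtain ⟨z, hz⟩ := h.2
  have := interior_subset hz
  simp [← hf, newtonPolygon] at this

/-- If infinitely many specializations admit a solution supported in `s` whose coefficient at `v`
is nonzero, then so does the generic system. -/
lemma exists_generic_of_infinite {F : Type*} [Field F] {n : Type*} [Finite n] (m : n → ℕ)
    (p : n → F[T;T⁻¹] × F[T;T⁻¹]) {t : (RatFunc F)ˣ} (ht : (t : RatFunc F) = RatFunc.X)
    {s : Set (Fin 2 →₀ ℕ)} {v : Fin 2 →₀ ℕ} (hv : v ∈ s)
    (h : {a : Fˣ | ∃ f ∈ restrictSupport F s ⊓ LinearMap.ker (jets m fun i ↦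
      (LaurentPolynomial.evalUnit a (p i).1, LaurentPolynomial.evalUnit a (p i).2)),
        coeff v f ≠ 0}.Infinite) :
    ∃ f ∈ restrictSupport (RatFunc F) s ⊓ LinearMap.ker (jets m fun i ↦
      (LaurentPolynomial.evalUnit t (p i).1, LaurentPolynomial.evalUnit t (p i).2)),
        coeff v f ≠ 0 := by
  have (i : n) : Finite {α : Fin 2 →₀ ℕ // α.degree < m i} := Finsupp.finite_of_degree_lt (m i)
  simp_rw [← mem_span_image_monomial_iff _ hv, jets_monomial_map] at h ⊢
  contrapose! h
  exact LaurentPolynomial.finite_setOf_evalUnit_mem_span ht _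
    (fun d ↦ jets m p (monomial d 1)) _ h

/-- Detropicalization lemma. If over `K = F(t)` there is no curve with
Newton polygon `Δ` through the points `(t^{−xᵢ}, t^{−yᵢ})` with multiplicities `mᵢ`, then
the set of `a ∈ F \ {0}` for which such a curve exists over `F` through
`(a^{−xᵢ}, a^{−yᵢ})` is finite; in particular some `a ≠ 0` admits no such curve. -/
theorem statement6 (F : Type*) [Field F] [Infinite F]
    (n : ℕ) (hn : 1 ≤ n) (m : Fin n → ℕ) (hm : ∀ i, 1 ≤ m i)
    (x y : Fin n → ℤ)
    (Δ : Set (ℝ × ℝ)) (hΔ : IsLatticePolygon Δ)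
    (hK : ¬ ∃ Cf : MvPolynomial (Fin 2) (RatFunc F), Cf ≠ 0 ∧ newtonPolygon Cf = Δ ∧
        ∀ i, multAtLeast ((RatFunc.X : RatFunc F) ^ (-(x i)),
                          (RatFunc.X : RatFunc F) ^ (-(y i))) (m i) Cf) :
    { a : F | a ≠ 0 ∧ ∃ Cf : MvPolynomial (Fin 2) F, Cf ≠ 0 ∧ newtonPolygon Cf = Δ ∧
        ∀ i, multAtLeast (a ^ (-(x i)), a ^ (-(y i))) (m i) Cf }.Finite ∧
    ∃ a : F, a ≠ 0 ∧ ¬ ∃ Cf : MvPolynomial (Fin 2) F, Cf ≠ 0 ∧ newtonPolygon Cf = Δ ∧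
        ∀ i, multAtLeast (a ^ (-(x i)), a ^ (-(y i))) (m i) Cf := by
  have hfin : { a : F | a ≠ 0 ∧ ∃ Cf : MvPolynomial (Fin 2) F, Cf ≠ 0 ∧ newtonPolygon Cf = Δ ∧
      ∀ i, multAtLeast (a ^ (-(x i)), a ^ (-(y i))) (m i) Cf }.Finite := by
    by_contra hinf
    obtain ⟨-, -, f₀, -, hf₀, -⟩ := Set.Infinite.nonempty hinf
    have hvertex : Δ.extremePoints ℝ ⊆ Set.range exponentPoint :=
      (extremePoints_subset_of_newtonPolygon_eq hf₀).trans (Set.image_subset_range _ _)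
    have := hΔ.finite_extremePoints.to_subtype
    choose d hd using fun v : Δ.extremePoints ℝ ↦ hvertex v.2
    have : Infinite (RatFunc F) := .of_injective _ (algebraMap F (RatFunc F)).injective
    let t : (RatFunc F)ˣ := Units.mk0 RatFunc.X RatFunc.X_ne_zero
    obtain ⟨f, ⟨hfs, hfm⟩, hfv⟩ := Module.Dual.exists_forall_mem_ne_zero_of_forall_exists
      (restrictSupport (RatFunc F) (exponentPoint ⁻¹' Δ) ⊓ LinearMap.ker (jets m fun i ↦
        (LaurentPolynomial.evalUnit t (LaurentPolynomial.T (-(x i)) : F[T;T⁻¹]),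
          LaurentPolynomial.evalUnit t (LaurentPolynomial.T (-(y i)) : F[T;T⁻¹]))))
      (fun v ↦ lcoeff (RatFunc F) (d v)) fun v ↦ by
        refine exists_generic_of_infinite m
          (fun i ↦ (LaurentPolynomial.T (-(x i)), LaurentPolynomial.T (-(y i)))) rfl ?_ ?_
        · rw [Set.mem_preimage, hd]
          exact extremePoints_subset v.2
        · refine fun hfinite ↦ hinf ((hfinite.image Units.val).subset ?_)
          rintro a ⟨ha, f, -, hf, hfm⟩
          refine ⟨Units.mk0 a ha, ⟨f, ⟨support_subset_of_newtonPolygon_eq hf, ?_⟩, ?_⟩, rfl⟩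
          · rw [SetLike.mem_coe, LinearMap.mem_ker, jets_eq_zero_iff]
            simpa [LaurentPolynomial.evalUnit] using hfm
          · obtain ⟨e, he, hev⟩ := extremePoints_subset_of_newtonPolygon_eq hf v.2
            rw [← hd v] at hev
            rw [← exponentPoint_injective hev]
            exact mem_support_iff.1 he
    have hf : newtonPolygon f = Δ := hΔ.newtonPolygon_eq_iff.2
      ⟨hfs, fun v hv ↦ ⟨d ⟨v, hv⟩, mem_support_iff.2 (hfv ⟨v, hv⟩), hd ⟨v, hv⟩⟩⟩
    refine hK ⟨f, hΔ.ne_zero_of_newtonPolygon_eq hf, hf, ?_⟩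
    rw [SetLike.mem_coe, LinearMap.mem_ker, jets_eq_zero_iff] at hfm
    simpa [LaurentPolynomial.evalUnit, t] using hfm
  refine ⟨hfin, ?_⟩
  obtain ⟨a, ha⟩ := (hfin.insert 0).exists_notMem
  rw [Set.mem_insert_iff, not_or] at ha
  exact ⟨a, ha.1, fun h ↦ ha.2 ⟨ha.1, h⟩⟩
end

section
/- Let k ≥ 1 and n ≥ 1, and for each i = 1,…,n let Hᵢ be a finite family of affine hyperplanes in ℚᵏ, where an affine hyperplane is a set of the form {q ∈ ℚᵏ : u·q = c} with u ∈ ℚᵏ nonzero and c ∈ ℚ. Then there exist vectors v₁,…,vₙ ∈ ℤᵏ such that for every choice of k+1 pairwise distinct indices i₁,…,i_{k+1} ∈ {1,…,n} and every choice of hyperplanes L₁ ∈ H_{i₁},…,L_{k+1} ∈ H_{i_{k+1}}, the intersection of the translated hyperplanes (L₁ + v_{i₁}) ∩ … ∩ (L_{k+1} + v_{i_{k+1}}) is empty. -/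
/-- Finitely many nonzero polynomials over `ℚ` have a common non-root with integer coordinates. -/
theorem MvPolynomial.exists_int_forall_eval_ne_zero {σ ι : Type*} [Finite ι]
    (P : ι → MvPolynomial σ ℚ) (hP : ∀ i, P i ≠ 0) :
    ∃ x : σ → ℤ, ∀ i, MvPolynomial.eval (fun s => (x s : ℚ)) (P i) ≠ 0 := by
  have := Fintype.ofFinite ι
  by_contra! h
  refine Finset.prod_ne_zero_iff.mpr (fun i (_ : i ∈ Finset.univ) => hP i) ?_
  refine MvPolynomial.funext_set (fun _ : σ => Set.range ((↑) : ℤ → ℚ))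
    (fun _ => Set.infinite_range_of_injective Int.cast_injective) fun x hx => ?_
  choose y hy using fun s => hx s (Set.mem_univ s)
  obtain rfl : (fun s => (y s : ℚ)) = x := _root_.funext hy
  obtain ⟨i, hi⟩ := h y
  rw [map_prod, map_zero]
  exact Finset.prod_eq_zero (Finset.mem_univ i) hi

/-- If more than `k` hyperplanes of `ℚᵏ` are translated independently, then the translation vectors
for which the translates have a common point lie on the zero set of a nonzero polynomial. -/
theorem exists_polynomial_of_translates_meet {k : ℕ} {ι κ : Type*} [Fintype ι]
    (hι : k < Fintype.card ι) (idx : ι → κ) (hidx : Function.Injective idx)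
    (L : ι → (Fin k → ℚ) × ℚ) (hL : ∀ j, (L j).1 ≠ 0) :
    ∃ P : MvPolynomial (κ × Fin k) ℚ, P ≠ 0 ∧ ∀ (v : κ × Fin k → ℚ) (q : Fin k → ℚ),
      (∀ j, ∑ l, (L j).1 l * (q l - v (idx j, l)) = (L j).2) → MvPolynomial.eval v P = 0 := by
  classical
  have hdep : ¬ LinearIndependent ℚ (fun j => (L j).1) := fun h => by
    have := h.fintype_card_le_finrank
    rw [Module.finrank_fin_fun] at this
    lia
  obtain ⟨g, hg, j₀, hj₀⟩ := Fintype.not_linearIndependent_iff.mp hdep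
  obtain ⟨l₀, hl₀⟩ := Function.ne_iff.mp (hL j₀)
  let P : MvPolynomial (κ × Fin k) ℚ := ∑ j, MvPolynomial.C (g j) *
    (MvPolynomial.C (L j).2 + ∑ l, MvPolynomial.C ((L j).1 l) * MvPolynomial.X (idx j, l))
  have heval (v : κ × Fin k → ℚ) : MvPolynomial.eval v P =
      ∑ j, g j * ((L j).2 + ∑ l, (L j).1 l * v (idx j, l)) := by
    simp [P]
  refine ⟨P, fun hP => ?_, fun v q h => ?_⟩
  · have h0 := heval 0
    have h1 := heval (Pi.single (idx j₀, l₀) 1)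
    have hsum (j : ι) : ∑ l, (L j).1 l * (Pi.single (idx j₀, l₀) 1 : κ × Fin k → ℚ) (idx j, l) =
        if j = j₀ then (L j).1 l₀ else 0 := by
      by_cases hj : j = j₀ <;> simp [Pi.single_apply, hidx.eq_iff, hj]
    simp only [hsum, hP, map_zero, mul_add, Finset.sum_add_distrib, Pi.zero_apply, mul_zero,
      Finset.sum_const_zero, add_zero, mul_ite, Finset.sum_ite_eq', Finset.mem_univ,
      if_true] at h0 h1
    rw [← h0, zero_add] at h1
    exact mul_ne_zero hj₀ hl₀ h1.symm
  · have hcoord (l : Fin k) : ∑ j, g j * (L j).1 l = 0 := by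
      simpa using congrFun hg l
    have hq (j : ι) : (L j).2 + ∑ l, (L j).1 l * v (idx j, l) = ∑ l, (L j).1 l * q l := by
      rw [← h j, ← Finset.sum_add_distrib]
      exact Finset.sum_congr rfl fun l _ => by ring
    simp only [heval, hq, Finset.mul_sum]
    rw [Finset.sum_comm]
    simp only [← mul_assoc, ← Finset.sum_mul, hcoord, zero_mul, Finset.sum_const_zero]


/-- Finitely many finite families of affine hyperplanes in `ℚᵏ` can be
translated by integer vectors `v₁,…,vₙ` so that no `k+1` hyperplanes coming from `k+1`
pairwise distinct families have a common point. A hyperplane is encoded by a pair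
`(u, c)` with `u ≠ 0`, standing for `{q : u·q = c}`; its translate by `v` is
`{q : u·(q − v) = c}`. -/
theorem statement7 (k n : ℕ) (hk : 1 ≤ k) (hn : 1 ≤ n)
    (H : Fin n → Finset ((Fin k → ℚ) × ℚ))
    (hH : ∀ i, ∀ L ∈ H i, L.1 ≠ 0) :
    ∃ v : Fin n → Fin k → ℤ,
      ∀ idx : Fin (k + 1) → Fin n, Function.Injective idx →
        ∀ L : Fin (k + 1) → (Fin k → ℚ) × ℚ, (∀ j, L j ∈ H (idx j)) →
          ¬ ∃ q : Fin k → ℚ,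
              ∀ j, ∑ l, (L j).1 l * (q l - ((v (idx j) l : ℚ))) = (L j).2 := by
  classical
  choose P hP0 hP using fun p : {idx : Fin (k + 1) → Fin n // Function.Injective idx} ×
      (Fin (k + 1) → {L // L ∈ Finset.univ.biUnion H}) =>
    exists_polynomial_of_translates_meet (by simp) p.1.1 p.1.2 (fun j => (p.2 j).1) fun j => by
      obtain ⟨i, -, hi⟩ := Finset.mem_biUnion.mp (p.2 j).2
      exact hH i _ hi
  obtain ⟨x, hx⟩ := MvPolynomial.exists_int_forall_eval_ne_zero P hP0
  refine ⟨fun i l => x (i, l), fun idx hidx L hL ⟨q, hq⟩ => ?_⟩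
  exact hx _ (hP (⟨idx, hidx⟩, fun j =>
    ⟨L j, Finset.mem_biUnion.mpr ⟨idx j, Finset.mem_univ _, hL j⟩⟩) _ q hq)
end

section
/- Let n ≥ 1, k ≥ 1 and let A ⊂ ℤᵏ be a finite set. Then there exist points P₁,…,Pₙ ∈ ℤᵏ such that for every choice of k+1 pairwise distinct indices i₁,…,i_{k+1} ∈ {1,…,n} and every choice of vectors u₁,…,u_{k+1} ∈ D(A), there is no point q ∈ ℚᵏ satisfying uⱼ·(q − P_{iⱼ}) = 0 for all j = 1,…,k+1. (Equivalently, the tangent cones TC^Δ(P_{i₁}),…,TC^Δ(P_{i_{k+1}}) have empty common intersection, i.e. the points P₁,…,Pₙ are in general position with respect to the polytope Δ = conv(A).) -/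
/-- Finitely many nonzero linear functionals on `ℚ^ι` have a common integral non-zero. -/
theorem exists_int_forall_dual_ne_zero {ι κ : Type*} [Finite ι] [Finite κ]
    (f : κ → Module.Dual ℚ (ι → ℚ)) (hf : ∀ i, f i ≠ 0) :
    ∃ p : ι → ℤ, ∀ i, f i (fun x => (p x : ℚ)) ≠ 0 := by
  obtain ⟨v, hv⟩ := Module.Dual.exists_forall_ne_zero_of_forall_exists f
    fun i => by
      by_contra! h
      exact hf i (LinearMap.ext h)
  obtain ⟨b, hb⟩ := IsLocalization.exist_integer_multiples_of_finite (nonZeroDivisors ℤ) v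
  choose p hp using hb
  refine ⟨p, fun i => ?_⟩
  have hpv : (fun x => (p x : ℚ)) = ((b : ℤ) : ℚ) • v := by
    ext x
    simpa [Algebra.smul_def] using hp x
  rw [hpv, map_smul]
  exact smul_ne_zero (Int.cast_ne_zero.mpr (nonZeroDivisors.coe_ne_zero b)) (hv i)

/-- Any `k + 1` vectors of `ℚ^k` satisfy a nontrivial linear relation. -/
theorem exists_relation_of_succ {k : ℕ} (u : Fin (k + 1) → Fin k → ℚ) :
    ∃ c : Fin (k + 1) → ℚ, ∑ j, c j • u j = 0 ∧ ∃ j, c j ≠ 0 := by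
  have h : ¬ LinearIndependent ℚ u := fun h => by
    simpa using h.fintype_card_le_finrank
  exact Fintype.not_linearIndependent_iff.mp h

/-- The functional `P ↦ ∑ⱼ cⱼ (uⱼ · P_{idx j})` on configurations of `n` points of `ℚ^k`. -/
def configFunctional {n k : ℕ} (idx : Fin (k + 1) → Fin n) (u : Fin (k + 1) → Fin k → ℚ)
    (c : Fin (k + 1) → ℚ) : Module.Dual ℚ (Fin n × Fin k → ℚ) :=
  ∑ j, ∑ l, (c j * u j l) • LinearMap.proj (idx j, l)

theorem configFunctional_apply {n k : ℕ} (idx : Fin (k + 1) → Fin n)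
    (u : Fin (k + 1) → Fin k → ℚ) (c : Fin (k + 1) → ℚ) (v : Fin n × Fin k → ℚ) :
    configFunctional idx u c v = ∑ j, ∑ l, c j * u j l * v (idx j, l) := by
  simp [configFunctional, LinearMap.sum_apply]

theorem configFunctional_ne_zero {n k : ℕ} {idx : Fin (k + 1) → Fin n}
    (hidx : Function.Injective idx) {u : Fin (k + 1) → Fin k → ℚ} (hu : ∀ j, u j ≠ 0)
    {c : Fin (k + 1) → ℚ} {j : Fin (k + 1)} (hc : c j ≠ 0) :
    configFunctional idx u c ≠ 0 := by
  obtain ⟨l, hl⟩ := Function.ne_iff.mp (hu j)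
  intro h
  have h' := LinearMap.congr_fun h (Pi.single (idx j, l) 1)
  rw [configFunctional_apply, Finset.sum_eq_single j, Finset.sum_eq_single l] at h'
  · simp [hc] at h'
    exact hl h'
  · intro l' _ hl'
    simp [hl']
  · simp
  · intro j' _ hj'
    simp [hidx.ne hj']
  · simp

theorem configFunctional_eq_zero_of_mem_hyperplanes {n k : ℕ} {idx : Fin (k + 1) → Fin n}
    {u : Fin (k + 1) → Fin k → ℚ} {c : Fin (k + 1) → ℚ} (hc : ∑ j, c j • u j = 0)
    {v : Fin n × Fin k → ℚ} {q : Fin k → ℚ}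
    (hq : ∀ j, ∑ l, u j l * (q l - v (idx j, l)) = 0) :
    configFunctional idx u c v = 0 := by
  have h₁ : ∑ j, ∑ l, c j * u j l * q l = 0 := by
    rw [Finset.sum_comm]
    refine Finset.sum_eq_zero fun l _ => ?_
    rw [← Finset.sum_mul]
    simpa using Or.inl (by simpa using congrFun hc l)
  have h₂ : ∑ j, ∑ l, (c j * u j l * q l - c j * u j l * v (idx j, l)) = 0 := by
    refine Finset.sum_eq_zero fun j _ => ?_
    have h := congrArg (c j * ·) (hq j)
    simpa only [Finset.mul_sum, mul_sub, mul_zero, mul_assoc] using h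
  simp only [Finset.sum_sub_distrib] at h₂
  rw [configFunctional_apply]
  linarith

/-- For any finite set `A ⊂ ℤᵏ` there exist `n` points of `ℤᵏ` in general
position with respect to the polytope `conv(A)`: for any `k+1` pairwise distinct indices and
any normal directions `uⱼ` taken from the set `D(A)` of nonzero differences of elements of
`A`, the corresponding hyperplanes through the chosen points have no common point in `ℚᵏ`. -/
theorem statement8 (n k : ℕ) (hn : 1 ≤ n) (hk : 1 ≤ k)
    (A : Finset (Fin k → ℤ)) :
    ∃ P : Fin n → Fin k → ℤ,
      ∀ idx : Fin (k + 1) → Fin n, Function.Injective idx →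
        ∀ u : Fin (k + 1) → Fin k → ℤ,
          (∀ j, u j ≠ 0 ∧ ∃ a ∈ A, ∃ b ∈ A, u j = a - b) →
          ¬ ∃ q : Fin k → ℚ,
              ∀ j, ∑ l, (u j l : ℚ) * (q l - (P (idx j) l : ℚ)) = 0 := by
  choose c hc hc' using fun u : Fin (k + 1) → Fin k → ℚ => exists_relation_of_succ u
  let toRat : (Fin (k + 1) → Fin k → ℤ) → Fin (k + 1) → Fin k → ℚ := fun u j l => u j l
  let U : Set (Fin (k + 1) → Fin k → ℤ) :=
    {u | ∀ j, u j ≠ 0 ∧ ∃ a ∈ A, ∃ b ∈ A, u j = a - b}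
  have hU : U.Finite := by
    refine (Set.Finite.pi' fun _ : Fin (k + 1) =>
      (A.finite_toSet.image2 (fun a b => a - b) A.finite_toSet)).subset fun u hu j => ?_
    obtain ⟨-, a, ha, b, hb, h⟩ := hu j
    exact ⟨a, ha, b, hb, h.symm⟩
  have : Finite U := hU
  obtain ⟨p, hp⟩ := exists_int_forall_dual_ne_zero
    (fun i : {idx : Fin (k + 1) → Fin n // Function.Injective idx} × U =>
      configFunctional i.1.1 (toRat i.2.1) (c (toRat i.2.1))) fun i => by
    obtain ⟨j, hj⟩ := hc' (toRat i.2.1)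
    refine configFunctional_ne_zero i.1.2 (fun j h => (i.2.2 j).1 ?_) hj
    ext l
    exact Int.cast_eq_zero.mp (congrFun h l)
  refine ⟨fun i l => p (i, l), fun idx hidx u hu ⟨q, hq⟩ => ?_⟩
  exact hp (⟨idx, hidx⟩, ⟨u, hu⟩)
    (configFunctional_eq_zero_of_mem_hyperplanes (hc (toRat u)) hq)
end

section
/- Let n, m, ω be natural numbers with m ≥ 1, and let s₁,…,sₙ be natural numbers with sᵢ ≤ m for every i and Σᵢ₌₁ⁿ sᵢ ≤ ω. Write ω = m·k + k' with k, k' natural numbers and 0 ≤ k' < m. Then, as real numbers, Σᵢ₌₁ⁿ (m² − sᵢ²) ≥ (n − k − 1)·m² + (m − k')², and consequently Σᵢ₌₁ⁿ (m² − sᵢ²) ≥ (n − ω/m − 1)·m². -/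
/-- If `sᵢ ≤ m` and `Σ sᵢ ≤ ω = m·k + k'` with `0 ≤ k' < m`, then
`Σ (m² − sᵢ²) ≥ (n − k − 1)·m² + (m − k')²` and consequently
`Σ (m² − sᵢ²) ≥ (n − ω/m − 1)·m²` (as real numbers). -/
theorem statement10 (n m ω k k' : ℕ) (hm : 1 ≤ m)
    (s : Fin n → ℕ) (hs : ∀ i, s i ≤ m) (hsum : ∑ i, s i ≤ ω)
    (hω : ω = m * k + k') (hk' : k' < m) :
    ((n : ℝ) - (k : ℝ) - 1) * (m : ℝ) ^ 2 + ((m : ℝ) - (k' : ℝ)) ^ 2 ≤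
        ∑ i, ((m : ℝ) ^ 2 - (s i : ℝ) ^ 2) ∧
    ((n : ℝ) - (ω : ℝ) / (m : ℝ) - 1) * (m : ℝ) ^ 2 ≤
        ∑ i, ((m : ℝ) ^ 2 - (s i : ℝ) ^ 2) := by
  have hm0 : (m : ℝ) ≠ 0 := by positivity
  have hsq : ∑ i, (s i : ℝ) ^ 2 ≤ m * ω := calc
    ∑ i, (s i : ℝ) ^ 2 ≤ ∑ i, (m : ℝ) * s i := by
      gcongr with i
      rw [sq]
      gcongr
      exact hs i
    _ = m * ∑ i, (s i : ℝ) := by rw [Finset.mul_sum]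
    _ ≤ m * ω := by
      gcongr
      exact_mod_cast hsum
  have hω' : (ω : ℝ) = m * k + k' := by exact_mod_cast hω
  have hk : (0 : ℝ) ≤ k' * (m - k') :=
    mul_nonneg k'.cast_nonneg (sub_nonneg.2 (by exact_mod_cast hk'.le))
  have hdiv : (ω : ℝ) / m * (m : ℝ) ^ 2 = m * ω := by field_simp
  simp only [Finset.sum_sub_distrib, Finset.sum_const, Finset.card_univ, Fintype.card_fin,
    nsmul_eq_mul]
  constructor
  · rw [hω'] at hsq
    linarith
  · linarith [sq_nonneg (m : ℝ)]
end

section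
/- Let d, m, n be real numbers with d ≥ 0, m > 0 and n ≥ 4. If d² ≥ (n − d/m − 1)·m², then d ≥ (√n − 1/2 − 1/√n)·m. -/
/-- If `d ≥ 0`, `m > 0`, `n ≥ 4` and `d² ≥ (n − d/m − 1)·m²`, then
`d ≥ (√n − 1/2 − 1/√n)·m`. -/
theorem statement11 (d m n : ℝ) (hd : 0 ≤ d) (hm : 0 < m) (hn : 4 ≤ n)
    (h : d ^ 2 ≥ (n - d / m - 1) * m ^ 2) :
    d ≥ (Real.sqrt n - 1 / 2 - 1 / Real.sqrt n) * m := by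
  have hx : 0 ≤ d / m := div_nonneg hd hm.le
  have h' : n - d / m - 1 ≤ (d / m) ^ 2 := by
    rw [div_pow]
    exact (le_div_iff₀ (pow_pos hm 2)).mpr h
  refine (le_div_iff₀ hm).mp ?_
  have hs : 2 ≤ √n := Real.le_sqrt_of_sq_le (by linarith)
  have hsn : √n ^ 2 = n := Real.sq_sqrt (by linarith)
  have hsu : √n * (1 / √n) = 1 := mul_one_div_cancel (by linarith)
  have hu : 0 ≤ 1 / √n := by positivity
  have hu' : 1 / √n ≤ 1 / 2 := one_div_le_one_div_of_le two_pos hs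
  generalize d / m = x at *
  generalize 1 / √n = u at *
  by_contra! hlt
  have hsq : (x + 1 / 2) ^ 2 < (√n - u) ^ 2 :=
    pow_lt_pow_left₀ (by linarith) (by linarith) two_ne_zero
  nlinarith
end

section
/- Let K be a field, let p₁ ≠ p₂ be two distinct points of K², and let m₁ ≥ m₂ ≥ 1 be integers. Then: (a) there exists a nonzero polynomial f ∈ K[x,y] of total degree m₁ with μ_{p₁}(f) ≥ m₁ and μ_{p₂}(f) ≥ m₂ (namely the m₁-th power of a linear form vanishing on the line through p₁ and p₂); and (b) every nonzero polynomial f ∈ K[x,y] with μ_{p₁}(f) ≥ m₁ has total degree ≥ m₁. Hence the minimal total degree of a nonzero polynomial passing through p₁, p₂ with multiplicities at least m₁, m₂ equals m₁. -/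
open MvPolynomial

/-- The translation `f(x, y) ↦ f(x + p.1, y + p.2)`. -/
noncomputable def translateHom {K : Type*} [CommRing K] (p : K × K) :
    MvPolynomial (Fin 2) K →ₐ[K] MvPolynomial (Fin 2) K :=
  aeval ![X 0 + C p.1, X 1 + C p.2]

lemma translateHom_injective {K : Type*} [CommRing K] (p : K × K) :
    Function.Injective (translateHom p) := by
  have h : (translateHom (-p)).comp (translateHom p) = AlgHom.id K _ := by
    ext i : 1
    fin_cases i <;> simp [translateHom]
  exact Function.LeftInverse.injective (g := translateHom (-p)) fun f => DFunLike.congr_fun h f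

lemma totalDegree_translateHom_le {K : Type*} [CommRing K] (p : K × K)
    (f : MvPolynomial (Fin 2) K) : (translateHom p f).totalDegree ≤ f.totalDegree := by
  have hX : ∀ (i : Fin 2) (c : K), (X i + C c : MvPolynomial (Fin 2) K).totalDegree ≤ 1 := by
    intro i c
    refine (totalDegree_add _ _).trans (max_le ?_ (by simp))
    exact (totalDegree_monomial_le _ _).trans (by simp)
  rw [translateHom, aeval_def, eval₂_eq']
  refine totalDegree_finsetSum_le fun d hd => ?_
  have hd' := le_totalDegree hd
  rw [Finsupp.sum_fintype _ _ (fun _ => rfl), Fin.sum_univ_two] at hd'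
  refine le_trans ?_ hd'
  rw [Fin.prod_univ_two, algebraMap_eq]
  refine (totalDegree_mul _ _).trans ?_
  rw [totalDegree_C, zero_add]
  refine (totalDegree_mul _ _).trans (add_le_add ?_ ?_)
  · exact (totalDegree_pow _ _).trans (by simpa using Nat.mul_le_mul_left (d 0) (hX 0 p.1))
  · exact (totalDegree_pow _ _).trans (by simpa using Nat.mul_le_mul_left (d 1) (hX 1 p.2))

lemma multAtLeast.translateHom_mem {K : Type*} [CommRing K] {p : K × K} {m : ℕ}
    {f : MvPolynomial (Fin 2) K} (h : multAtLeast p m f) :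
    translateHom p f ∈ idealOfVars (Fin 2) K ^ m := by
  have h' := Ideal.mem_map_of_mem (translateHom p) h
  rw [Ideal.map_pow, Ideal.map_span] at h'
  refine Ideal.pow_right_mono (Ideal.span_le.2 ?_) m h'
  rintro _ ⟨g, rfl | rfl, rfl⟩
  · exact Ideal.subset_span ⟨0, by simp [translateHom, ← algebraMap_eq]⟩
  · exact Ideal.subset_span ⟨1, by simp [translateHom, ← algebraMap_eq]⟩

lemma multAtLeast.le_totalDegree {K : Type*} [CommRing K] {p : K × K} {m : ℕ}
    {f : MvPolynomial (Fin 2) K} (h : multAtLeast p m f) (hf : f ≠ 0) :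
    m ≤ f.totalDegree := by
  refine le_trans ?_ (totalDegree_translateHom_le p f)
  have hne : translateHom p f ≠ 0 := (map_ne_zero_iff _ (translateHom_injective p)).2 hf
  obtain ⟨d, hd⟩ := ne_zero_iff.1 hne
  have hm := (mem_pow_idealOfVars_iff' m _).1 h.translateHom_mem d
  by_contra! hlt
  refine hd (hm (lt_of_le_of_lt ?_ hlt))
  exact MvPolynomial.le_totalDegree (mem_support_iff.2 hd)

/-- An equation of the line through `p` and `q`. -/
noncomputable def lineThrough {K : Type*} [CommRing K] (p q : K × K) : MvPolynomial (Fin 2) K :=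
  C (q.2 - p.2) * (X 0 - C p.1) - C (q.1 - p.1) * (X 1 - C p.2)

lemma lineThrough_ne_zero {K : Type*} [CommRing K] {p q : K × K} (hpq : p ≠ q) :
    lineThrough p q ≠ 0 := by
  intro h
  have h0 := congrArg (eval ![p.1 + 1, p.2]) h
  have h1 := congrArg (eval ![p.1, p.2 + 1]) h
  simp only [lineThrough, map_sub, map_mul, eval_C, eval_X, map_zero, Matrix.cons_val_zero,
    Matrix.cons_val_one] at h0 h1
  exact hpq (Prod.ext (by linear_combination h1) (by linear_combination -h0))

lemma totalDegree_lineThrough_le {K : Type*} [CommRing K] (p q : K × K) :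
    (lineThrough p q).totalDegree ≤ 1 := by
  have hX : ∀ (i : Fin 2) (a c : K),
      (C a * (X i - C c) : MvPolynomial (Fin 2) K).totalDegree ≤ 1 := by
    intro i a c
    refine (totalDegree_mul _ _).trans ?_
    rw [totalDegree_C, zero_add]
    refine (totalDegree_sub _ _).trans (max_le ?_ (by simp))
    exact (totalDegree_monomial_le _ _).trans (by simp)
  exact (totalDegree_sub _ _).trans (max_le (hX _ _ _) (hX _ _ _))

lemma lineThrough_mem_left {K : Type*} [CommRing K] (p q : K × K) :
    lineThrough p q ∈ Ideal.span {X 0 - C p.1, X 1 - C p.2} :=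
  sub_mem (Ideal.mul_mem_left _ _ (Ideal.subset_span (by simp)))
    (Ideal.mul_mem_left _ _ (Ideal.subset_span (by simp)))

lemma lineThrough_swap {K : Type*} [CommRing K] (p q : K × K) :
    lineThrough q p = -lineThrough p q := by
  simp only [lineThrough, map_sub]
  ring

lemma lineThrough_mem_right {K : Type*} [CommRing K] (p q : K × K) :
    lineThrough p q ∈ Ideal.span {X 0 - C q.1, X 1 - C q.2} := by
  rw [lineThrough_swap q p]
  exact neg_mem (lineThrough_mem_left q p)

/-- For two distinct points and `m₁ ≥ m₂ ≥ 1`: (a) there is a nonzero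
polynomial of total degree `m₁` with `μ_{p}(f) ≥ m₁`, `μ_{q}(f) ≥ m₂`; (b) any nonzero
polynomial with `μ_{p}(f) ≥ m₁` has total degree `≥ m₁`; hence the minimal such total
degree equals `m₁`. -/
theorem statement14 (K : Type*) [Field K] (p q : K × K) (hpq : p ≠ q)
    (m₁ m₂ : ℕ) (h21 : m₂ ≤ m₁) (h2 : 1 ≤ m₂) :
    (∃ f : MvPolynomial (Fin 2) K, f ≠ 0 ∧ f.totalDegree = m₁ ∧
      multAtLeast p m₁ f ∧ multAtLeast q m₂ f) ∧
    (∀ f : MvPolynomial (Fin 2) K, f ≠ 0 → multAtLeast p m₁ f → m₁ ≤ f.totalDegree) ∧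
    IsLeast { e : ℕ | ∃ f : MvPolynomial (Fin 2) K, f ≠ 0 ∧ f.totalDegree = e ∧
      multAtLeast p m₁ f ∧ multAtLeast q m₂ f } m₁ := by
  have hline : ∃ f : MvPolynomial (Fin 2) K, f ≠ 0 ∧ f.totalDegree = m₁ ∧
      multAtLeast p m₁ f ∧ multAtLeast q m₂ f := by
    have hne := pow_ne_zero m₁ (lineThrough_ne_zero hpq)
    have hp : multAtLeast p m₁ (lineThrough p q ^ m₁) :=
      Ideal.pow_mem_pow (lineThrough_mem_left p q) m₁
    refine ⟨lineThrough p q ^ m₁, hne, le_antisymm ?_ (hp.le_totalDegree hne), hp,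
      Ideal.pow_le_pow_right h21 (Ideal.pow_mem_pow (lineThrough_mem_right p q) m₁)⟩
    simpa using (totalDegree_pow _ _).trans
      (Nat.mul_le_mul_left m₁ (totalDegree_lineThrough_le p q))
  refine ⟨hline, fun f hf h => h.le_totalDegree hf, hline, ?_⟩
  rintro _ ⟨f, hf, rfl, h, -⟩
  exact h.le_totalDegree hf
end

section
/- Let F be a field and let M be an m × n matrix with entries in the polynomial ring F[t]. Regard M also as a matrix over the field of rational functions F(t) (Mathlib's RatFunc F). If the only vector x ∈ (F(t))ⁿ with M·x = 0 is x = 0, then the set of elements a ∈ F such that the specialized matrix M(a) ∈ Matrix (Fin m) (Fin n) F (obtained by evaluating every entry of M at t = a) has a nonzero vector in its kernel is finite. -/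
/-- A matrix over a domain whose kernel over the fraction field is trivial has a left inverse
up to a nonzero scalar. -/
theorem Matrix.exists_mul_eq_smul_one_of_mulVec_eq_zero {R K m n : Type*} [CommRing R] [IsDomain R]
    [Field K] [Algebra R K] [IsFractionRing R K] [Fintype m] [Fintype n] [DecidableEq n]
    (M : Matrix m n R)
    (h : ∀ x : n → K, (M.map (algebraMap R K)).mulVec x = 0 → x = 0) :
    ∃ (b : R) (N : Matrix n m R), b ≠ 0 ∧ N * M = b • (1 : Matrix n n R) := by
  classical
  obtain ⟨g, hg⟩ := LinearMap.exists_leftInverse_of_injective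
    (Matrix.toLin' (M.map (algebraMap R K))) (LinearMap.ker_eq_bot'.2 fun x hx => h x hx)
  have hB : LinearMap.toMatrix' g * M.map (algebraMap R K) = 1 := by
    rw [← LinearMap.toMatrix'_toLin' (M.map (algebraMap R K)), ← LinearMap.toMatrix'_comp, hg,
      LinearMap.toMatrix'_id]
  obtain ⟨b, hb⟩ := IsLocalization.exist_integer_multiples_of_finite (nonZeroDivisors R)
    fun p : n × m => LinearMap.toMatrix' g p.1 p.2
  choose N hN using hb
  have hN' : (Matrix.of fun i j => N (i, j)).map (algebraMap R K) =
      (b : R) • LinearMap.toMatrix' g := by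
    ext i j
    exact hN (i, j)
  refine ⟨b, Matrix.of fun i j => N (i, j), nonZeroDivisors.coe_ne_zero b, ?_⟩
  apply Matrix.map_injective (IsFractionRing.injective R K)
  beta_reduce
  rw [Matrix.map_mul, hN', Matrix.smul_mul, hB]
  ext i j
  by_cases hij : i = j <;> simp [hij, Algebra.algebraMap_eq_smul_one]

/-- A homogeneous linear system with polynomial coefficients that has only
the trivial solution over `F(t)` has only the trivial solution after specializing `t` to all
but finitely many values `a ∈ F`. -/
theorem statement15 (F : Type*) [Field F] (m n : ℕ)
    (M : Matrix (Fin m) (Fin n) (Polynomial F))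
    (h : ∀ x : Fin n → RatFunc F,
      (M.map (algebraMap (Polynomial F) (RatFunc F))).mulVec x = 0 → x = 0) :
    { a : F | ∃ x : Fin n → F, x ≠ 0 ∧
        (M.map fun q => Polynomial.eval a q).mulVec x = 0 }.Finite := by
  obtain ⟨b, N, hb, hNM⟩ := M.exists_mul_eq_smul_one_of_mulVec_eq_zero h
  refine (Polynomial.finite_setOfPred_isRoot hb).subset ?_
  rintro a ⟨x, hx, hMx⟩
  have hev : N.map (Polynomial.evalRingHom a) * M.map (Polynomial.evalRingHom a) =
      b.eval a • (1 : Matrix (Fin n) (Fin n) F) := by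
    rw [← Matrix.map_mul, hNM]
    ext i j
    by_cases hij : i = j <;> simp [hij]
  have hbx : b.eval a • x = 0 := by
    rw [← Matrix.one_mulVec x, ← Matrix.smul_mulVec, ← hev, ← Matrix.mulVec_mulVec]
    exact (congrArg _ hMx).trans (Matrix.mulVec_zero _)
  exact (smul_eq_zero.1 hbx).resolve_right hx
end

section
/- Let F be an infinite field and let d, N, m, n be positive integers with m ≤ d ≤ N and, as real numbers, d·N < ½·(n − d/m − 1)·m². Then there exist points p₁,…,pₙ ∈ F² such that there is no nonzero polynomial C ∈ F[x,y] whose Newton polygon equals the rectangle [0,d] × [0,N] (the convex hull of (0,0), (d,0), (0,N), (d,N)) and such that μ_{pᵢ}(C) ≥ m for every i = 1,…,n. -/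
open MvPolynomial

/-- The restriction of a bivariate polynomial to the diagonal `x = y`. -/
noncomputable def diagonalRestriction (K : Type*) [CommRing K] :
    MvPolynomial (Fin 2) K →ₐ[K] Polynomial K :=
  aeval fun _ => Polynomial.X

/-- A diagonal point of multiplicity at least `m` is a root of order at least `m` of the
restriction to the diagonal. -/
lemma multAtLeast.X_sub_C_pow_dvd_diagonalRestriction {K : Type*} [CommRing K] {a : K} {m : ℕ}
    {f : MvPolynomial (Fin 2) K} (h : multAtLeast (a, a) m f) :
    (Polynomial.X - Polynomial.C a) ^ m ∣ diagonalRestriction K f := by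
  have hle : Ideal.map (diagonalRestriction K)
      (Ideal.span {X 0 - C a, X 1 - C a} : Ideal (MvPolynomial (Fin 2) K)) ≤
      Ideal.span {Polynomial.X - Polynomial.C a} := by
    rw [Ideal.map_span, Ideal.span_le]
    rintro _ ⟨g, hg, rfl⟩
    rcases hg with rfl | rfl <;>
      simp [diagonalRestriction, ← Polynomial.algebraMap_eq]
  have hmem := Ideal.pow_right_mono hle m
    (Ideal.map_pow (diagonalRestriction K) _ m ▸ Ideal.mem_map_of_mem (diagonalRestriction K) h)
  rwa [Ideal.span_singleton_pow, Ideal.mem_span_singleton] at hmem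

lemma coeff_diagonalRestriction {K : Type*} [CommRing K] (f : MvPolynomial (Fin 2) K) (k : ℕ) :
    (diagonalRestriction K f).coeff k =
      ∑ e ∈ f.support, if k = e 0 + e 1 then f.coeff e else 0 := by
  rw [diagonalRestriction, aeval_def, eval₂_eq', Polynomial.finsetSum_coeff]
  refine Finset.sum_congr rfl fun e _ => ?_
  rw [Fin.prod_univ_two, ← pow_add, Polynomial.algebraMap_eq, Polynomial.coeff_C_mul_X_pow]

lemma le_of_mem_support_of_newtonPolygon_subset {K : Type*} [CommRing K]
    {f : MvPolynomial (Fin 2) K} {d N : ℕ}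
    (h : newtonPolygon f ⊆ Set.Iic ((d : ℝ), (N : ℝ)))
    {e : Fin 2 →₀ ℕ} (he : e ∈ f.support) : e 0 ≤ d ∧ e 1 ≤ N := by
  have := h (subset_convexHull ℝ _ ⟨e, he, rfl⟩)
  simpa using this

/-- The top right corner of the Newton polygon, if it exists, is an exponent. -/
lemma exists_mem_support_of_corner_mem_newtonPolygon {K : Type*} [CommRing K]
    {f : MvPolynomial (Fin 2) K} {d N : ℕ}
    (h : newtonPolygon f ⊆ Set.Iic ((d : ℝ), (N : ℝ)))
    (hc : ((d : ℝ), (N : ℝ)) ∈ newtonPolygon f) :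
    ∃ e ∈ f.support, e 0 = d ∧ e 1 = N := by
  by_contra! hne
  have hsub : newtonPolygon f ⊆
      {q : ℝ × ℝ | (LinearMap.fst ℝ ℝ ℝ + LinearMap.snd ℝ ℝ ℝ) q ≤ (d : ℝ) + N - 1} := by
    refine convexHull_min ?_ (convex_halfSpace_le (LinearMap.isLinear _) _)
    rintro _ ⟨e, he, rfl⟩
    have hle := le_of_mem_support_of_newtonPolygon_subset h he
    have hlt : e 0 + e 1 + 1 ≤ d + N := by
      have := hne e he
      omega
    have : (e 0 : ℝ) + e 1 + 1 ≤ d + N := mod_cast hlt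
    simp only [Set.mem_ofPred_eq, LinearMap.add_apply, LinearMap.fst_apply, LinearMap.snd_apply]
    linarith
  have := hsub hc
  simp only [Set.mem_ofPred_eq, LinearMap.add_apply, LinearMap.fst_apply, LinearMap.snd_apply]
    at this
  linarith

lemma natDegree_diagonalRestriction_le {K : Type*} [CommRing K]
    {f : MvPolynomial (Fin 2) K} {d N : ℕ}
    (h : newtonPolygon f ⊆ Set.Iic ((d : ℝ), (N : ℝ))) :
    (diagonalRestriction K f).natDegree ≤ d + N := by
  refine Polynomial.natDegree_le_iff_coeff_eq_zero.2 fun k hk => ?_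
  rw [coeff_diagonalRestriction]
  refine Finset.sum_eq_zero fun e he => if_neg ?_
  have := le_of_mem_support_of_newtonPolygon_subset h he
  omega

lemma diagonalRestriction_ne_zero {K : Type*} [CommRing K]
    {f : MvPolynomial (Fin 2) K} {d N : ℕ}
    (h : newtonPolygon f ⊆ Set.Iic ((d : ℝ), (N : ℝ)))
    (hc : ((d : ℝ), (N : ℝ)) ∈ newtonPolygon f) :
    diagonalRestriction K f ≠ 0 := by
  obtain ⟨e, he, rfl, rfl⟩ := exists_mem_support_of_corner_mem_newtonPolygon h hc
  intro h0
  have hcoeff := coeff_diagonalRestriction f (e 0 + e 1)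
  rw [Finset.sum_eq_single_of_mem e he, if_pos rfl, h0, Polynomial.coeff_zero] at hcoeff
  · exact mem_support_iff.1 he hcoeff.symm
  · intro e' he' hne
    refine if_neg fun heq => hne ?_
    have := le_of_mem_support_of_newtonPolygon_subset h he'
    ext i
    fin_cases i <;> simp <;> omega

/-- A nonzero polynomial has degree at least `n * m` if it vanishes to order `m` at `n` points. -/
lemma mul_le_natDegree_of_X_sub_C_pow_dvd {K : Type*} [Field K] {n m : ℕ} {a : Fin n → K}
    (ha : Function.Injective a) {g : Polynomial K} (hg : g ≠ 0)
    (h : ∀ i, (Polynomial.X - Polynomial.C (a i)) ^ m ∣ g) : n * m ≤ g.natDegree := by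
  have hdvd : ∏ i, (Polynomial.X - Polynomial.C (a i)) ^ m ∣ g :=
    Fintype.prod_dvd_of_coprime
      (fun i j hij => (Polynomial.pairwise_coprime_X_sub_C ha hij).pow) h
  have hdeg := Polynomial.natDegree_le_of_dvd hdvd hg
  rw [Polynomial.natDegree_prod_of_monic _ _
    fun i _ => (Polynomial.monic_X_sub_C (a i)).pow m] at hdeg
  simpa [Polynomial.natDegree_pow] using hdeg

/-- (Code-theoretic example.) If `m ≤ d ≤ N` and
`d·N < ½·(n − d/m − 1)·m²`, then over an infinite field there exist `n` points such that no
nonzero polynomial with Newton polygon the rectangle `[0,d] × [0,N]` passes through all of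
them with multiplicity `≥ m`. -/
theorem statement17 (F : Type*) [Field F] [Infinite F]
    (d N m n : ℕ) (hd : 1 ≤ d) (hN : 1 ≤ N) (hm : 1 ≤ m) (hn : 1 ≤ n)
    (hmd : m ≤ d) (hdN : d ≤ N)
    (harea : (d : ℝ) * (N : ℝ) < (1 / 2) * ((n : ℝ) - (d : ℝ) / (m : ℝ) - 1) * (m : ℝ) ^ 2) :
    ∃ p : Fin n → F × F, ¬ ∃ Cf : MvPolynomial (Fin 2) F, Cf ≠ 0 ∧
      newtonPolygon Cf =
        convexHull ℝ ({((0 : ℝ), (0 : ℝ)), ((d : ℝ), (0 : ℝ)),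
          ((0 : ℝ), (N : ℝ)), ((d : ℝ), (N : ℝ))} : Set (ℝ × ℝ)) ∧
      ∀ i, multAtLeast (p i) m Cf := by
  obtain ⟨a, ha⟩ : ∃ a : Fin n → F, Function.Injective a :=
    ⟨fun i => Infinite.natEmbedding F i,
      (Infinite.natEmbedding F).injective.comp Fin.val_injective⟩
  refine ⟨fun i => (a i, a i), ?_⟩
  rintro ⟨f, -, hf, hmult⟩
  have hsub : newtonPolygon f ⊆ Set.Iic ((d : ℝ), (N : ℝ)) := by
    rw [hf]
    refine convexHull_min ?_ (convex_Iic _)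
    rintro q (rfl | rfl | rfl | rfl) <;> simp
  have hcorner : ((d : ℝ), (N : ℝ)) ∈ newtonPolygon f := by
    rw [hf]
    exact subset_convexHull ℝ _ (by simp)
  have hle : n * m ≤ d + N :=
    (mul_le_natDegree_of_X_sub_C_pow_dvd ha (diagonalRestriction_ne_zero hsub hcorner)
      fun i => (hmult i).X_sub_C_pow_dvd_diagonalRestriction).trans
      (natDegree_diagonalRestriction_le hsub)
  have hle' : (n : ℝ) * m ≤ d + N := mod_cast hle
  have hm' : (0 : ℝ) < m := mod_cast hm
  have hmd' : (m : ℝ) ≤ d := mod_cast hmd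
  have harea' : 2 * ((d : ℝ) * N) < (n * m - d - m) * m := by
    have : (1 / 2) * ((n : ℝ) - (d : ℝ) / (m : ℝ) - 1) * (m : ℝ) ^ 2 =
        (n * m - d - m) * m / 2 := by field_simp
    linarith
  have hN' : (0 : ℝ) ≤ N := N.cast_nonneg
  nlinarith [mul_le_mul_of_nonneg_right hmd' hN', mul_le_mul_of_nonneg_right hle' hm'.le,
    mul_nonneg hN' hm'.le, mul_pos hm' hm']
end
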